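/- Every bridgeless 3-regular graph with oddness k ≥ 2 on n vertices admits a 1-bend RAC drawing of O(n²) area in which at most k edges are drawn with a bend (all remaining edges are drawn as single straight-line segments). -/

import Mathlib

open scoped Classical

noncomputable section

/-- A point of the Euclidean plane. -/
abbrev Pt : Type := ℝ × ℝ

/-- The segments with endpoints `a, b` and `c, d` are orthogonal:
their direction vectors have zero inner product. -/
def SegOrth (a b c d : Pt) : Prop :=
  (b.1 - a.1) * (d.1 - c.1) + (b.2 - a.2) * (d.2 - c.2) = 0

/-- The degree of a vertex in a simple graph. -/
def vdeg {V : Type*} (G : SimpleGraph V) (v : V) : ℕ := (G.neighborSet v).ncard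

/-- `M` is a matching in `G`: a set of edges of `G` that are pairwise non-adjacent. -/
def IsMatchingOn {V : Type*} (G : SimpleGraph V) (M : Set (Sym2 V)) : Prop :=
  M ⊆ G.edgeSet ∧ ∀ e ∈ M, ∀ f ∈ M, e ≠ f → ∀ v : V, v ∈ e → v ∉ f

/-- `G` is `k`-edge-colorable: its edge set is partitioned into `k` matchings. -/
def EdgeColorable {V : Type*} (G : SimpleGraph V) (k : ℕ) : Prop :=
  ∃ M : Fin k → Set (Sym2 V),
    (∀ i, IsMatchingOn G (M i)) ∧
    (∀ i j, i ≠ j → Disjoint (M i) (M j)) ∧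
    (⋃ i, M i) = G.edgeSet

/-- `p` is a straight-line RAC drawing of `G`: vertices are at pairwise distinct points,
each edge is the closed segment between its endpoints, no edge passes through another
vertex, edges sharing an endpoint meet only there, and any two edges with no common
endpoint that intersect do so orthogonally. -/
structure IsRACDrawing {V : Type*} (G : SimpleGraph V) (p : V → Pt) : Prop where
  inj : Function.Injective p
  vertex_off : ∀ u v w : V, G.Adj u v → w ≠ u → w ≠ v →
    p w ∉ segment ℝ (p u) (p v)
  shared : ∀ u v w : V, G.Adj u v → G.Adj u w → v ≠ w →
    segment ℝ (p u) (p v) ∩ segment ℝ (p u) (p w) ⊆ {p u}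
  rac : ∀ u v u' v' : V, G.Adj u v → G.Adj u' v' →
    u ≠ u' → u ≠ v' → v ≠ u' → v ≠ v' →
    (segment ℝ (p u) (p v) ∩ segment ℝ (p u') (p v')).Nonempty →
    SegOrth (p u) (p v) (p u') (p v')

/-- All points of `P` are integer grid points lying in an axis-aligned square
of side length `side`. -/
def InGridSquare (side : ℝ) (P : Set Pt) : Prop :=
  (∀ q ∈ P, ∃ a b : ℤ, q = ((a : ℝ), (b : ℝ))) ∧
  ∃ x0 y0 : ℝ, ∀ q ∈ P, x0 ≤ q.1 ∧ q.1 ≤ x0 + side ∧ y0 ≤ q.2 ∧ q.2 ≤ y0 + side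

/-- The list of consecutive segments (as pairs of endpoints) of a polyline given
by its list of points. -/
def polySegs (l : List Pt) : List (Pt × Pt) := l.zip l.tail

/-- The set of plane points covered by a polyline given by its list of points. -/
def polySet (l : List Pt) : Set Pt := ⋃ s ∈ polySegs l, segment ℝ s.1 s.2

/-- `p, poly` is a `k`-bend RAC drawing of `G`: each edge `e` is drawn as the polyline
through the list of points `poly e` (at most `k + 1` segments, i.e. at most `k + 2`
points) joining the two endpoints of `e`; no edge passes through another vertex; edges
sharing an endpoint meet only at that endpoint; any two distinct edges intersect in
finitely many points; and wherever segments of two distinct edges meet (other than at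
the point of a common endvertex) the two segments are orthogonal. -/
structure IsBendRACDrawing {V : Type*} (k : ℕ) (G : SimpleGraph V)
    (p : V → Pt) (poly : Sym2 V → List Pt) : Prop where
  inj : Function.Injective p
  ends : ∀ e ∈ G.edgeSet, ∃ u v : V, e = s(u, v) ∧
    (poly e).head? = some (p u) ∧ (poly e).getLast? = some (p v)
  nsegs : ∀ e ∈ G.edgeSet, 2 ≤ (poly e).length ∧ (poly e).length ≤ k + 2
  vertex_off : ∀ e ∈ G.edgeSet, ∀ w : V, w ∉ e → p w ∉ polySet (poly e)
  shared : ∀ e ∈ G.edgeSet, ∀ e' ∈ G.edgeSet, e ≠ e' → ∀ w : V, w ∈ e → w ∈ e' →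
    polySet (poly e) ∩ polySet (poly e') ⊆ {p w}
  fin_inter : ∀ e ∈ G.edgeSet, ∀ e' ∈ G.edgeSet, e ≠ e' →
    (polySet (poly e) ∩ polySet (poly e')).Finite
  rac : ∀ e ∈ G.edgeSet, ∀ e' ∈ G.edgeSet, e ≠ e' →
    ∀ s ∈ polySegs (poly e), ∀ s' ∈ polySegs (poly e'),
    ∀ x : Pt, x ∈ segment ℝ s.1 s.2 → x ∈ segment ℝ s'.1 s'.2 →
    (∀ w : V, w ∈ e → w ∈ e' → x ≠ p w) →
    SegOrth s.1 s.2 s'.1 s'.2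

/-- All vertex points and bend points of a polyline drawing. -/
def drawingPoints {V : Type*} (G : SimpleGraph V) (p : V → Pt)
    (poly : Sym2 V → List Pt) : Set Pt :=
  Set.range p ∪ {q | ∃ e ∈ G.edgeSet, q ∈ poly e}

/-- `F` is (the edge set of) a 2-factor of `G`: a spanning subgraph in which every
vertex has degree exactly 2. -/
def Is2Factor {V : Type*} (G : SimpleGraph V) (F : Set (Sym2 V)) : Prop :=
  F ⊆ G.edgeSet ∧ ∀ v : V, {e ∈ F | v ∈ e}.ncard = 2

/-- The connected components of the (2-regular) spanning subgraph with edge set `F`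
that are odd cycles, i.e. have an odd number of vertices. -/
def oddComps {V : Type*} (F : Set (Sym2 V)) :
    Set ((SimpleGraph.fromEdgeSet F).ConnectedComponent) :=
  {C | Odd C.supp.ncard}

/-- `G` has oddness `k`: the minimum over all 2-factors of the number of odd-cycle
components equals `k` (in particular a 2-factor exists). -/
def HasOddness {V : Type*} (G : SimpleGraph V) (k : ℕ) : Prop :=
  (∃ F, Is2Factor G F ∧ (oddComps F).ncard = k) ∧
  (∀ F, Is2Factor G F → k ≤ (oddComps F).ncard)

/-- `G` has no cut-edge. -/
def Bridgeless {V : Type*} (G : SimpleGraph V) : Prop := ∀ e, ¬ G.IsBridge e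

/-- orbit relation of two maps -/
def Orb {V : Type*} (f g : V → V) (a b : V) : Prop :=
  ∀ T : Set V, a ∈ T → (∀ x ∈ T, f x ∈ T ∧ g x ∈ T) → b ∈ T

theorem Orb.rfl' {V : Type*} {f g : V → V} (a : V) : Orb f g a a := fun _ h _ => h

theorem Orb.trans' {V : Type*} {f g : V → V} {a b c : V} (h1 : Orb f g a b) (h2 : Orb f g b c) :
    Orb f g a c := fun T h hc => h2 T (h1 T h hc) hc

theorem Orb.f_right {V : Type*} {f g : V → V} (a : V) : Orb f g a (f a) :=
  fun _ h hc => (hc _ h).1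

theorem Orb.g_right {V : Type*} {f g : V → V} (a : V) : Orb f g a (g a) :=
  fun _ h hc => (hc _ h).2

theorem Orb.symm' {V : Type*} {f g : V → V} (hf : Function.Involutive f)
    (hg : Function.Involutive g) {a b : V} (h : Orb f g a b) : Orb f g b a := by
  refine h {x | Orb f g x a} (Orb.rfl' a) ?_
  intro x hx
  constructor
  · have := Orb.f_right (f := f) (g := g) (f x)
    rw [hf x] at this
    exact this.trans' hx
  · have := Orb.g_right (f := f) (g := g) (g x)
    rw [hg x] at this
    exact this.trans' hx

theorem Orb.swap {V : Type*} {f g : V → V} {a b : V} (h : Orb f g a b) : Orb g f a b :=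
  fun T ha hc => h T ha (fun x hx => ⟨(hc x hx).2, (hc x hx).1⟩)

/-- linear arrangement of a class along `e`-edges (pairs `2i,2i+1`) and `d`-edges
(pairs `2i+1,2i+2`), with exceptional `d`-edges. -/
structure Lin {V : Type*} (e d : V → V) (C : Set V) (pos : V → ℤ) (exc : V → Prop) : Prop where
  inj : ∀ a ∈ C, ∀ b ∈ C, pos a = pos b → a = b
  e_eq : ∀ a ∈ C, pos (e a) / 2 = pos a / 2
  lev_inj : ∀ a ∈ C, ∀ b ∈ C, pos a / 2 = pos b / 2 → b = a ∨ b = e a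
  d_eq : ∀ a ∈ C, ¬ exc a → (pos (d a) + 1) / 2 = (pos a + 1) / 2

theorem Lin.rev {V : Type*} {e d : V → V} {C : Set V} {pos : V → ℤ} {exc : V → Prop}
    (L : Lin e d C pos exc) : Lin e d C (fun a => 1 - pos a) exc := by
  refine ⟨fun a ha b hb h => L.inj a ha b hb (by omega), fun a ha => ?_,
    fun a ha b hb h => L.lev_inj a ha b hb (by omega), fun a ha h => ?_⟩
  · have := L.e_eq a ha
    omega
  · have := L.d_eq a ha h
    omega

theorem Lin.congr {V : Type*} {e d : V → V} {C : Set V} {pos pos' : V → ℤ} {exc : V → Prop}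
    (L : Lin e d C pos exc) (hC : ∀ a ∈ C, e a ∈ C ∧ d a ∈ C)
    (h : ∀ a ∈ C, pos' a = pos a) : Lin e d C pos' exc := by
  refine ⟨fun a ha b hb hh => L.inj a ha b hb ?_, fun a ha => ?_,
    fun a ha b hb hh => L.lev_inj a ha b hb ?_, fun a ha hh => ?_⟩
  · rwa [h a ha, h b hb] at hh
  · rw [h a ha, h _ (hC a ha).1]; exact L.e_eq a ha
  · rwa [h a ha, h b hb] at hh
  · rw [h a ha, h _ (hC a ha).2]; exact L.d_eq a ha hh

/-- alternating sequence -/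
def altSeq {V : Type*} (f g : V → V) (r : V) : ℕ → V
  | 0 => r
  | n + 1 => if n % 2 = 0 then f (altSeq f g r n) else g (altSeq f g r n)

theorem exists_seq {V : Type*} [Finite V] (f g : V → V) (hf : Function.Involutive f)
    (hg : Function.Involutive g) (r : V)
    (hr : g r = r ∨ ∀ a, Orb f g r a → f a ≠ a ∧ g a ≠ a) :
    ∃ (S : Set V) (idx : V → ℤ), r ∈ S ∧ (∀ a ∈ S, f a ∈ S ∧ g a ∈ S) ∧
      (∀ a ∈ S, Orb f g r a) ∧
      Lin f g S idx (fun a => g r ≠ r ∧ (a = r ∨ a = g r)) ∧ idx r = 0 ∧ (∀ a ∈ S, 0 ≤ idx a) ∧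
      (∀ a ∈ S, a ≠ r → (f a = a ∨ g a = a) → ∀ b ∈ S, idx b ≤ idx a) ∧
      (g r = r → ∃ a ∈ S, f a = a ∨ (g a = a ∧ a ≠ r)) := by
  set s := altSeq f g r with hs
  have s0 : s 0 = r := rfl
  have sE : ∀ n, n % 2 = 0 → s (n + 1) = f (s n) := by
    intro n hn; simp only [hs, altSeq, hn, if_true]
  have sO : ∀ n, n % 2 = 1 → s (n + 1) = g (s n) := by
    intro n hn
    simp only [hs, altSeq]
    rw [if_neg (by omega)]
  have sE' : ∀ n, n % 2 = 0 → f (s (n + 1)) = s n := by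
    intro n hn; rw [sE n hn, hf]
  have sO' : ∀ n, n % 2 = 1 → g (s (n + 1)) = s n := by
    intro n hn; rw [sO n hn, hg]
  have hex : ∃ m, ∃ j, j < m ∧ s j = s m := by
    obtain ⟨i, j, hij, h⟩ := Finite.exists_ne_map_eq_of_infinite s
    rcases lt_or_gt_of_ne hij with h1 | h1
    · exact ⟨j, i, h1, h⟩
    · exact ⟨i, j, h1, h.symm⟩
  obtain ⟨m, ⟨j, hjm, hj⟩, hmin⟩ : ∃ m, (∃ j, j < m ∧ s j = s m) ∧
      ∀ m', m' < m → ¬ ∃ j, j < m' ∧ s j = s m' :=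
    ⟨Nat.find hex, Nat.find_spec hex, fun m' h => Nat.find_min hex h⟩
  have inj : ∀ i, i < m → ∀ i', i' < m → s i = s i' → i = i' := by
    intro i hi i' hi' h
    by_contra hne
    rcases lt_or_gt_of_ne hne with h1 | h1
    · exact hmin i' hi' ⟨i, h1, h⟩
    · exact hmin i hi ⟨i', h1, h.symm⟩
  -- Orbit membership
  have orb : ∀ i, Orb f g r (s i) := by
    intro i
    induction i with
    | zero => exact Orb.rfl' r
    | succ n ih =>
      rcases Nat.mod_two_eq_zero_or_one n with h | h
      · rw [sE n h]; exact ih.trans' (Orb.f_right _)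
      · rw [sO n h]; exact ih.trans' (Orb.g_right _)
  obtain ⟨M, rfl⟩ : ∃ M, m = M + 1 := ⟨m - 1, by omega⟩
  -- j = 0 or j = M
  have key : (j = M) ∨ (j = 0 ∧ M % 2 = 1 ∧ M ≠ 0) := by
    by_contra hcon
    push Not at hcon
    obtain ⟨hjM, hc⟩ := hcon
    rcases Nat.mod_two_eq_zero_or_one M with hM | hM
    · -- last step is f
      have h1 : f (s j) = s M := by rw [hj, sE' M hM]
      rcases Nat.mod_two_eq_zero_or_one j with h2 | h2
      · rw [← sE j h2] at h1
        have := inj (j + 1) (by omega) M (by omega) h1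
        omega
      · obtain ⟨i, rfl⟩ : ∃ i, j = i + 1 := ⟨j - 1, by omega⟩
        rw [sE' i (by omega)] at h1
        have := inj i (by omega) M (by omega) h1
        omega
    · have h1 : g (s j) = s M := by rw [hj, sO' M hM]
      rcases Nat.mod_two_eq_zero_or_one j with h2 | h2
      · have hj0 : j ≠ 0 := fun h => by have := hc h hM; omega
        obtain ⟨i, rfl⟩ : ∃ i, j = i + 1 := ⟨j - 1, by omega⟩
        rw [sO' i (by omega)] at h1
        have := inj i (by omega) M (by omega) h1
        omega
      · rw [← sO j h2] at h1
        have := inj (j + 1) (by omega) M (by omega) h1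
        omega
  -- dichotomy
  have dich : (g r = r ∧ s (M + 1) = s M) ∨
      (g r ≠ r ∧ s (M + 1) = r ∧ M % 2 = 1 ∧ g r = s M) := by
    rcases key with h | ⟨h, hM, hM0⟩
    · rw [h] at hj
      left
      refine ⟨?_, hj.symm⟩
      rcases hr with h1 | h1
      · exact h1
      · exfalso
        rcases Nat.mod_two_eq_zero_or_one M with h2 | h2
        · rw [sE M h2] at hj
          exact (h1 _ (orb M)).1 hj.symm
        · rw [sO M h2] at hj
          exact (h1 _ (orb M)).2 hj.symm
    · right
      rw [h, s0] at hj
      have h1 : g r = s M := by rw [hj, sO' M hM]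
      refine ⟨?_, hj.symm, hM, h1⟩
      intro h2
      rw [h2, ← s0] at h1
      have := inj 0 (by omega) M (by omega) h1
      omega
  -- index function
  have hidx : ∃ idx : V → ℤ, ∀ i, i < M + 1 → idx (s i) = i := by
    refine ⟨fun a => if h : ∃ i, i < M + 1 ∧ s i = a then ((Classical.choose h : ℕ) : ℤ) else 0, ?_⟩
    intro i hi
    have h : ∃ i', i' < M + 1 ∧ s i' = s i := ⟨i, hi, rfl⟩
    simp only [dif_pos h]
    have := Classical.choose_spec h
    rw [inj _ this.1 i hi this.2]
  obtain ⟨idx, hidx⟩ := hidx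
  -- images
  have fimg : ∀ i, i < M + 1 → (i % 2 = 0 ∧ i < M ∧ f (s i) = s (i + 1)) ∨
      (i % 2 = 0 ∧ i = M ∧ f (s i) = s i) ∨ (i % 2 = 1 ∧ f (s i) = s (i - 1)) := by
    intro i hi
    rcases Nat.mod_two_eq_zero_or_one i with h | h
    · by_cases hiM : i < M
      · exact Or.inl ⟨h, hiM, (sE i h).symm⟩
      · right; left
        have : i = M := by omega
        subst this
        refine ⟨h, rfl, ?_⟩
        rcases dich with ⟨_, h2⟩ | ⟨_, _, h2, _⟩
        · rw [← sE i h, h2]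
        · omega
    · right; right
      obtain ⟨i', rfl⟩ : ∃ i', i = i' + 1 := ⟨i - 1, by omega⟩
      exact ⟨h, by simpa using sE' i' (by omega)⟩
  have gimg : ∀ i, i < M + 1 → (i % 2 = 1 ∧ i < M ∧ g (s i) = s (i + 1)) ∨
      (i % 2 = 1 ∧ i = M ∧ g r = r ∧ g (s i) = s i) ∨
      (i = 0 ∧ g r = r) ∨
      (g r ≠ r ∧ i = M ∧ g r = s M ∧ g (s M) = r) ∨ (g r ≠ r ∧ i = 0 ∧ g r = s M) ∨
      (i % 2 = 0 ∧ i ≠ 0 ∧ g (s i) = s (i - 1)) := by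
    intro i hi
    rcases Nat.mod_two_eq_zero_or_one i with h | h
    · by_cases h0 : i = 0
      · rcases dich with ⟨h1, _⟩ | ⟨h1, h2, h3, h4⟩
        · right; right; left; exact ⟨h0, h1⟩
        · right; right; right; right; left; exact ⟨h1, h0, h4⟩
      · right; right; right; right; right
        obtain ⟨i', rfl⟩ : ∃ i', i = i' + 1 := ⟨i - 1, by omega⟩
        exact ⟨h, h0, by simpa using sO' i' (by omega)⟩
    · by_cases hiM : i < M
      · exact Or.inl ⟨h, hiM, (sO i h).symm⟩
      · have : i = M := by omega
        subst this
        rcases dich with ⟨h1, h2⟩ | ⟨h1, h2, h3, h4⟩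
        · right; left
          exact ⟨h, rfl, h1, by rw [← sO i h, h2]⟩
        · right; right; right; left
          exact ⟨h1, rfl, h4, by rw [← h4, hg]⟩
  refine ⟨{a | ∃ i, i < M + 1 ∧ s i = a}, idx, ⟨0, by omega, rfl⟩, ?_, ?_, ?_, ?_, ?_, ?_, ?_⟩
  · rintro _ ⟨i, hi, rfl⟩
    constructor
    · rcases fimg i hi with ⟨_, h2, h3⟩ | ⟨_, h2, h3⟩ | ⟨_, h3⟩
      · exact ⟨i + 1, by omega, h3.symm⟩
      · exact ⟨i, by omega, h3.symm⟩
      · exact ⟨i - 1, by omega, h3.symm⟩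
    · rcases gimg i hi with ⟨_, h2, h3⟩ | ⟨_, h2, _, h3⟩ | ⟨h2, h3⟩ | ⟨_, h2, _, h3⟩ | ⟨_, h2, h3⟩ |
        ⟨_, h2, h3⟩
      · exact ⟨i + 1, by omega, h3.symm⟩
      · exact ⟨i, by omega, h3.symm⟩
      · exact ⟨0, by omega, by rw [h2, s0, h3]⟩
      · exact ⟨0, by omega, by rw [h2, h3, s0]⟩
      · exact ⟨M, by omega, by rw [h2, s0, h3]⟩
      · exact ⟨i - 1, by omega, h3.symm⟩
  · rintro _ ⟨i, hi, rfl⟩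
    exact orb i
  · constructor
    · rintro _ ⟨i, hi, rfl⟩ _ ⟨i', hi', rfl⟩ h
      rw [hidx i hi, hidx i' hi'] at h
      have : i = i' := by omega
      rw [this]
    · rintro _ ⟨i, hi, rfl⟩
      rcases fimg i hi with ⟨h1, h2, h3⟩ | ⟨_, h2, h3⟩ | ⟨h1, h3⟩
      · rw [h3, hidx i hi, hidx _ (by omega)]; push_cast; omega
      · rw [h3]
      · rw [h3, hidx i hi, hidx _ (by omega)]; omega
    · rintro _ ⟨i, hi, rfl⟩ _ ⟨i', hi', rfl⟩ h
      rw [hidx i hi, hidx i' hi'] at h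
      by_cases he : i = i'
      · left; rw [he]
      · right
        rcases Nat.mod_two_eq_zero_or_one i with h1 | h1
        · rw [← sE i h1]; congr 1; omega
        · obtain ⟨i'', rfl⟩ : ∃ i'', i = i'' + 1 := ⟨i - 1, by omega⟩
          rw [sE' i'' (by omega)]; congr 1; omega
    · rintro _ ⟨i, hi, rfl⟩ hex
      rcases gimg i hi with ⟨h1, h2, h3⟩ | ⟨_, h2, _, h3⟩ | ⟨h2, h3⟩ | ⟨h1, h2, h4, h3⟩ |
        ⟨h1, h2, h3⟩ | ⟨h1, h2, h3⟩
      · rw [h3, hidx i hi, hidx _ (by omega)]; push_cast; omega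
      · rw [h3]
      · rw [h2, s0, h3]
      · exact absurd ⟨h1, Or.inr (by rw [h2, h4])⟩ hex
      · exact absurd ⟨h1, Or.inl (by rw [h2, s0])⟩ hex
      · rw [h3, hidx i hi, hidx _ (by omega)]; omega
  · have := hidx 0 (by omega); simpa [s0] using this
  · rintro _ ⟨i, hi, rfl⟩
    rw [hidx i hi]; omega
  · rintro _ ⟨i, hi, rfl⟩ hne hfix _ ⟨i', hi', rfl⟩
    rw [hidx i hi, hidx i' hi']
    have hi0 : i ≠ 0 := by rintro rfl; exact hne s0
    suffices i = M by omega
    rcases hfix with h | h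
    · rcases fimg i hi with ⟨h1, h2, h3⟩ | ⟨_, h2, h3⟩ | ⟨h1, h3⟩
      · have := inj _ (by omega) _ hi (h3.symm.trans h); omega
      · exact h2
      · have := inj _ (by omega) _ hi (h3.symm.trans h); omega
    · rcases gimg i hi with ⟨h1, h2, h3⟩ | ⟨_, h2, _, h3⟩ | ⟨h2, h3⟩ | ⟨h1, h2, h4, h3⟩ |
        ⟨h1, h2, h3⟩ | ⟨h1, h2, h3⟩
      · have := inj _ (by omega) _ hi (h3.symm.trans h); omega
      · exact h2
      · omega
      · exact h2
      · omega
      · have := inj _ (by omega) _ hi (h3.symm.trans h); omega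
  · intro hgr
    rcases dich with ⟨_, h2⟩ | ⟨h1, _⟩
    · refine ⟨s M, ⟨M, by omega, rfl⟩, ?_⟩
      rcases Nat.mod_two_eq_zero_or_one M with h | h
      · left; rw [← sE M h, h2]
      · right
        refine ⟨by rw [← sO M h, h2], ?_⟩
        intro h3
        rw [← s0] at h3
        have := inj _ (by omega) _ (by omega) h3
        omega
    · exact absurd hgr h1

theorem compress {V L : Type*} [Fintype V] [LinearOrder L] (K : V → L) :
    ∃ X : V → ℤ, (∀ a, 0 ≤ X a ∧ X a < Fintype.card V) ∧ ∀ a b, X a < X b ↔ K a < K b := by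
  refine ⟨fun a => ((Finset.univ.filter (fun b => K b < K a)).card : ℤ), ?_, ?_⟩
  · intro a
    refine ⟨by positivity, ?_⟩
    have : (Finset.univ.filter (fun b => K b < K a)).card < Fintype.card V := by
      refine Finset.card_lt_card (s := Finset.univ.filter (fun b => K b < K a))
        (t := Finset.univ) ?_
      rw [Finset.ssubset_univ_iff]
      intro h
      have := Finset.mem_univ a
      rw [← h] at this
      simp at this
    show ((_ : ℕ) : ℤ) < _
    exact_mod_cast this
  · intro a b
    constructor
    · intro h
      by_contra hcon
      have hle : K b ≤ K a := not_lt.mp hcon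
      have : (Finset.univ.filter (fun c => K c < K b)).card ≤
          (Finset.univ.filter (fun c => K c < K a)).card := by
        apply Finset.card_le_card
        intro c hc
        simp only [Finset.mem_filter, Finset.mem_univ, true_and] at hc ⊢
        exact lt_of_lt_of_le hc hle
      change ((_ : ℕ) : ℤ) < ((_ : ℕ) : ℤ) at h
      have h' : (Finset.univ.filter (fun c => K c < K a)).card <
          (Finset.univ.filter (fun c => K c < K b)).card := by exact_mod_cast h
      omega
    · intro h
      have : (Finset.univ.filter (fun c => K c < K a)).card <
          (Finset.univ.filter (fun c => K c < K b)).card := by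
        apply Finset.card_lt_card
        rw [Finset.ssubset_iff_of_subset]
        · refine ⟨a, by simpa using h, by simp⟩
        · intro c hc
          simp only [Finset.mem_filter, Finset.mem_univ, true_and] at hc ⊢
          exact lt_trans hc h
      show ((_ : ℕ) : ℤ) < ((_ : ℕ) : ℤ)
      exact_mod_cast this

/-- class of `a` for the label `t` -/
def Cls {V : Type*} (t : V → ℕ) (a : V) : Set V := {b | t b = t a}

/-- closing-edge extremeness -/
def ExtE {V : Type*} (md : Bool) (d : V → V) (t t' : V → ℕ) (ρ' pos' : V → ℤ) (u : V) : Prop :=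
  (md = true ∧ (∀ w, t w = t u → w ≠ u →
      ρ' u < ρ' w ∨ (t' w = t' u ∧ pos' (d u) / 2 ≤ pos' w / 2)) ∧ pos' u / 2 < pos' (d u) / 2) ∨
  (md = false ∧ (∀ w, t w = t u → w ≠ u →
      ρ' w < ρ' u ∨ (t' w = t' u ∧ pos' w / 2 ≤ pos' (d u) / 2)) ∧ pos' (d u) / 2 < pos' u / 2)

theorem exists_pos {V : Type*} [Finite V] (e : Bool → V → V) (d : V → V)
    (t : Bool → V → ℕ) (ρ : Bool → V → ℤ) (cyc : Bool → V → Prop) (pos0 : Bool → V → ℤ) (md : Bool → V → Bool)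
    (te : ∀ s a, t s (e s a) = t s a) (td : ∀ s a, t s (d a) = t s a)
    (cc : ∀ s a b, t s a = t s b → cyc s a → cyc s b)
    (hρ : ∀ s a b, t s a = t s b → ρ s a = ρ s b)
    (hmd : ∀ s a b, t s a = t s b → md s a = md s b)
    (hn : ∀ s a, ¬ cyc s a → Lin (e s) d (Cls (t s) a) (pos0 s) (fun _ => False))
    (hdc : ∀ s a, cyc s a → d a ≠ a)
    (hy : ∀ s u, cyc s u → ∃ pos, Lin (e s) d (Cls (t s) u) pos (fun w => w = u ∨ w = d u))
    (hex : ∀ s a, cyc s a → ∃ u, t s u = t s a ∧ t (!s) u < t s u ∧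
      ((md s u = true ∧ ∀ w, t s w = t s u → t (!s) w = t (!s) u ∨ ρ (!s) u < ρ (!s) w) ∨
       (md s u = false ∧ ∀ w, t s w = t s u → t (!s) w = t (!s) u ∨ ρ (!s) w < ρ (!s) u))) :
    ∃ pos : Bool → V → ℤ, (∀ s a, ¬ cyc s a → pos s a = pos0 s a) ∧
      ∀ s a, cyc s a → ∃ u, t s u = t s a ∧ 
        Lin (e s) d (Cls (t s) u) (pos s) (fun w => w = u ∨ w = d u) ∧
        ExtE (md s u) d (t s) (t (!s)) (ρ (!s)) (pos (!s)) u := by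
  have main : ∀ T : ℕ, ∃ pos : Bool → V → ℤ, (∀ s a, ¬ cyc s a → pos s a = pos0 s a) ∧
      ∀ s a, cyc s a → t s a < T → ∃ u, t s u = t s a ∧ t (!s) u < t s u ∧
        Lin (e s) d (Cls (t s) u) (pos s) (fun w => w = u ∨ w = d u) ∧
        ExtE (md s u) d (t s) (t (!s)) (ρ (!s)) (pos (!s)) u := by
    intro T
    induction T with
    | zero => exact ⟨pos0, fun _ _ _ => rfl, fun s a _ h => absurd h (by omega)⟩
    | succ T ih =>
      obtain ⟨pos, hp0, hp⟩ := ih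
      -- step for each side
      have step : ∀ s, ∃ q : V → ℤ, ∀ a, cyc s a → t s a = T → ∃ u, t s u = t s a ∧
          t (!s) u < t s u ∧
          Lin (e s) d (Cls (t s) u) q (fun w => w = u ∨ w = d u) ∧
          ExtE (md s u) d (t s) (t (!s)) (ρ (!s)) (pos (!s)) u := by
        intro s
        by_cases hs : ∃ a, cyc s a ∧ t s a = T
        swap
        · exact ⟨fun _ => 0, fun a h1 h2 => absurd ⟨a, h1, h2⟩ hs⟩
        obtain ⟨a0, hc0, ht0⟩ := hs
        obtain ⟨u0, hu0, hlt0, hext0⟩ := hex s a0 hc0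
        -- Linear structure on the class of u0 on the other side
        have hL : ∀ w, t s w = t s u0 → t (!s) w = t (!s) u0 →
            ((pos (!s) (d w) + 1) / 2 = (pos (!s) w + 1) / 2) := by
          intro w hw hw'
          by_cases hcy : cyc (!s) u0
          · obtain ⟨u', h1, h2, h3, h4⟩ := hp (!s) u0 hcy (by omega)
            refine h3.d_eq w (by show _ = _; omega) ?_
            rw [Bool.not_not] at h2
            rintro (rfl | rfl)
            · omega
            · rw [td] at hw; omega
          · have h3 := hn (!s) u0 hcy
            have h4 := h3.d_eq w hw' (fun h => h)
            have hc1 : ¬ cyc (!s) w := fun h => hcy (cc _ _ _ hw' h)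
            have hc2 : ¬ cyc (!s) (d w) := fun h => hcy (cc _ _ _ (by rw [td, hw']) h)
            rw [hp0 _ _ hc1, hp0 _ _ hc2]
            exact h4
        have hI : ∀ w w', t (!s) w = t (!s) u0 → t (!s) w' = t (!s) u0 →
            pos (!s) w = pos (!s) w' → w = w' := by
          intro w w' hw hw' h
          by_cases hcy : cyc (!s) u0
          · obtain ⟨u', h1, h2, h3, h4⟩ := hp (!s) u0 hcy (by omega)
            exact h3.inj w (by show _ = _; omega) w' (by show _ = _; omega) h
          · have h3 := hn (!s) u0 hcy
            have hc1 : ¬ cyc (!s) w := fun h => hcy (cc _ _ _ hw h)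
            have hc2 : ¬ cyc (!s) w' := fun h => hcy (cc _ _ _ hw' h)
            rw [hp0 _ _ hc1, hp0 _ _ hc2] at h
            exact h3.inj w hw w' hw' h
        have hfin : {w | t s w = t s u0 ∧ t (!s) w = t (!s) u0}.Finite := Set.toFinite _
        have hne : {w | t s w = t s u0 ∧ t (!s) w = t (!s) u0}.Nonempty := ⟨u0, rfl, rfl⟩
        have hchoose : ∃ u, t s u = t s u0 ∧ t (!s) u = t (!s) u0 ∧
            ExtE (md s u) d (t s) (t (!s)) (ρ (!s)) (pos (!s)) u := by
          rcases hext0 with ⟨hm, hmin⟩ | ⟨hm, hmax⟩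
          · obtain ⟨u, ⟨hu1, hu2⟩, hu3⟩ := Set.exists_min_image _ (pos (!s)) hfin hne
            have hcu : cyc s u := cc s a0 u (by omega) hc0
            have hdu := hu3 (d u) ⟨by rw [td, hu1], by rw [td, hu2]⟩
            have hne' : pos (!s) (d u) ≠ pos (!s) u := by
              intro h
              exact hdc s u hcu (hI _ _ (by rw [td, hu2]) hu2 h)
            have hl := hL u hu1 hu2
            refine ⟨u, hu1, hu2, Or.inl ⟨by rw [hmd s u u0 hu1, hm], ?_, by omega⟩⟩
            intro w hw hwu
            by_cases hw' : t (!s) w = t (!s) u0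
            · right
              refine ⟨by omega, ?_⟩
              have h1 := hu3 w ⟨by omega, hw'⟩
              have h2 : pos (!s) w ≠ pos (!s) u := fun h => hwu (hI _ _ hw' hu2 h)
              omega
            · left
              rcases hmin w (by omega) with h | h
              · exact absurd h hw'
              · rw [hρ (!s) u u0 hu2]; exact h
          · obtain ⟨u, ⟨hu1, hu2⟩, hu3⟩ := Set.exists_max_image _ (pos (!s)) hfin hne
            have hcu : cyc s u := cc s a0 u (by omega) hc0
            have hdu := hu3 (d u) ⟨by rw [td, hu1], by rw [td, hu2]⟩
            have hne' : pos (!s) (d u) ≠ pos (!s) u := by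
              intro h
              exact hdc s u hcu (hI _ _ (by rw [td, hu2]) hu2 h)
            have hl := hL u hu1 hu2
            refine ⟨u, hu1, hu2, Or.inr ⟨by rw [hmd s u u0 hu1, hm], ?_, by omega⟩⟩
            intro w hw hwu
            by_cases hw' : t (!s) w = t (!s) u0
            · right
              refine ⟨by omega, ?_⟩
              have h1 := hu3 w ⟨by omega, hw'⟩
              have h2 : pos (!s) w ≠ pos (!s) u := fun h => hwu (hI _ _ hw' hu2 h)
              omega
            · left
              rcases hmax w (by omega) with h | h
              · exact absurd h hw'
              · rw [hρ (!s) u u0 hu2]; exact h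
        obtain ⟨u, hu1, hu2, hu3⟩ := hchoose
        obtain ⟨q, hq⟩ := hy s u (cc s a0 u (by omega) hc0)
        exact ⟨q, fun a h1 h2 => ⟨u, by omega, by omega, hq, hu3⟩⟩
      choose q hq using step
      have hlow : ∀ s a, t s a < T →
          (fun s a => if cyc s a ∧ t s a = T then q s a else pos s a) s a = pos s a := by
        intro s a h
        exact if_neg (by omega)
      refine ⟨fun s a => if cyc s a ∧ t s a = T then q s a else pos s a, ?_, ?_⟩
      · intro s a h
        show (if cyc s a ∧ t s a = T then q s a else pos s a) = _
        rw [if_neg (fun hh => h hh.1)]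
        exact hp0 s a h
      · intro s a hc hlt
        have hE : ∀ u, t (!s) u < T → ExtE (md s u) d (t s) (t (!s)) (ρ (!s)) (pos (!s)) u →
            ExtE (md s u) d (t s) (t (!s)) (ρ (!s))
              ((fun s a => if cyc s a ∧ t s a = T then q s a else pos s a) (!s)) u := by
          intro u hu hE
          have h1 := hlow (!s) u hu
          have h2 := hlow (!s) (d u) (by rw [td]; exact hu)
          unfold ExtE at hE ⊢
          rw [h1, h2]
          rcases hE with ⟨h0, h3, h4⟩ | ⟨h0, h3, h4⟩
          · refine Or.inl ⟨h0, fun w hw hwu => ?_, h4⟩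
            rcases h3 w hw hwu with h | ⟨h, h'⟩
            · exact Or.inl h
            · exact Or.inr ⟨h, by rw [hlow (!s) w (by omega)]; exact h'⟩
          · refine Or.inr ⟨h0, fun w hw hwu => ?_, h4⟩
            rcases h3 w hw hwu with h | ⟨h, h'⟩
            · exact Or.inl h
            · exact Or.inr ⟨h, by rw [hlow (!s) w (by omega)]; exact h'⟩
        have hcl : ∀ u, ∀ a ∈ Cls (t s) u, e s a ∈ Cls (t s) u ∧ d a ∈ Cls (t s) u := by
          intro u a ha
          exact ⟨(te s a).trans ha, (td s a).trans ha⟩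
        by_cases hT : t s a = T
        · obtain ⟨u, h1, h2, h3, h4⟩ := hq s a hc hT
          refine ⟨u, h1, h2, h3.congr (hcl u) ?_, hE u (by omega) h4⟩
          intro b hb
          have hb' : t s b = t s u := hb
          exact if_pos ⟨cc s a b (by omega) hc, by omega⟩
        · obtain ⟨u, h1, h2, h3, h4⟩ := hp s a hc (by omega)
          refine ⟨u, h1, h2, h3.congr (hcl u) ?_, hE u (by omega) h4⟩
          intro b hb
          have hb' : t s b = t s u := hb
          exact hlow s b (by omega)
  obtain ⟨N, hN⟩ : ∃ N, ∀ s a, t s a < N := by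
    have h1 : ∀ s, ∃ N, ∀ a, t s a < N := by
      intro s
      obtain ⟨N, hN⟩ := (Set.finite_range (t s)).bddAbove
      exact ⟨N + 1, fun a => Nat.lt_succ_of_le (hN ⟨a, rfl⟩)⟩
    choose N hN using h1
    refine ⟨N true + N false, ?_⟩
    intro s a
    have := hN s a
    cases s <;> omega
  obtain ⟨pos, h0, h1⟩ := main N
  refine ⟨pos, h0, fun s a hc => ?_⟩
  obtain ⟨u, h2, _, h3, h4⟩ := h1 s a hc (hN s a)
  exact ⟨u, h2, h3, h4⟩

/-- weak axis-parallel separation of the boxes spanned by `a, b` and by `c, f` -/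
def SepZ {V : Type*} (Z : Bool → V → ℤ) (a b c f : V) : Prop :=
  ∃ s, (Z s a ≤ Z s c ∧ Z s a ≤ Z s f ∧ Z s b ≤ Z s c ∧ Z s b ≤ Z s f) ∨
    (Z s c ≤ Z s a ∧ Z s f ≤ Z s a ∧ Z s c ≤ Z s b ∧ Z s f ≤ Z s b)

theorem SepZ.swap1 {V : Type*} {Z : Bool → V → ℤ} {a b c f : V} (H : SepZ Z a b c f) :
    SepZ Z b a c f := by
  obtain ⟨s, h | h⟩ := H
  · exact ⟨s, Or.inl ⟨h.2.2.1, h.2.2.2, h.1, h.2.1⟩⟩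
  · exact ⟨s, Or.inr ⟨h.2.2.1, h.2.2.2, h.1, h.2.1⟩⟩

theorem SepZ.symm {V : Type*} {Z : Bool → V → ℤ} {a b c f : V} (H : SepZ Z a b c f) :
    SepZ Z c f a b := by
  obtain ⟨s, h | h⟩ := H
  · exact ⟨s, Or.inr ⟨h.1, h.2.2.1, h.2.1, h.2.2.2⟩⟩
  · exact ⟨s, Or.inl ⟨h.1, h.2.2.1, h.2.1, h.2.2.2⟩⟩

/-- order-type certificate for a straight drawing -/
structure Cert {V : Type*} (e : Bool → V → V) (d : V → V) (A : Set V) (Z : Bool → V → ℤ) :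
    Prop where
  ce : ∀ s, ∀ a ∈ A, Z s (e s a) = Z s a
  ci : ∀ s, ∀ a ∈ A, ∀ c ∈ A, Z s a = Z s c → c = a ∨ c = e s a
  dn : ∀ s, ∀ a ∈ A, d a ≠ a → Z s a ≠ Z s (d a)
  de : ∀ s, ∀ a ∈ A, ∀ w ∈ A, d a ≠ a → SepZ Z a (d a) w (e s w)
  dd : ∀ a ∈ A, ∀ w ∈ A, d a ≠ a → w ≠ a → w ≠ d a → SepZ Z a (d a) w (d w)

theorem exists_cert {V : Type*} [Fintype V] (e : Bool → V → V) (d : V → V)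
    (hd : Function.Involutive d)
    (t : Bool → V → ℕ) (ρ : Bool → V → ℤ) (cyc : Bool → V → Prop) (pos0 : Bool → V → ℤ)
    (md : Bool → V → Bool)
    (hde : ∀ s a, d a ≠ a → d a ≠ e s a)
    (te : ∀ s a, t s (e s a) = t s a) (td : ∀ s a, t s (d a) = t s a)
    (cc : ∀ s a b, t s a = t s b → cyc s a → cyc s b)
    (hρ : ∀ s a b, t s a = t s b ↔ ρ s a = ρ s b)
    (hmd : ∀ s a b, t s a = t s b → md s a = md s b)
    (hn : ∀ s a, ¬ cyc s a → Lin (e s) d (Cls (t s) a) (pos0 s) (fun _ => False))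
    (hdc : ∀ s a, cyc s a → d a ≠ a)
    (hy : ∀ s u, cyc s u → ∃ pos, Lin (e s) d (Cls (t s) u) pos (fun w => w = u ∨ w = d u))
    (hex : ∀ s a, cyc s a → ∃ u, t s u = t s a ∧ t (!s) u < t s u ∧
      ((md s u = true ∧ ∀ w, t s w = t s u → t (!s) w = t (!s) u ∨ ρ (!s) u < ρ (!s) w) ∨
       (md s u = false ∧ ∀ w, t s w = t s u → t (!s) w = t (!s) u ∨ ρ (!s) w < ρ (!s) u))) :
    ∃ Z : Bool → V → ℤ, (∀ s a, 0 ≤ Z s a ∧ Z s a < Fintype.card V) ∧ Cert e d Set.univ Z ∧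
      (∀ s a b, ρ s a < ρ s b → Z s a < Z s b) ∧
      (∀ s a b, ρ s a = ρ s b → ¬ cyc s a → (Z s a < Z s b ↔ pos0 s a / 2 < pos0 s b / 2)) ∧
      (∀ s a w, d a ≠ a → Z s a < Z s w → Z s w < Z s (d a) →
        cyc s a ∧ t s w = t s a ∧
        (md s a = true → Z (!s) a ≤ Z (!s) w ∧ Z (!s) (d a) ≤ Z (!s) w) ∧
        (md s a = false → Z (!s) w ≤ Z (!s) a ∧ Z (!s) w ≤ Z (!s) (d a))) := by
  obtain ⟨pos, hp0, hp⟩ := exists_pos e d t ρ cyc pos0 md te td cc (fun s a b => (hρ s a b).1)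
    hmd hn hdc hy hex
  have hZ : ∀ s, ∃ X : V → ℤ, (∀ a, 0 ≤ X a ∧ X a < Fintype.card V) ∧ ∀ a b, X a < X b ↔
      (ρ s a < ρ s b ∨ (ρ s a = ρ s b ∧ pos s a / 2 < pos s b / 2)) := by
    intro s
    obtain ⟨X, h1, h2⟩ := compress (fun a => toLex (ρ s a, pos s a / 2))
    refine ⟨X, h1, fun a b => ?_⟩
    rw [h2]
    exact Prod.Lex.toLex_lt_toLex
  choose Z hZb hZ using hZ
  have eρ : ∀ s a, ρ s (e s a) = ρ s a := fun s a => (hρ s _ _).1 (te s a)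
  have dρ : ∀ s a, ρ s (d a) = ρ s a := fun s a => (hρ s _ _).1 (td s a)
  -- same-class comparison
  have hsame : ∀ s a b, ρ s a = ρ s b → (Z s a < Z s b ↔ pos s a / 2 < pos s b / 2) := by
    intro s a b h
    rw [hZ]; constructor
    · rintro (h1 | h1)
      · omega
      · exact h1.2
    · intro h1; exact Or.inr ⟨h, h1⟩
  have hdiff : ∀ s a b, ρ s a < ρ s b → Z s a < Z s b := by
    intro s a b h
    rw [hZ]; exact Or.inl h
  -- Linear structure
  have hLin : ∀ s a, ∃ exc, Lin (e s) d (Cls (t s) a) (pos s) exc ∧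
      ∀ w, exc w → t s w = t s a → ∃ u, t s u = t s a ∧ (w = u ∨ w = d u) ∧ cyc s a ∧
        ExtE (md s u) d (t s) (t (!s)) (ρ (!s)) (pos (!s)) u := by
    intro s a
    by_cases hc : cyc s a
    · obtain ⟨u, h1, h2, h3⟩ := hp s a hc
      refine ⟨_, ?_, fun w hw ht => ⟨u, h1, hw, hc, h3⟩⟩
      have : Cls (t s) a = Cls (t s) u := by
        ext b; show t s b = t s a ↔ t s b = t s u; rw [h1]
      rw [this]; exact h2
    · refine ⟨_, (hn s a hc).congr ?_ ?_, fun w hw => hw.elim⟩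
      · intro b hb
        exact ⟨(te s b).trans hb, (td s b).trans hb⟩
      · intro b hb
        exact hp0 s b (fun h => hc (cc s b a hb h))
  have extZ : ∀ s u, ExtE (md s u) d (t s) (t (!s)) (ρ (!s)) (pos (!s)) u →
      (md s u = true ∧ Z (!s) u < Z (!s) (d u) ∧ ∀ w, t s w = t s u → w ≠ u →
        Z (!s) (d u) ≤ Z (!s) w) ∨
      (md s u = false ∧ Z (!s) (d u) < Z (!s) u ∧ ∀ w, t s w = t s u → w ≠ u →
        Z (!s) w ≤ Z (!s) (d u)) := by
    rintro s u (⟨h0, h1, h2⟩ | ⟨h0, h1, h2⟩)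
    · left
      refine ⟨h0, (hsame _ _ _ (dρ _ _).symm).2 h2, fun w hw hwu => ?_⟩
      rcases h1 w hw hwu with h | ⟨h, h'⟩
      · exact le_of_lt (hdiff _ _ _ (by rw [dρ]; exact h))
      · rw [← not_lt, hsame _ _ _ (by rw [dρ]; exact (hρ _ _ _).1 h)]; omega
    · right
      refine ⟨h0, (hsame _ _ _ (dρ _ _)).2 h2, fun w hw hwu => ?_⟩
      rcases h1 w hw hwu with h | ⟨h, h'⟩
      · exact le_of_lt (hdiff _ _ _ (by rw [dρ]; exact h))
      · rw [← not_lt, hsame _ _ _ (by rw [dρ]; exact ((hρ _ _ _).1 h).symm)]; omega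
  -- uniform version of extremeness, symmetric in `u, d u`
  have extS : ∀ s a w, t s w = t s a → (∃ u, t s u = t s a ∧ (a = u ∨ a = d u) ∧ cyc s a ∧
        ExtE (md s u) d (t s) (t (!s)) (ρ (!s)) (pos (!s)) u) → w ≠ a → w ≠ d a →
      (md s a = true ∧ Z (!s) a ≤ Z (!s) w ∧ Z (!s) (d a) ≤ Z (!s) w) ∨
      (md s a = false ∧ Z (!s) w ≤ Z (!s) a ∧ Z (!s) w ≤ Z (!s) (d a)) := by
    rintro s a w hw ⟨u, hu, hau, _, hE⟩ hwa hwd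
    have hm := hmd s u a hu
    have hwu : w ≠ u := by
      rcases hau with rfl | rfl
      · exact hwa
      · rw [hd] at hwd; exact hwd
    have hset : (Z (!s) a = Z (!s) u ∧ Z (!s) (d a) = Z (!s) (d u)) ∨
        (Z (!s) a = Z (!s) (d u) ∧ Z (!s) (d a) = Z (!s) u) := by
      rcases hau with rfl | rfl
      · exact Or.inl ⟨rfl, rfl⟩
      · rw [hd]; exact Or.inr ⟨rfl, rfl⟩
    rcases extZ s u hE with ⟨h0, h1, h2⟩ | ⟨h0, h1, h2⟩
    · have := h2 w (by omega) hwu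
      exact Or.inl ⟨by rw [← hm, h0], by omega, by omega⟩
    · have := h2 w (by omega) hwu
      exact Or.inr ⟨by rw [← hm, h0], by omega, by omega⟩
  have extSep : ∀ s a w w', t s w = t s a → t s w' = t s a →
      (∃ u, t s u = t s a ∧ (a = u ∨ a = d u) ∧ cyc s a ∧
        ExtE (md s u) d (t s) (t (!s)) (ρ (!s)) (pos (!s)) u) → w ≠ a → w ≠ d a →
      w' ≠ a → w' ≠ d a → SepZ Z a (d a) w w' := by
    intro s a w w' hw hw' H h1 h2 h3 h4
    refine ⟨!s, ?_⟩
    rcases extS s a w hw H h1 h2 with ⟨h5, h6⟩ | ⟨h5, h6⟩ <;>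
    rcases extS s a w' hw' H h3 h4 with ⟨h7, h8⟩ | ⟨h7, h8⟩
    · left; omega
    · rw [h5] at h7; cases h7
    · rw [h5] at h7; cases h7
    · right; omega
  have ceq : ∀ s a, Z s (e s a) = Z s a := by
    intro s a
    obtain ⟨exc, L, _⟩ := hLin s a
    have h1 := L.e_eq a rfl
    have h2 := hsame s (e s a) a (eρ s a)
    have h3 := hsame s a (e s a) (eρ s a).symm
    omega
  have cinj : ∀ s a c, Z s a = Z s c → c = a ∨ c = e s a := by
    intro s a c h
    have hr : ρ s a = ρ s c := by
      rcases lt_trichotomy (ρ s a) (ρ s c) with h1 | h1 | h1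
      · have := hdiff s _ _ h1; omega
      · exact h1
      · have := hdiff s _ _ h1; omega
    obtain ⟨exc, L, _⟩ := hLin s a
    have h2 := hsame s a c hr
    have h3 := hsame s c a hr.symm
    exact L.lev_inj a rfl c ((hρ s c a).2 hr.symm) (by omega)
  have rdiff : ∀ s a w w', ρ s w' = ρ s w → ρ s a ≠ ρ s w → SepZ Z a (d a) w w' := by
    intro s a w w' h1 h2
    have h3 := dρ s a
    refine ⟨s, ?_⟩
    rcases lt_or_gt_of_ne h2 with h | h
    · left
      refine ⟨?_, ?_, ?_, ?_⟩ <;> exact le_of_lt (hdiff s _ _ (by omega))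
    · right
      refine ⟨?_, ?_, ?_, ?_⟩ <;> exact le_of_lt (hdiff s _ _ (by omega))
  refine ⟨Z, hZb, ⟨fun s a _ => ceq s a, fun s a _ c _ => cinj s a c, ?_, ?_, ?_⟩, hdiff, ?_, ?_⟩
  · intro s a _ hda h
    rcases cinj s a (d a) h with h1 | h1
    · exact hda h1
    · exact hde s a hda h1
  · intro s a _ w _ hda
    by_cases hr : ρ s a = ρ s w
    swap
    · exact rdiff s a w _ (eρ s w) hr
    obtain ⟨exc, L, hexc⟩ := hLin s a
    have ha : t s a = t s a := rfl
    have hwt : t s w = t s a := (hρ s w a).2 hr.symm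
    by_cases hx : exc a
    · have hu := hexc a hx rfl
      by_cases hw : w = a ∨ w = d a ∨ e s w = a ∨ e s w = d a
      · refine ⟨s, ?_⟩
        have h1 := ceq s w
        rcases hw with h | h | h | h
        · subst h; omega
        · subst h; omega
        · rw [h] at h1 ⊢; omega
        · rw [h] at h1 ⊢; omega
      · push Not at hw
        exact extSep s a w (e s w) hwt (by rw [te, hwt]) hu hw.1 hw.2.1 hw.2.2.1 hw.2.2.2
    · have h1 := L.d_eq a rfl hx
      have h2 := L.e_eq w hwt
      have h3 := ceq s w
      have h4 := hsame s a w hr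
      have h5 := hsame s w a hr.symm
      have h6 := hsame s (d a) w ((dρ s a).trans hr)
      have h7 := hsame s w (d a) ((dρ s a).trans hr).symm
      refine ⟨s, ?_⟩
      omega
  · intro a _ w _ hda hwa hwd
    by_cases hr : ρ false a = ρ false w
    swap
    · exact rdiff false a w _ (dρ _ w) hr
    obtain ⟨exc, L, hexc⟩ := hLin false a
    have hwt : t false w = t false a := (hρ _ w a).2 hr.symm
    have hdwa : d w ≠ a := fun h => hwd (by rw [← h, hd])
    have hdwd : d w ≠ d a := fun h => hwa (hd.injective h)
    by_cases hx : exc a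
    · exact extSep false a w (d w) hwt (by rw [td, hwt]) (hexc a hx rfl) hwa hwd hdwa hdwd
    by_cases hxw : exc w
    · obtain ⟨u, h1, h2, h3, h4⟩ := hexc w hxw hwt
      exact (extSep false w a (d a) hwt.symm (by rw [td, hwt])
        ⟨u, by omega, h2, cc _ _ _ hwt.symm h3, h4⟩ hwa.symm hdwa.symm hwd.symm hdwd.symm).symm
    have h1 := L.d_eq a rfl hx
    have h2 := L.d_eq w hwt hxw
    have hda' : d a ∈ Cls (t false) a := td _ _
    have n1 : pos false (d a) ≠ pos false a := fun h => hda (L.inj _ hda' _ rfl h)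
    have n2 : pos false w ≠ pos false a := fun h => hwa (L.inj _ hwt _ rfl h)
    have n3 : pos false w ≠ pos false (d a) := fun h => hwd (L.inj _ hwt _ hda' h)
    have k1 := hsame false a w hr
    have k2 := hsame false w a hr.symm
    have k3 := hsame false (d a) w ((dρ _ a).trans hr)
    have k4 := hsame false w (d a) ((dρ _ a).trans hr).symm
    have k5 := hsame false a (d w) (hr.trans (dρ _ w).symm)
    have k6 := hsame false (d w) a (hr.trans (dρ _ w).symm).symm
    have k7 := hsame false (d a) (d w) (((dρ _ a).trans hr).trans (dρ _ w).symm)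
    have k8 := hsame false (d w) (d a) (((dρ _ a).trans hr).trans (dρ _ w).symm).symm
    refine ⟨false, ?_⟩
    omega
  · intro s a b hr hc
    rw [hsame s a b hr, hp0 s a hc, hp0 s b (fun h => hc (cc s b a ((hρ _ _ _).2 hr.symm) h))]
  · intro s a w hda h1 h2
    have hr : ρ s w = ρ s a := by
      have hdr := dρ s a
      rcases lt_trichotomy (ρ s a) (ρ s w) with h | h | h
      · have := hdiff s (d a) w (by omega); omega
      · exact h.symm
      · have := hdiff s _ _ h; omega
    have hwt : t s w = t s a := (hρ _ _ _).2 hr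
    obtain ⟨exc, L, hexc⟩ := hLin s a
    have hx : exc a := by
      by_contra hx
      have h3 := L.d_eq a rfl hx
      have h4 := (hsame s a w hr.symm).1 h1
      have h5 := (hsame s w (d a) (hr.trans (dρ s a).symm)).1 h2
      omega
    have hu := hexc a hx rfl
    have hwa : w ≠ a := by rintro rfl; omega
    have hwd : w ≠ d a := by rintro rfl; omega
    obtain ⟨u, q1, q2, q3, q4⟩ := hu
    refine ⟨q3, hwt, ?_⟩
    rcases extS s a w hwt ⟨u, q1, q2, q3, q4⟩ hwa hwd with ⟨h5, h6⟩ | ⟨h5, h6⟩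
    · exact ⟨fun _ => h6, fun h => by rw [h5] at h; cases h⟩
    · exact ⟨fun h => (by rw [h5] at h; cases h), fun _ => h6⟩

theorem seg_le {ℓ : Pt →ₗ[ℝ] ℝ} {P Q x : Pt} (hx : x ∈ segment ℝ P Q) {m : ℝ}
    (h1 : m ≤ ℓ P) (h2 : m ≤ ℓ Q) : m ≤ ℓ x := by
  obtain ⟨a, b, ha, hb, hab, rfl⟩ := hx
  simp only [map_add, map_smul, smul_eq_mul]
  have hm : m = a * m + b * m := by rw [← add_mul, hab, one_mul]
  have := mul_le_mul_of_nonneg_left h1 ha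
  have := mul_le_mul_of_nonneg_left h2 hb
  linarith

theorem seg_ge {ℓ : Pt →ₗ[ℝ] ℝ} {P Q x : Pt} (hx : x ∈ segment ℝ P Q) {m : ℝ}
    (h1 : ℓ P ≤ m) (h2 : ℓ Q ≤ m) : ℓ x ≤ m := by
  obtain ⟨a, b, ha, hb, hab, rfl⟩ := hx
  simp only [map_add, map_smul, smul_eq_mul]
  have hm : m = a * m + b * m := by rw [← add_mul, hab, one_mul]
  have := mul_le_mul_of_nonneg_left h1 ha
  have := mul_le_mul_of_nonneg_left h2 hb
  linarith

theorem seg_end {ℓ : Pt →ₗ[ℝ] ℝ} {P Q x : Pt} (hx : x ∈ segment ℝ P Q)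
    (h : ℓ P ≠ ℓ Q) (h1 : ℓ x = ℓ P) : x = P := by
  obtain ⟨a, b, ha, hb, hab, rfl⟩ := hx
  simp only [map_add, map_smul, smul_eq_mul] at h1
  have ha' : a = 1 - b := by linarith
  subst ha'
  have : b * (ℓ Q - ℓ P) = 0 := by linarith
  rcases mul_eq_zero.1 this with h2 | h2
  · subst h2; simp
  · exact absurd (by linarith) h

theorem seg_symm {P Q x : Pt} (hx : x ∈ segment ℝ P Q) : x ∈ segment ℝ Q P := by
  rw [segment_symm]; exact hx

/-- coordinate functional -/
def co : Bool → Pt →ₗ[ℝ] ℝ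
  | false => LinearMap.fst ℝ ℝ ℝ
  | true => LinearMap.snd ℝ ℝ ℝ

theorem co_ext {x y : Pt} (s : Bool) (h : co s x = co s y) (h' : co (!s) x = co (!s) y) :
    x = y := by
  cases s
  · exact Prod.ext h h'
  · exact Prod.ext h' h

/-- point with integer coordinates -/
def pt {V : Type*} (Z : Bool → V → ℤ) (a : V) : Pt := ((Z false a : ℝ), (Z true a : ℝ))

theorem co_pt {V : Type*} (Z : Bool → V → ℤ) (s : Bool) (a : V) : co s (pt Z a) = Z s a := by
  cases s <;> rfl

/-- crossing condition of two segments belonging to two edges -/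
def Cr {V : Type*} (p : V → Pt) (S S' : Pt × Pt) (a b a' b' : V) : Prop :=
  ∀ x, x ∈ segment ℝ S.1 S.2 → x ∈ segment ℝ S'.1 S'.2 →
    (∃ w, (w = a ∨ w = b) ∧ (w = a' ∨ w = b') ∧ x = p w) ∨
    (a ≠ a' ∧ a ≠ b' ∧ b ≠ a' ∧ b ≠ b' ∧ SegOrth S.1 S.2 S'.1 S'.2)

theorem SegOrth.symm {a b c d : Pt} (h : SegOrth a b c d) : SegOrth c d a b := by
  unfold SegOrth at *; linarith

theorem SegOrth.rev {a b c d : Pt} (h : SegOrth a b c d) : SegOrth b a c d := by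
  unfold SegOrth at *; linarith

theorem Cr.symm {V : Type*} {p : V → Pt} {S S' : Pt × Pt} {a b a' b' : V}
    (H : Cr p S S' a b a' b') : Cr p S' S a' b' a b := by
  intro x h1 h2
  rcases H x h2 h1 with ⟨w, h3, h4, h5⟩ | ⟨h3, h4, h5, h6, h7⟩
  · exact Or.inl ⟨w, h4, h3, h5⟩
  · exact Or.inr ⟨h3.symm, h5.symm, h4.symm, h6.symm, h7.symm⟩

theorem Cr.rev {V : Type*} {p : V → Pt} {P Q : Pt} {S' : Pt × Pt} {a b a' b' : V}
    (H : Cr p (P, Q) S' a b a' b') : Cr p (Q, P) S' b a a' b' := by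
  intro x h1 h2
  rcases H x (seg_symm h1) h2 with ⟨w, h3, h4, h5⟩ | ⟨h3, h4, h5, h6, h7⟩
  · exact Or.inl ⟨w, h3.symm, h4, h5⟩
  · exact Or.inr ⟨h5, h6, h3, h4, h7.rev⟩

theorem orth_of {P Q R S : Pt} (s : Bool) (h : co s P = co s Q) (h' : co (!s) R = co (!s) S) :
    SegOrth P Q R S := by
  unfold SegOrth
  cases s
  · have h1 : P.1 = Q.1 := h
    have h2 : R.2 = S.2 := h'
    rw [h1, h2]; ring
  · have h1 : P.2 = Q.2 := h
    have h2 : R.1 = S.1 := h'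
    rw [h1, h2]; ring

/-- straight-line good drawing of the relation `R` on vertex set `A` -/
structure SG {V : Type*} (R : V → V → Prop) (A : Set V) (p : V → Pt) : Prop where
  inj : ∀ a ∈ A, ∀ b ∈ A, p a = p b → a = b
  off : ∀ a b, R a b → ∀ w ∈ A, w ≠ a → w ≠ b → p w ∉ segment ℝ (p a) (p b)
  cr : ∀ a b a' b', R a b → R a' b' → s(a, b) ≠ s(a', b') →
    Cr p (p a, p b) (p a', p b') a b a' b'

/-- straight edges -/
def SE {V : Type*} (e : Bool → V → V) (d : V → V) (A : Set V) (a b : V) : Prop :=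
  a ∈ A ∧ a ≠ b ∧ ((∃ s, b = e s a) ∨ b = d a)

theorem sepD {V : Type*} {Z : Bool → V → ℤ} {a b c f : V} (hn : ∀ s, Z s a ≠ Z s b)
    (H : SepZ Z a b c f) {x : Pt} (h1 : x ∈ segment ℝ (pt Z a) (pt Z b))
    (h2 : x ∈ segment ℝ (pt Z c) (pt Z f)) : x = pt Z a ∨ x = pt Z b := by
  obtain ⟨s, H⟩ := H
  have hne : co s (pt Z a) ≠ co s (pt Z b) := by
    rw [co_pt, co_pt]; exact_mod_cast hn s
  have e1 : co s x = co s (pt Z a) ∨ co s x = co s (pt Z b) := by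
    rcases H with ⟨k1, k2, k3, k4⟩ | ⟨k1, k2, k3, k4⟩
    · rcases le_total (Z s a) (Z s b) with h | h
      · right
        apply le_antisymm
        · exact seg_ge h1 (by rw [co_pt, co_pt]; exact_mod_cast h) le_rfl
        · exact seg_le h2 (by rw [co_pt, co_pt]; exact_mod_cast k3)
            (by rw [co_pt, co_pt]; exact_mod_cast k4)
      · left
        apply le_antisymm
        · exact seg_ge h1 le_rfl (by rw [co_pt, co_pt]; exact_mod_cast h)
        · exact seg_le h2 (by rw [co_pt, co_pt]; exact_mod_cast k1)
            (by rw [co_pt, co_pt]; exact_mod_cast k2)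
    · rcases le_total (Z s a) (Z s b) with h | h
      · left
        apply le_antisymm
        · exact seg_ge h2 (by rw [co_pt, co_pt]; exact_mod_cast k1)
            (by rw [co_pt, co_pt]; exact_mod_cast k2)
        · exact seg_le h1 le_rfl (by rw [co_pt, co_pt]; exact_mod_cast h)
      · right
        apply le_antisymm
        · exact seg_ge h2 (by rw [co_pt, co_pt]; exact_mod_cast k3)
            (by rw [co_pt, co_pt]; exact_mod_cast k4)
        · exact seg_le h1 (by rw [co_pt, co_pt]; exact_mod_cast h) le_rfl
  rcases e1 with h | h
  · exact Or.inl (seg_end h1 hne h)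
  · exact Or.inr (seg_end (seg_symm h1) hne.symm h)

/-- a segment constant in coordinate `s` -/
theorem seg_const {s : Bool} {P Q x : Pt} {m : ℝ} (hx : x ∈ segment ℝ P Q) (h1 : co s P = m)
    (h2 : co s Q = m) : co s x = m :=
  le_antisymm (seg_ge hx h1.le h2.le) (seg_le hx h1.ge h2.ge)

theorem Cert.sg {V : Type*} {e : Bool → V → V} {d : V → V} {A : Set V} {Z : Bool → V → ℤ}
    (C : Cert e d A Z) (he : ∀ s, Function.Involutive (e s)) (hd : Function.Involutive d)
    (hne : ∀ a ∈ A, e false a ≠ a → e false a ≠ e true a)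
    (hA : ∀ a ∈ A, d a ∈ A ∧ ∀ s, e s a ∈ A) : SG (SE e d A) A (pt Z) := by
  have inj : ∀ a ∈ A, ∀ b ∈ A, pt Z a = pt Z b → a = b := by
    intro a ha b hb h
    have h1 : ∀ s, Z s a = Z s b := by
      intro s
      have : co s (pt Z a) = co s (pt Z b) := by rw [h]
      rw [co_pt, co_pt] at this; exact_mod_cast this
    rcases C.ci false a ha b hb (h1 false) with h2 | h2
    · exact h2.symm
    · rcases C.ci true a ha b hb (h1 true) with h3 | h3
      · exact h3.symm
      · by_contra hab
        exact hne a ha (by rw [← h2]; exact fun h => hab h.symm) (h2.symm.trans h3)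
  have ec : ∀ s, ∀ a ∈ A, ∀ x, x ∈ segment ℝ (pt Z a) (pt Z (e s a)) → co s x = Z s a := by
    intro s a ha x hx
    exact seg_const hx (co_pt _ _ _) (by rw [co_pt, C.ce s a ha])
  have offe : ∀ s, ∀ a ∈ A, ∀ w ∈ A, pt Z w ∈ segment ℝ (pt Z a) (pt Z (e s a)) →
      w = a ∨ w = e s a := by
    intro s a ha w hw h
    have := ec s a ha _ h
    rw [co_pt] at this
    exact C.ci s a ha w hw (by exact_mod_cast this.symm)
  have offd : ∀ a ∈ A, d a ≠ a → ∀ w ∈ A, pt Z w ∈ segment ℝ (pt Z a) (pt Z (d a)) →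
      w = a ∨ w = d a := by
    intro a ha hda w hw h
    rcases sepD (fun s => C.dn s a ha hda) (C.de false a ha w hw hda) h (left_mem_segment ℝ _ _)
      with h1 | h1
    · exact Or.inl (inj _ hw _ ha h1)
    · exact Or.inr (inj _ hw _ (hA a ha).1 h1)
  have off : ∀ a b, SE e d A a b → ∀ w ∈ A, pt Z w ∈ segment ℝ (pt Z a) (pt Z b) →
      w = a ∨ w = b := by
    rintro a b ⟨ha, hab, ⟨s, rfl⟩ | rfl⟩ w hw h
    · exact offe s a ha w hw h
    · exact offd a ha hab.symm w hw h
  have crd : ∀ a ∈ A, d a ≠ a → ∀ c f, SE e d A c f → SepZ Z a (d a) c f →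
      Cr (pt Z) (pt Z a, pt Z (d a)) (pt Z c, pt Z f) a (d a) c f := by
    intro a ha hda c f hcf hs x h1 h2
    left
    rcases sepD (fun s => C.dn s a ha hda) hs h1 h2 with h | h
    · refine ⟨a, Or.inl rfl, off c f hcf a ha ?_, h⟩
      rw [← h]; exact h2
    · refine ⟨d a, Or.inr rfl, off c f hcf _ (hA a ha).1 ?_, h⟩
      rw [← h]; exact h2
  refine ⟨inj, fun a b hab w hw h1 h2 h => (off a b hab w hw h).elim h1 h2, ?_⟩
  intro a b a' b' hab hab' hne'
  have hab0 := hab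
  have hab0' := hab'
  obtain ⟨ha, hn, hk⟩ := hab
  obtain ⟨ha', hn', hk'⟩ := hab'
  rcases hk with ⟨s, rfl⟩ | rfl
  · rcases hk' with ⟨s', rfl⟩ | rfl
    · by_cases hss : s' = s
      · subst hss
        intro x h1 h2
        exfalso
        have e1 := ec s' a ha x h1
        have e2 := ec s' a' ha' x h2
        rcases C.ci s' a ha a' ha' (by exact_mod_cast e1.symm.trans e2) with h | h
        · exact hne' (by rw [h])
        · exact hne' (by rw [h, he, Sym2.eq_swap])
      · have hss' : s' = !s := by cases s <;> cases s' <;> simp_all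
        subst hss'
        intro x h1 h2
        have e1 := ec s a ha x h1
        have e2 := ec (!s) a' ha' x h2
        by_cases hcom : ∃ w, (w = a ∨ w = e s a) ∧ (w = a' ∨ w = e (!s) a')
        · left
          obtain ⟨w, hw1, hw2⟩ := hcom
          refine ⟨w, hw1, hw2, co_ext s ?_ ?_⟩
          · rw [e1, co_pt]
            rcases hw1 with rfl | rfl
            · rfl
            · rw [C.ce s a ha]
          · rw [e2, co_pt]
            rcases hw2 with rfl | rfl
            · rfl
            · rw [C.ce (!s) a' ha']
        · right
          refine ⟨?_, ?_, ?_, ?_, orth_of s ?_ ?_⟩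
          · exact fun h => hcom ⟨a, Or.inl rfl, Or.inl h⟩
          · exact fun h => hcom ⟨a, Or.inl rfl, Or.inr h⟩
          · exact fun h => hcom ⟨e s a, Or.inr rfl, Or.inl h⟩
          · exact fun h => hcom ⟨e s a, Or.inr rfl, Or.inr h⟩
          · rw [co_pt, co_pt, C.ce s a ha]
          · rw [co_pt, co_pt, C.ce _ a' ha']
    · exact (crd a' ha' hn'.symm a _ hab0 (C.de s a' ha' a ha hn'.symm)).symm
  · rcases hk' with ⟨s', rfl⟩ | rfl
    · exact crd a ha hn.symm a' _ hab0' (C.de s' a ha a' ha' hn.symm)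
    · refine crd a ha hn.symm a' _ hab0' (C.dd a ha a' ha' hn.symm ?_ ?_)
      · rintro rfl; exact hne' rfl
      · rintro rfl; exact hne' (by rw [hd, Sym2.eq_swap])

/-- kinds of drawn segments -/
inductive Kd
  | st (s : Bool) | dd | b1 | b2

/-- partner -/
def oth {V : Type*} (e : Bool → V → V) (d b : V → V) (a : V) : Kd → V
  | Kd.st s => e s a
  | Kd.dd => d a
  | Kd.b1 => b a
  | Kd.b2 => b a

/-- active segments -/
def act {V : Type*} (e : Bool → V → V) (d b : V → V) (a : V) : Kd → Prop
  | Kd.st s => e s a ≠ a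
  | Kd.dd => d a ≠ a
  | Kd.b1 => e false a = a ∧ b a ≠ a
  | Kd.b2 => e false a = a ∧ b a ≠ a

/-- bend point -/
def bendPt {V : Type*} (b : V → V) (p : V → Pt) (a : V) : Pt := ((p a).1, (p (b a)).2)

/-- segment -/
def sg {V : Type*} (e : Bool → V → V) (d b : V → V) (p : V → Pt) (a : V) : Kd → Pt × Pt
  | Kd.st s => (p a, p (e s a))
  | Kd.dd => (p a, p (d a))
  | Kd.b1 => (p a, bendPt b p a)
  | Kd.b2 => (bendPt b p a, p (b a))

/-- good drawing -/
structure Good {V : Type*} (e : Bool → V → V) (d b : V → V) (p : V → Pt) : Prop where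
  inj : ∀ a c, p a = p c → a = c
  off : ∀ a k, act e d b a k → ∀ w, w ≠ a → w ≠ oth e d b a k →
    p w ∉ segment ℝ (sg e d b p a k).1 (sg e d b p a k).2
  cr : ∀ a k a' k', act e d b a k → act e d b a' k' →
    s(a, oth e d b a k) ≠ s(a', oth e d b a' k') →
    Cr p (sg e d b p a k) (sg e d b p a' k') a (oth e d b a k) a' (oth e d b a' k')

/-- combinatorial data -/
structure Dat {V : Type*} (e : Bool → V → V) (d b : V → V) : Prop where
  he : ∀ s, Function.Involutive (e s)
  hd : Function.Involutive d
  hb : Function.Involutive b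
  hfix : ∀ a, e true a ≠ a
  ne1 : ∀ a, e false a ≠ e true a
  ne2 : ∀ a, d a ≠ a → ∀ s, d a ≠ e s a
  ne3 : ∀ a, b a ≠ a → b a ≠ d a ∧ ∀ s, b a ≠ e s a
  deg : ∀ a, b a = a → e false a ≠ a ∧ d a ≠ a
  bent : ∀ a, b a ≠ a →
    (e false a = a ∧ d a ≠ a ∧ d (b a) = b a ∧ e false (b a) ≠ b a) ∨
    (d a = a ∧ e false a ≠ a ∧ e false (b a) = b a ∧ d (b a) ≠ b a)
  hout : ∀ a, d a = a → ¬ Orb (e false) d a (e true a)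
  brel : ∀ a, Orb (e false) d a (b a)

theorem SG.good {V : Type*} {e : Bool → V → V} {d : V → V} {p : V → Pt}
    (H : SG (SE e d Set.univ) Set.univ p) : Good e d id p := by
  have key : ∀ a k, act e d id a k → SE e d Set.univ a (oth e d id a k) ∧
      sg e d id p a k = (p a, p (oth e d id a k)) := by
    intro a k hk
    cases k with
    | st s => exact ⟨⟨trivial, Ne.symm hk, Or.inl ⟨s, rfl⟩⟩, rfl⟩
    | dd => exact ⟨⟨trivial, Ne.symm hk, Or.inr rfl⟩, rfl⟩
    | b1 => exact absurd rfl hk.2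
    | b2 => exact absurd rfl hk.2
  refine ⟨fun a c h => H.inj a trivial c trivial h, ?_, ?_⟩
  · intro a k hk w h1 h2
    rw [(key a k hk).2]
    exact H.off a _ (key a k hk).1 w trivial h1 h2
  · intro a k a' k' hk hk' hne
    rw [(key a k hk).2, (key a' k' hk').2]
    exact H.cr a _ a' _ (key a k hk).1 (key a' k' hk').1 hne

theorem seg_nb {V : Type*} {Z : Bool → V → ℤ} {a b : V} (s : Bool) (hn : Z s a ≠ Z s b) {m : ℤ}
    (h1 : ¬ (Z s a < m ∧ m < Z s b)) (h2 : ¬ (Z s b < m ∧ m < Z s a)) {x : Pt}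
    (hx : x ∈ segment ℝ (pt Z a) (pt Z b)) (hm : co s x = m) :
    (x = pt Z a ∧ m = Z s a) ∨ (x = pt Z b ∧ m = Z s b) := by
  have hne : co s (pt Z a) ≠ co s (pt Z b) := by
    rw [co_pt, co_pt]; exact_mod_cast hn
  have hlo : min (Z s a) (Z s b) ≤ m := by
    have : ((min (Z s a) (Z s b) : ℤ) : ℝ) ≤ co s x :=
      seg_le hx (by rw [co_pt]; exact_mod_cast min_le_left _ _)
        (by rw [co_pt]; exact_mod_cast min_le_right _ _)
    rw [hm] at this; exact_mod_cast this
  have hhi : m ≤ max (Z s a) (Z s b) := by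
    have : co s x ≤ ((max (Z s a) (Z s b) : ℤ) : ℝ) :=
      seg_ge hx (by rw [co_pt]; exact_mod_cast le_max_left _ _)
        (by rw [co_pt]; exact_mod_cast le_max_right _ _)
    rw [hm] at this; exact_mod_cast this
  have : m = Z s a ∨ m = Z s b := by omega
  rcases this with h | h
  · left; exact ⟨seg_end hx hne (by rw [hm, co_pt, h]), h⟩
  · right; exact ⟨seg_end (seg_symm hx) hne.symm (by rw [hm, co_pt, h]), h⟩

theorem seg_lo {s : Bool} {P Q : Pt} {i j : ℤ} {x : Pt}
    (hx : x ∈ segment ℝ P Q) (h1 : co s P = i) (h2 : co s Q = j) :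
    (min i j : ℤ) ≤ co s x ∧ co s x ≤ (max i j : ℤ) := by
  constructor
  · exact seg_le hx (by rw [h1]; exact_mod_cast min_le_left _ _)
      (by rw [h2]; exact_mod_cast min_le_right _ _)
  · exact seg_ge hx (by rw [h1]; exact_mod_cast le_max_left _ _)
      (by rw [h2]; exact_mod_cast le_max_right _ _)

theorem good_of_cert {V : Type*} {e : Bool → V → V} {d b : V → V} {Z : Bool → V → ℤ}
    (D : Dat e d b) (C : Cert e d Set.univ Z)
    (B1 : ∀ u, e false u = u → b u ≠ u → ∀ a, d a ≠ a →
      ¬ (Z false a < Z false u ∧ Z false u < Z false (d a)))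
    (B2 : ∀ u, e false u = u → b u ≠ u → ∀ a, d a ≠ a →
      ¬ (Z true a < Z true (b u) ∧ Z true (b u) < Z true (d a)))
    (B3 : ∀ u, e false u = u → b u ≠ u →
      (Z false u < Z false (b u) ∧ Z false (b u) < Z false (e true (b u))) ∨
      (Z false (e true (b u)) < Z false (b u) ∧ Z false (b u) < Z false u)) :
    Good e d b (pt Z) := by
  have S := C.sg D.he D.hd (fun a _ _ => D.ne1 a) (fun a _ => ⟨trivial, fun _ => trivial⟩)
  have ci : ∀ s a c, Z s a = Z s c → c = a ∨ c = e s a :=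
    fun s a c h => C.ci s a trivial c trivial h
  have ce : ∀ s a, Z s (e s a) = Z s a := fun s a => C.ce s a trivial
  have hbent : ∀ u, e false u = u → b u ≠ u → d (b u) = b u ∧ e false (b u) ≠ b u := by
    intro u h1 h2
    rcases D.bent u h2 with h | h
    · exact ⟨h.2.2.1, h.2.2.2⟩
    · exact absurd h1 h.2.1
  have q1 : ∀ u, co false (bendPt b (pt Z) u) = Z false u := fun u => rfl
  have q2 : ∀ u, co true (bendPt b (pt Z) u) = Z true (b u) := fun u => rfl
  -- membership facts
  have m1 : ∀ u x, x ∈ segment ℝ (pt Z u) (bendPt b (pt Z) u) → co false x = Z false u :=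
    fun u x hx => seg_const hx (co_pt _ _ _) (q1 u)
  have m2 : ∀ u x, x ∈ segment ℝ (bendPt b (pt Z) u) (pt Z (b u)) → co true x = Z true (b u) :=
    fun u x hx => seg_const hx (q2 u) (co_pt _ _ _)
  have m3 : ∀ u x, x ∈ segment ℝ (bendPt b (pt Z) u) (pt Z (b u)) →
      (min (Z false u) (Z false (b u)) : ℤ) ≤ co false x ∧
      co false x ≤ (max (Z false u) (Z false (b u)) : ℤ) :=
    fun u x hx => seg_lo hx (q1 u) (co_pt _ _ _)
  have mc : ∀ s a x, x ∈ segment ℝ (pt Z a) (pt Z (e s a)) → co s x = Z s a :=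
    fun s a x hx => seg_const hx (co_pt _ _ _) (by rw [co_pt, ce])
  -- helper : x = p hw impossible on b2
  have nohw : ∀ u, e false u = u → b u ≠ u →
      ¬ pt Z (e true (b u)) ∈ segment ℝ (bendPt b (pt Z) u) (pt Z (b u)) := by
    intro u h1 h2 hx
    obtain ⟨h3, h4⟩ := m3 u _ hx
    rw [co_pt] at h3 h4
    have h3' : min (Z false u) (Z false (b u)) ≤ Z false (e true (b u)) := by exact_mod_cast h3
    have h4' : Z false (e true (b u)) ≤ max (Z false u) (Z false (b u)) := by exact_mod_cast h4
    rcases B3 u h1 h2 with h | h <;> omega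
  have colu : ∀ u, e false u = u → ∀ c, Z false u = Z false c → c = u := by
    intro u h1 c h
    rcases ci false u c h with h' | h'
    · exact h'
    · rw [h', h1]
  have cb1st : ∀ u, e false u = u → b u ≠ u → ∀ s a, e s a ≠ a →
      Cr (pt Z) (pt Z u, bendPt b (pt Z) u) (pt Z a, pt Z (e s a)) u (b u) a (e s a) := by
    intro u h1 h2 s a ha x hx hx'
    have e1 := m1 u x hx
    have e2 := mc s a x hx'
    cases s
    · exfalso
      have : a = u := colu u h1 a (by exact_mod_cast e1.symm.trans e2)
      rw [this] at ha; exact ha h1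
    · by_cases hcu : u = a ∨ u = e true a
      · left
        refine ⟨u, Or.inl rfl, hcu, co_ext false (by rw [e1, co_pt]) ?_⟩
        show co true x = co true (pt Z u)
        rw [e2, co_pt]
        rcases hcu with h | h
        · rw [h]
        · rw [h, ce]
      by_cases hcw : b u = a ∨ b u = e true a
      · exfalso
        have e3 : (min (Z false (b u)) (Z false (e true (b u))) : ℤ) ≤ co false x ∧
            co false x ≤ (max (Z false (b u)) (Z false (e true (b u))) : ℤ) := by
          refine seg_lo (P := pt Z (b u)) (Q := pt Z (e true (b u))) ?_
            (co_pt _ _ _) (co_pt _ _ _)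
          rcases hcw with h | h
          · rw [h]; exact hx'
          · rw [h, D.he]; exact seg_symm hx'
        rw [e1] at e3
        obtain ⟨e3, e4⟩ := e3
        have e3' : min (Z false (b u)) (Z false (e true (b u))) ≤ Z false u := by exact_mod_cast e3
        have e4' : Z false u ≤ max (Z false (b u)) (Z false (e true (b u))) := by exact_mod_cast e4
        rcases B3 u h1 h2 with h | h <;> omega
      · right
        push Not at hcu hcw
        refine ⟨hcu.1, hcu.2, hcw.1, hcw.2, orth_of false ?_ ?_⟩
        · rw [q1, co_pt]
        · show co true _ = co true _
          rw [co_pt, co_pt, ce]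
  have cb1d : ∀ u, e false u = u → b u ≠ u → ∀ a, d a ≠ a →
      Cr (pt Z) (pt Z u, bendPt b (pt Z) u) (pt Z a, pt Z (d a)) u (b u) a (d a) := by
    intro u h1 h2 a ha x hx hx'
    have e1 := m1 u x hx
    left
    rcases seg_nb false (C.dn false a trivial ha) (B1 u h1 h2 a ha)
      (by have := B1 u h1 h2 (d a) (by rw [D.hd]; exact ha.symm)
          rw [D.hd] at this; exact this) hx' e1 with ⟨h3, h4⟩ | ⟨h3, h4⟩
    · have := colu u h1 a h4
      exact ⟨u, Or.inl rfl, Or.inl this.symm, by rw [h3, this]⟩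
    · have := colu u h1 (d a) h4
      exact ⟨u, Or.inl rfl, Or.inr this.symm, by rw [h3, this]⟩
  have cb2st : ∀ u, e false u = u → b u ≠ u → ∀ s a, e s a ≠ a →
      Cr (pt Z) (bendPt b (pt Z) u, pt Z (b u)) (pt Z a, pt Z (e s a)) u (b u) a (e s a) := by
    intro u h1 h2 s a ha x hx hx'
    have e1 := m2 u x hx
    have e2 := mc s a x hx'
    cases s
    · have hcu : ¬ (u = a ∨ u = e false a) := by
        rintro (h | h)
        · rw [← h] at ha; exact ha h1
        · have : a = u := by rw [← h1, h, D.he]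
          rw [this] at ha; exact ha h1
      by_cases hcw : b u = a ∨ b u = e false a
      · left
        refine ⟨b u, Or.inr rfl, hcw, co_ext true (by rw [e1, co_pt]) ?_⟩
        show co false x = co false (pt Z (b u))
        rw [e2, co_pt]
        rcases hcw with h | h
        · rw [h]
        · rw [h, ce]
      · right
        push Not at hcu hcw
        refine ⟨hcu.1, hcu.2, hcw.1, hcw.2, orth_of true ?_ ?_⟩
        · rw [q2, co_pt]
        · show co false _ = co false _
          rw [co_pt, co_pt, ce]
    · left
      have hcw : b u = a ∨ b u = e true a := ci true a (b u) (by exact_mod_cast e2.symm.trans e1)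
      have e3 : (min (Z false (b u)) (Z false (e true (b u))) : ℤ) ≤ co false x ∧
          co false x ≤ (max (Z false (b u)) (Z false (e true (b u))) : ℤ) := by
        refine seg_lo (P := pt Z (b u)) (Q := pt Z (e true (b u))) ?_
          (co_pt _ _ _) (co_pt _ _ _)
        rcases hcw with h | h
        · rw [h]; exact hx'
        · rw [h, D.he]; exact seg_symm hx'
      refine ⟨b u, Or.inr rfl, hcw, co_ext true (by rw [e1, co_pt]) ?_⟩
      show co false x = co false (pt Z (b u))
      rw [co_pt]
      have e4 := m3 u x hx
      rcases B3 u h1 h2 with ⟨h, h'⟩ | ⟨h, h'⟩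
      · rw [max_eq_right h.le] at e4
        rw [min_eq_left h'.le] at e3
        exact le_antisymm e4.2 e3.1
      · rw [min_eq_right h'.le] at e4
        rw [max_eq_left h.le] at e3
        exact le_antisymm e3.2 e4.1
  have cb2d : ∀ u, e false u = u → b u ≠ u → ∀ a, d a ≠ a →
      Cr (pt Z) (bendPt b (pt Z) u, pt Z (b u)) (pt Z a, pt Z (d a)) u (b u) a (d a) := by
    intro u h1 h2 a ha x hx hx'
    have e1 := m2 u x hx
    exfalso
    have hdw := (hbent u h1 h2).1
    have fin : ∀ c, d c ≠ c → x = pt Z c → Z true (b u) = Z true c → False := by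
      intro c hc h3 h4
      rcases ci true (b u) c h4 with h | h
      · rw [h] at hc; exact hc hdw
      · apply nohw u h1 h2
        rw [← h, ← h3]; exact hx
    have hda' : d (d a) ≠ d a := by rw [D.hd]; exact ha.symm
    rcases seg_nb true (C.dn true a trivial ha) (B2 u h1 h2 a ha)
      (by have := B2 u h1 h2 (d a) hda'
          rw [D.hd] at this; exact this) hx' e1 with ⟨h3, h4⟩ | ⟨h3, h4⟩
    · exact fin a ha h3 h4
    · exact fin (d a) hda' h3 h4
  have nocom : ∀ u u', e false u = u → b u ≠ u → e false u' = u' → b u' ≠ u' →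
      s(u, b u) ≠ s(u', b u') → u ≠ u' ∧ u ≠ b u' ∧ b u ≠ u' ∧ b u ≠ b u' := by
    intro u u' h1 h2 h3 h4 hne
    refine ⟨?_, ?_, ?_, ?_⟩
    · rintro rfl; exact hne rfl
    · intro h; rw [h] at h1; exact (hbent u' h3 h4).2 h1
    · intro h; rw [← h] at h3; exact (hbent u h1 h2).2 h3
    · intro h; have := D.hb.injective h; exact hne (by rw [this])
  have cb11 : ∀ u u', e false u = u → b u ≠ u → e false u' = u' → b u' ≠ u' →
      s(u, b u) ≠ s(u', b u') → Cr (pt Z) (pt Z u, bendPt b (pt Z) u)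
        (pt Z u', bendPt b (pt Z) u') u (b u) u' (b u') := by
    intro u u' h1 h2 h3 h4 hne x hx hx'
    exfalso
    have e1 := m1 u x hx
    have e2 := m1 u' x hx'
    exact (nocom u u' h1 h2 h3 h4 hne).1
      (colu u h1 u' (by exact_mod_cast e1.symm.trans e2)).symm
  have cb12 : ∀ u u', e false u = u → b u ≠ u → e false u' = u' → b u' ≠ u' →
      s(u, b u) ≠ s(u', b u') → Cr (pt Z) (pt Z u, bendPt b (pt Z) u)
        (bendPt b (pt Z) u', pt Z (b u')) u (b u) u' (b u') := by
    intro u u' h1 h2 h3 h4 hne x hx hx'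
    right
    obtain ⟨n1, n2, n3, n4⟩ := nocom u u' h1 h2 h3 h4 hne
    refine ⟨n1, n2, n3, n4, orth_of false ?_ ?_⟩
    · rw [q1, co_pt]
    · show co true _ = co true _
      rw [q2, co_pt]
  have cb22 : ∀ u u', e false u = u → b u ≠ u → e false u' = u' → b u' ≠ u' →
      s(u, b u) ≠ s(u', b u') → Cr (pt Z) (bendPt b (pt Z) u, pt Z (b u))
        (bendPt b (pt Z) u', pt Z (b u')) u (b u) u' (b u') := by
    intro u u' h1 h2 h3 h4 hne x hx hx'
    exfalso
    obtain ⟨n1, n2, n3, n4⟩ := nocom u u' h1 h2 h3 h4 hne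
    have e1 := m2 u x hx
    have e2 := m2 u' x hx'
    rcases ci true (b u) (b u') (by exact_mod_cast e1.symm.trans e2) with h | h
    · exact n4 h.symm
    · have h' : e true (b u') = b u := by rw [h, D.he]
      obtain ⟨e3, e4⟩ := m3 u x hx
      obtain ⟨e5, e6⟩ := m3 u' x hx'
      have e7 : min (Z false u) (Z false (b u)) ≤ max (Z false u') (Z false (b u')) := by
        exact_mod_cast e3.trans e6
      have e8 : min (Z false u') (Z false (b u')) ≤ max (Z false u) (Z false (b u)) := by
        exact_mod_cast e5.trans e4
      have k1 := B3 u h1 h2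
      have k2 := B3 u' h3 h4
      rw [← h] at k1
      rw [h'] at k2
      omega
  refine ⟨fun a c h => S.inj a trivial c trivial h, ?_, ?_⟩
  · intro a k hk w n1 n2 hx
    cases k with
    | st s => exact S.off a (e s a) ⟨trivial, Ne.symm hk, Or.inl ⟨s, rfl⟩⟩ w trivial n1 n2 hx
    | dd => exact S.off a (d a) ⟨trivial, Ne.symm hk, Or.inr rfl⟩ w trivial n1 n2 hx
    | b1 =>
      have := m1 a _ hx
      rw [co_pt] at this
      exact n1 (colu a hk.1 w (by exact_mod_cast this.symm))
    | b2 =>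
      have := m2 a _ hx
      rw [co_pt] at this
      rcases ci true (b a) w (by exact_mod_cast this.symm) with h | h
      · exact n2 h
      · exact nohw a hk.1 hk.2 (by rw [← h]; exact hx)
  · intro a k a' k' hk hk' hne
    cases k with
    | st s =>
      cases k' with
      | st s' =>
        exact S.cr a _ a' _ ⟨trivial, Ne.symm hk, Or.inl ⟨s, rfl⟩⟩
          ⟨trivial, Ne.symm hk', Or.inl ⟨s', rfl⟩⟩ hne
      | dd =>
        exact S.cr a _ a' _ ⟨trivial, Ne.symm hk, Or.inl ⟨s, rfl⟩⟩
          ⟨trivial, Ne.symm hk', Or.inr rfl⟩ hne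
      | b1 => exact (cb1st a' hk'.1 hk'.2 s a hk).symm
      | b2 => exact (cb2st a' hk'.1 hk'.2 s a hk).symm
    | dd =>
      cases k' with
      | st s' =>
        exact S.cr a _ a' _ ⟨trivial, Ne.symm hk, Or.inr rfl⟩
          ⟨trivial, Ne.symm hk', Or.inl ⟨s', rfl⟩⟩ hne
      | dd =>
        exact S.cr a _ a' _ ⟨trivial, Ne.symm hk, Or.inr rfl⟩
          ⟨trivial, Ne.symm hk', Or.inr rfl⟩ hne
      | b1 => exact (cb1d a' hk'.1 hk'.2 a hk).symm
      | b2 => exact (cb2d a' hk'.1 hk'.2 a hk).symm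
    | b1 =>
      cases k' with
      | st s' => exact cb1st a hk.1 hk.2 s' a' hk'
      | dd => exact cb1d a hk.1 hk.2 a' hk'
      | b1 => exact cb11 a a' hk.1 hk.2 hk'.1 hk'.2 hne
      | b2 => exact cb12 a a' hk.1 hk.2 hk'.1 hk'.2 hne
    | b2 =>
      cases k' with
      | st s' => exact cb2st a hk.1 hk.2 s' a' hk'
      | dd => exact cb2d a hk.1 hk.2 a' hk'
      | b1 => exact (cb12 a' a hk'.1 hk'.2 hk.1 hk.2 hne.symm).symm
      | b2 => exact cb22 a a' hk.1 hk.2 hk'.1 hk'.2 hne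

theorem tau1 {N : Type*} [Finite N] (G : SimpleGraph N) (hG : G.Connected) (root b : N)
    (hb : G.Adj root b) : ∃ τ : N → ℕ, Function.Injective τ ∧ τ root = 0 ∧
      (∀ x, x ≠ root → τ b ≤ τ x) ∧ ∀ x, x ≠ root → ∃ y, G.Adj x y ∧ τ y < τ x := by
  obtain ⟨M, ⟨f⟩⟩ := Finite.exists_equiv_fin N
  have : Nonempty N := ⟨root⟩
  have hM : 0 < M := by
    have := (f root).2; omega
  haveI : NeZero M := ⟨by omega⟩
  let g : N ≃ Fin M := f.trans (Equiv.swap (f b) 0)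
  have gb : g b = 0 := by simp [g]
  have hdist : ∀ x, x ≠ root → 1 ≤ G.dist root x := by
    intro x hx
    exact hG.pos_dist_of_ne hx.symm
  refine ⟨fun x => if x = root then 0 else G.dist root x * M + (g x : ℕ), ?_, ?_, ?_, ?_⟩
  · intro x y h
    dsimp only at h
    have hl : ∀ x, x ≠ root → 1 ≤ G.dist root x * M := fun x hx =>
      Nat.one_le_iff_ne_zero.2 (Nat.mul_ne_zero (by have := hdist x hx; omega) (by omega))
    by_cases hx : x = root <;> by_cases hy : y = root
    · rw [hx, hy]
    · rw [if_pos hx, if_neg hy] at h; have := hl y hy; omega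
    · rw [if_neg hx, if_pos hy] at h; have := hl x hx; omega
    · rw [if_neg hx, if_neg hy] at h
      have h1 := congrArg (· % M) h
      simp only [Nat.mul_add_mod_self_right, Nat.mod_eq_of_lt (g x).2,
        Nat.mod_eq_of_lt (g y).2] at h1
      exact g.injective (Fin.ext h1)
  · simp
  · intro x hx
    dsimp only
    have h1 : b ≠ root := hb.ne.symm
    rw [if_neg h1, if_neg hx, gb, SimpleGraph.dist_eq_one_iff_adj.2 hb]
    have h2 := Nat.mul_le_mul_right M (hdist x hx)
    have h0 : ((0 : Fin M) : ℕ) = 0 := rfl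
    omega
  · intro x hx
    obtain ⟨p, hp⟩ := hG.exists_walk_length_eq_dist x root
    cases p with
    | nil => exact absurd rfl hx
    | @cons _ y _ h q =>
      refine ⟨y, h, ?_⟩
      dsimp only
      rw [if_neg hx]
      have h1 : G.dist root y + 1 ≤ G.dist root x := by
        rw [SimpleGraph.dist_comm (u := root) (v := x), ← hp, SimpleGraph.Walk.length_cons,
          SimpleGraph.dist_comm]
        have := SimpleGraph.dist_le q
        omega
      have h2 := Nat.mul_le_mul_right M h1
      have h3 := (g y).2
      rw [add_mul, one_mul] at h2
      split_ifs <;> omega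

theorem tau2 {N : Type*} [Finite N] (G : SimpleGraph N) (x0 : N)
    (hG : (G.induce {x0}ᶜ).Connected) (root b : N) (hr : root ≠ x0) (hb0 : b ≠ x0)
    (hb : G.Adj root b) (hx0 : ∃ y, G.Adj x0 y) : ∃ τ : N → ℕ, Function.Injective τ ∧
      τ root = 0 ∧
      (∀ x, x ≠ root → τ b ≤ τ x) ∧ (∀ x, x ≠ root → ∃ y, G.Adj x y ∧ τ y < τ x) ∧
      ∀ x, τ x ≤ τ x0 := by
  obtain ⟨τ, h1, h2, h3, h4⟩ := tau1 (G.induce {x0}ᶜ) hG ⟨root, hr⟩ ⟨b, hb0⟩ hb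
  obtain ⟨B, hB⟩ := (Set.finite_range τ).bddAbove
  have hB' : ∀ x, τ x ≤ B := fun x => hB ⟨x, rfl⟩
  refine ⟨fun x => if h : x = x0 then B + 1 else τ ⟨x, h⟩, ?_, ?_, ?_, ?_, ?_⟩
  · intro x y h
    dsimp only at h
    by_cases hx : x = x0 <;> by_cases hy : y = x0
    · rw [hx, hy]
    · rw [dif_pos hx, dif_neg hy] at h; have := hB' ⟨y, hy⟩; omega
    · rw [dif_neg hx, dif_pos hy] at h; have := hB' ⟨x, hx⟩; omega
    · rw [dif_neg hx, dif_neg hy] at h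
      have := h1 h
      exact congrArg Subtype.val this
  · simp only [dif_neg hr, h2]
  · intro x hx
    dsimp only
    rw [dif_neg hb0]
    by_cases hx' : x = x0
    · rw [dif_pos hx']; have := hB' ⟨b, hb0⟩; omega
    · rw [dif_neg hx']; exact h3 _ (fun h => hx (congrArg Subtype.val h))
  · intro x hx
    by_cases hx' : x = x0
    · obtain ⟨y, hy⟩ := hx0
      have hyn : y ≠ x0 := hy.ne.symm
      refine ⟨y, by rw [hx']; exact hy, ?_⟩
      dsimp only
      rw [dif_pos hx', dif_neg hyn]
      have := hB' ⟨y, hyn⟩; omega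
    · obtain ⟨⟨y, hyn⟩, hy, hlt⟩ := h4 ⟨x, hx'⟩ (fun h => hx (congrArg Subtype.val h))
      have hyn' : y ≠ x0 := hyn
      refine ⟨y, hy, ?_⟩
      dsimp only
      rw [dif_neg hx', dif_neg hyn']
      exact hlt
  · intro x
    dsimp only
    rw [dif_pos rfl]
    split_ifs
    · omega
    · have := hB' ⟨x, by assumption⟩; omega

/-- connectedness -/
def Conn {V : Type*} (e : Bool → V → V) (d : V → V) : Prop :=
  ∀ T : Set V, T.Nonempty → (∀ a ∈ T, d a ∈ T ∧ ∀ s, e s a ∈ T) → T = Set.univ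

/-- class setoid -/
def nodeSetoid {V : Type*} (e : Bool → V → V) (d : V → V) (he : ∀ s, Function.Involutive (e s))
    (hd : Function.Involutive d) : Setoid (Bool × V) where
  r x y := x.1 = y.1 ∧ Orb (e x.1) d x.2 y.2
  iseqv := ⟨fun x => ⟨rfl, Orb.rfl' _⟩,
    fun {x y} h => ⟨h.1.symm, by rw [← h.1]; exact h.2.symm' (he _) hd⟩,
    fun {x y z} h h' => ⟨h.1.trans h'.1, h.2.trans' (by rw [h.1]; exact h'.2)⟩⟩

theorem exists_nodes.{u} {V : Type u} [Finite V] (e : Bool → V → V) (d : V → V)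
    (he : ∀ s, Function.Involutive (e s)) (hd : Function.Involutive d) (hc : Conn e d)
    (r0 : V) :
    ∃ (N : Type u) (_ : Finite N) (G : SimpleGraph N) (c : Bool → V → N),
      G.Connected ∧ (∀ s a b, c s a = c s b ↔ Orb (e s) d a b) ∧ (∀ a b, c false a ≠ c true b) ∧
      (∀ x, ∃ s a, x = c s a) ∧ (∀ s a, G.Adj (c s a) (c (!s) a)) ∧
      (∀ s a x, G.Adj (c s a) x → ∃ u, c s u = c s a ∧ x = c (!s) u) := by
  let S := nodeSetoid e d he hd
  let c : Bool → V → Quotient S := fun s a => Quotient.mk S (s, a)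
  have cs : ∀ x, ∃ s a, x = c s a := by
    intro x
    induction x using Quotient.inductionOn with
    | h p => exact ⟨p.1, p.2, rfl⟩
  have c1 : ∀ s a b, c s a = c s b ↔ Orb (e s) d a b := by
    intro s a b
    constructor
    · intro h; exact (Quotient.exact h).2
    · intro h; exact Quotient.sound ⟨rfl, h⟩
  have c2 : ∀ s a b, c s a ≠ c (!s) b := by
    intro s a b h
    have : s = !s := (Quotient.exact h).1
    cases s <;> cases this
  let G : SimpleGraph (Quotient S) :=
    { Adj := fun x y => ∃ s a, x = c s a ∧ y = c (!s) a
      symm := ⟨by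
        rintro x y ⟨s, a, h1, h2⟩
        exact ⟨!s, a, h2, by rw [Bool.not_not]; exact h1⟩⟩
      loopless := ⟨by
        rintro x ⟨s, a, h1, h2⟩
        exact c2 s a a (h1.symm.trans h2)⟩ }
  have ga : ∀ s a, G.Adj (c s a) (c (!s) a) := fun s a => ⟨s, a, rfl, rfl⟩
  refine ⟨Quotient S, inferInstance, G, c, ?_, c1, c2 false, cs, ga, ?_⟩
  · have hT := hc {a | ∀ s, G.Reachable (c false r0) (c s a)} ⟨r0, ?_⟩ ?_
    · haveI : Nonempty (Quotient S) := ⟨c false r0⟩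
      refine SimpleGraph.Connected.mk ?_
      have hr : ∀ x, G.Reachable (c false r0) x := by
        intro x
        obtain ⟨s, a, rfl⟩ := cs x
        have : a ∈ {a | ∀ s, G.Reachable (c false r0) (c s a)} := by rw [hT]; trivial
        exact this s
      intro x y
      exact (hr x).symm.trans (hr y)
    · intro s
      cases s
      · exact SimpleGraph.Reachable.refl _
      · exact (ga false r0).reachable
    · intro a ha
      constructor
      · intro s
        have := (c1 s a (d a)).2 (Orb.g_right _)
        rw [← this]; exact ha s
      · intro s
        have h1 := (c1 s a (e s a)).2 (Orb.f_right _)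
        have h2 : G.Reachable (c false r0) (c s (e s a)) := by rw [← h1]; exact ha s
        intro s'
        by_cases h : s' = s
        · rw [h]; exact h2
        · have : s' = !s := by cases s <;> cases s' <;> simp_all
          rw [this]
          exact h2.trans (ga s _).reachable
  · rintro s a x ⟨s', u, h1, h2⟩
    have : s = s' := (Quotient.exact h1).1
    subst this
    exact ⟨u, h1.symm, h2⟩

/-- label package -/
structure Lab {V : Type*} (e : Bool → V → V) (d : V → V) (r0 : V) (t : Bool → V → ℕ) : Prop where
  orb : ∀ s a b, t s a = t s b ↔ Orb (e s) d a b
  t0 : t false r0 = 0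
  ne : ∀ a b, t false a ≠ t true b
  snd : ∀ a, t true r0 ≤ t true a
  nb : ∀ s a, ¬ (s = false ∧ t false a = t false r0) → ∃ u, t s u = t s a ∧ t (!s) u < t s u ∧
    ∀ w, t s w = t s u → t (!s) u ≤ t (!s) w

theorem lab_of_tau {V N : Type*} [Finite V] (e : Bool → V → V) (d : V → V)
    (G : SimpleGraph N) (c : Bool → V → N) (c1 : ∀ s a b, c s a = c s b ↔ Orb (e s) d a b)
    (c2 : ∀ a b, c false a ≠ c true b)
    (c4 : ∀ s a x, G.Adj (c s a) x → ∃ u, c s u = c s a ∧ x = c (!s) u) (r0 : V)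
    (τ : N → ℕ) (h1 : Function.Injective τ) (h2 : τ (c false r0) = 0)
    (h3 : ∀ x, x ≠ c false r0 → τ (c true r0) ≤ τ x)
    (h4 : ∀ x, x ≠ c false r0 → ∃ y, G.Adj x y ∧ τ y < τ x) :
    Lab e d r0 (fun s a => τ (c s a)) := by
  refine ⟨?_, h2, ?_, ?_, ?_⟩
  · intro s a b
    rw [← c1]
    exact ⟨fun h => h1 h, fun h => congrArg τ h⟩
  · intro a b h
    exact c2 a b (h1 h)
  · intro a
    exact h3 _ (c2 r0 a).symm
  · intro s a hs
    have hne : c s a ≠ c false r0 := by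
      intro h
      cases s
      · exact hs ⟨rfl, congrArg τ h⟩
      · exact c2 r0 a h.symm
    obtain ⟨y, hy, hlt⟩ := h4 _ hne
    obtain ⟨u0, hu0, rfl⟩ := c4 s a y hy
    obtain ⟨u, hu, hmin⟩ := Set.exists_min_image {w | c s w = c s a} (fun w => τ (c (!s) w))
      (Set.toFinite _) ⟨u0, hu0⟩
    have hu' : c s u = c s a := hu
    refine ⟨u, by rw [hu'], ?_, ?_⟩
    · rw [hu']; exact lt_of_le_of_lt (hmin u0 hu0) hlt
    · intro w hw
      exact hmin w ((h1 hw).trans hu')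

theorem exists_lab {V : Type*} [Finite V] (e : Bool → V → V) (d : V → V)
    (he : ∀ s, Function.Involutive (e s)) (hd : Function.Involutive d) (hc : Conn e d)
    (r0 : V) : ∃ t, Lab e d r0 t := by
  obtain ⟨N, _, G, c, g1, c1, c2, c3, g2, c4⟩ := exists_nodes e d he hd hc r0
  obtain ⟨τ, h1, h2, h3, h4⟩ := tau1 G g1 (c false r0) (c true r0) (g2 false r0)
  exact ⟨_, lab_of_tau e d G c c1 c2 c4 r0 τ h1 h2 h3 h4⟩

/-- cyclic class -/
def Cyc {V : Type*} (e : Bool → V → V) (d : V → V) (t : Bool → V → ℕ) (s : Bool) (a : V) : Prop :=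
  ∀ w, t s w = t s a → e s w ≠ w ∧ d w ≠ w

theorem cert_of_lab {V : Type*} [Fintype V] (e : Bool → V → V) (d : V → V)
    (he : ∀ s, Function.Involutive (e s)) (hd : Function.Involutive d)
    (t : Bool → V → ℕ) (orb : ∀ s a b, t s a = t s b ↔ Orb (e s) d a b)
    (ρ : Bool → ℕ → ℤ) (hρ : ∀ s a b, ρ s (t s a) = ρ s (t s b) → t s a = t s b) (md : Bool → ℕ → Bool)
    (r : Bool → ℕ → V) (rv : Bool → ℕ → Bool)
    (hde : ∀ s a, d a ≠ a → d a ≠ e s a)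
    (hr : ∀ s a, Cyc e d t s a ∨ (t s (r s (t s a)) = t s a ∧ d (r s (t s a)) = r s (t s a)))
    (hex : ∀ s a, Cyc e d t s a → ∃ u, t s u = t s a ∧ t (!s) u < t s u ∧
      ((md s (t s u) = true ∧
        ∀ w, t s w = t s u → t (!s) w = t (!s) u ∨ ρ (!s) (t (!s) u) < ρ (!s) (t (!s) w)) ∨
       (md s (t s u) = false ∧
        ∀ w, t s w = t s u → t (!s) w = t (!s) u ∨ ρ (!s) (t (!s) w) < ρ (!s) (t (!s) u)))) :
    ∃ Z : Bool → V → ℤ, (∀ s a, 0 ≤ Z s a ∧ Z s a < Fintype.card V) ∧ Cert e d Set.univ Z ∧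
      (∀ s a b, ρ s (t s a) < ρ s (t s b) → Z s a < Z s b) ∧
      (∀ s a, ¬ Cyc e d t s a → ∀ w, t s w = t s a →
        (rv s (t s a) = false → Z s (r s (t s a)) ≤ Z s w ∧
          ∀ x, t s x = t s a → x ≠ r s (t s a) → (e s x = x ∨ d x = x) → Z s w ≤ Z s x) ∧
        (rv s (t s a) = true → Z s w ≤ Z s (r s (t s a)) ∧
          ∀ x, t s x = t s a → x ≠ r s (t s a) → (e s x = x ∨ d x = x) → Z s x ≤ Z s w)) ∧
      (∀ s a w, d a ≠ a → Z s a < Z s w → Z s w < Z s (d a) →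
        Cyc e d t s a ∧ t s w = t s a ∧
        (md s (t s a) = true → Z (!s) a ≤ Z (!s) w ∧ Z (!s) (d a) ≤ Z (!s) w) ∧
        (md s (t s a) = false → Z (!s) w ≤ Z (!s) a ∧ Z (!s) w ≤ Z (!s) (d a))) := by
  have te : ∀ s a, t s (e s a) = t s a := fun s a => ((orb s _ _).2 (Orb.f_right a)).symm
  have td : ∀ s a, t s (d a) = t s a := fun s a => ((orb s _ _).2 (Orb.g_right a)).symm
  have scls : ∀ s (q : V) (S : Set V), q ∈ S → (∀ a ∈ S, e s a ∈ S ∧ d a ∈ S) →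
      (∀ a ∈ S, Orb (e s) d q a) → S = Cls (t s) q := by
    intro s q S h1 h2 h3
    ext x
    constructor
    · intro hx; exact ((orb s _ _).2 (h3 x hx)).symm
    · intro hx
      exact ((orb s _ _).1 (Eq.symm hx)) S h1 h2
  have hseq : ∀ s n, ∃ idx : V → ℤ, ∀ a, t s a = n → ¬ Cyc e d t s a →
      Lin (e s) d (Cls (t s) a) idx (fun _ => False) ∧
      (∀ w, t s w = n → idx (r s n) ≤ idx w ∧
      ∀ x, t s x = n → x ≠ r s n → (e s x = x ∨ d x = x) → idx w ≤ idx x) := by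
    intro s n
    by_cases hn : ∃ a, t s a = n ∧ ¬ Cyc e d t s a
    · obtain ⟨a0, h1, h2⟩ := hn
      obtain ⟨q1, q2⟩ := (hr s a0).resolve_left h2
      rw [h1] at q1 q2
      obtain ⟨S, idx, i1, i2, i3, i4, i5, i6, i7, -⟩ :=
        exists_seq (e s) d (he s) hd (r s n) (Or.inl q2)
      have hS := scls s _ S i1 i2 i3
      refine ⟨idx, ?_⟩
      intro a ha hc
      have hSa : S = Cls (t s) a := by
        rw [hS]; ext x; show t s x = _ ↔ t s x = _; rw [ha, q1]
      rw [← hSa]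
      have hS' : ∀ x, t s x = n → x ∈ S := by
        intro x hx; rw [hSa]; show t s x = t s a; rw [hx, ha]
      refine ⟨⟨i4.inj, i4.e_eq, i4.lev_inj, fun a ha _ => i4.d_eq a ha (fun h => h.1 q2)⟩, ?_⟩
      intro w hw
      refine ⟨by rw [i5]; exact i6 w (hS' w hw), ?_⟩
      intro x hx h3 h4
      exact i7 x (hS' x hx) h3 h4 w (hS' w hw)
    · exact ⟨fun _ => 0, fun a h1 h2 => absurd ⟨a, h1, h2⟩ hn⟩
  choose idx hidx using hseq
  have hclos : ∀ s a, ∀ x ∈ Cls (t s) a, e s x ∈ Cls (t s) a ∧ d x ∈ Cls (t s) a := by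
    intro s a x hx
    have hx' : t s x = t s a := hx
    exact ⟨(te s x).trans hx', (td s x).trans hx'⟩
  obtain ⟨Z, z1, z2, z3, z4, z5⟩ := exists_cert e d hd t (fun s a => ρ s (t s a))
    (Cyc e d t) (fun s a => if rv s (t s a) then 1 - idx s (t s a) a else idx s (t s a) a)
    (fun s a => md s (t s a)) hde te td
    (fun s a b h hc w hw => hc w (hw.trans h.symm))
    (fun s a b => ⟨fun h => congrArg (ρ s) h, fun h => hρ s _ _ h⟩)
    (fun s a b h => congrArg (md s) h)
    (by
      intro s a hc
      have L := (hidx s _ a rfl hc).1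
      by_cases hv : rv s (t s a) = true
      · refine L.rev.congr (hclos s a) ?_
        intro x hx
        have hx' : t s x = t s a := hx
        simp only [hx', hv, if_true]
      · refine L.congr (hclos s a) ?_
        intro x hx
        have hx' : t s x = t s a := hx
        simp only [hx', hv]
        rfl)
    (fun s a hc => (hc a rfl).2)
    (by
      intro s u hc
      obtain ⟨S, idx, i1, i2, i3, i4, -⟩ :=
        exists_seq (e s) d (he s) hd u (Or.inr (fun a ha => hc a ((orb s _ _).2 ha).symm))
      rw [scls s _ S i1 i2 i3] at i4
      exact ⟨idx, ⟨i4.inj, i4.e_eq, i4.lev_inj, fun a ha h => i4.d_eq a ha (fun h' => h h'.2)⟩⟩)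
    hex
  refine ⟨Z, z1, z2, z3, ?_, z5⟩
  intro s a hc
  have H := (hidx s _ a rfl hc).2
  have hra := (hr s a).resolve_left hc
  have hle : ∀ x y, t s x = t s a → t s y = t s a →
      ((rv s (t s a) = false → idx s (t s a) x ≤ idx s (t s a) y) ∧
       (rv s (t s a) = true → idx s (t s a) y ≤ idx s (t s a) x)) → Z s x ≤ Z s y := by
    intro x y hx hy h
    by_contra hlt
    have hcy : ¬ Cyc e d t s y := fun h' => hc (fun w hw => h' w (hw.trans hy.symm))
    have := (z4 s y x (by rw [hx, hy]) hcy).1 (by omega)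
    rw [hx, hy] at this
    by_cases hv : rv s (t s a) = true
    · simp only [hv, if_true] at this
      have := h.2 hv
      omega
    · have hv' : rv s (t s a) = false := by simpa using hv
      simp only [hv'] at this
      have := h.1 hv'
      have h3 : idx s (t s a) y / 2 < idx s (t s a) x / 2 := by assumption
      omega
  intro w hw
  refine ⟨fun hv => ⟨hle _ _ hra.1 hw ⟨fun _ => (H w hw).1, fun h => by simp [hv] at h⟩, ?_⟩,
    fun hv => ⟨hle _ _ hw hra.1 ⟨fun h => by simp [hv] at h, fun _ => (H w hw).1⟩, ?_⟩⟩
  · intro x h1 h2 h3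
    exact hle _ _ hw h1 ⟨fun _ => (H w hw).2 x h1 h2 h3, fun h => by simp [hv] at h⟩
  · intro x h1 h2 h3
    exact hle _ _ h1 hw ⟨fun h => by simp [hv] at h, fun _ => (H w hw).2 x h1 h2 h3⟩

/-- case with at least one bend -/
theorem case_one {V : Type*} [Fintype V] {e : Bool → V → V} {d b : V → V} (D : Dat e d b)
    (hc : Conn e d) (hb : ∃ a, b a ≠ a) :
    ∃ Z : Bool → V → ℤ, (∀ s a, 0 ≤ Z s a ∧ Z s a < Fintype.card V) ∧ Good e d b (pt Z) := by
  obtain ⟨a0, ha0⟩ := hb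
  -- a `d`-lacking vertex
  obtain ⟨r0, hr0⟩ : ∃ r0, d r0 = r0 := by
    rcases D.bent a0 ha0 with h | h
    · exact ⟨b a0, h.2.2.1⟩
    · exact ⟨a0, h.1⟩
  obtain ⟨t, L⟩ := exists_lab e d D.he D.hd hc r0
  have te : ∀ s a, t s (e s a) = t s a := fun s a => ((L.orb s _ _).2 (Orb.f_right a)).symm
  have td : ∀ s a, t s (d a) = t s a := fun s a => ((L.orb s _ _).2 (Orb.g_right a)).symm
  have tb : ∀ a, t false (b a) = t false a := fun a => ((L.orb false _ _).2 (D.brel a)).symm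
  -- noncyclic classes have a `d`-lacking vertex
  have hfx : ∀ s a, ¬ Cyc e d t s a → ∃ q, t s q = t s a ∧ d q = q := by
    intro s a hcy
    unfold Cyc at hcy
    push Not at hcy
    obtain ⟨w, h1, h2⟩ := hcy
    by_cases h3 : e s w = w
    · cases s
      · have hbw : b w ≠ w := fun h => (D.deg w h).1 h3
        rcases D.bent w hbw with h | h
        · exact ⟨b w, (tb w).trans h1, h.2.2.1⟩
        · exact absurd h3 h.2.1
      · exact absurd h3 (D.hfix w)
    · exact ⟨w, h1, h2 h3⟩
  have hq : ∀ s n, ∃ q, ∀ a, t s a = n → ¬ Cyc e d t s a → t s q = n ∧ d q = q := by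
    intro s n
    by_cases hn : ∃ a, t s a = n ∧ ¬ Cyc e d t s a
    · obtain ⟨a1, h1, h2⟩ := hn
      obtain ⟨q, h3, h4⟩ := hfx s a1 h2
      exact ⟨q, fun a _ _ => ⟨h3.trans h1, h4⟩⟩
    · exact ⟨r0, fun a h1 h2 => absurd ⟨a, h1, h2⟩ hn⟩
  choose r hr using hq
  obtain ⟨Z, z1, z2, z3, z4, z5⟩ := cert_of_lab e d D.he D.hd t L.orb (fun _ n => (n : ℤ))
    (fun _ a b h => by exact_mod_cast h) (fun _ _ => true) r
    (fun s n => decide (n < t false (e true (r s n)))) (fun s a h => D.ne2 a h s)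
    (by
      intro s a
      by_cases h : Cyc e d t s a
      · exact Or.inl h
      · exact Or.inr (hr s _ a rfl h))
    (by
      intro s a hcy
      obtain ⟨u, h1, h2, h3⟩ := L.nb s a (by
        rintro ⟨rfl, h⟩
        exact (hcy r0 h.symm).2 hr0)
      refine ⟨u, h1, h2, Or.inl ⟨rfl, ?_⟩⟩
      intro w hw
      rcases (h3 w hw).eq_or_lt with h | h
      · exact Or.inl h.symm
      · exact Or.inr (by exact_mod_cast h))
  refine ⟨Z, z1, ?_⟩
  have hbent : ∀ u, e false u = u → b u ≠ u → d (b u) = b u ∧ e false (b u) ≠ b u := by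
    intro u h1 h2
    rcases D.bent u h2 with h | h
    · exact ⟨h.2.2.1, h.2.2.2⟩
    · exact absurd h1 h.2.1
  -- uniqueness : any `d`-lacking vertex of the class of `u` is `b u`
  have huniq : ∀ u, e false u = u → b u ≠ u → r false (t false u) = b u := by
    intro u h1 h2
    have hnc : ¬ Cyc e d t false u := fun h => (h u rfl).1 h1
    have hnc' : ∀ w, t false w = t false u → ¬ Cyc e d t false w :=
      fun w hw h => hnc (fun x hx => h x (hx.trans hw.symm))
    obtain ⟨h3, h4⟩ := hr false _ u rfl hnc
    by_contra hne
    have hub : d u ≠ u := by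
      rcases D.bent u h2 with h | h
      · exact h.2.1
      · exact absurd h1 h.2.1
    have h5 : b u ≠ r false (t false u) := fun h => hne h.symm
    have hur : u ≠ r false (t false u) := by
      intro h; apply hub; rw [h]; exact h4
    have k := z4 false u hnc
    have hbu := (hbent u h1 h2).1
    have heq : Z false u = Z false (b u) := by
      by_cases hv : decide (t false u < t false (e true (r false (t false u)))) = true
      · have k1 := ((k u rfl).2 hv).2 (b u) (tb u) h5 (Or.inr hbu)
        have k2 := ((k (b u) (tb u)).2 hv).2 u rfl hur (Or.inl h1)
        omega
      · have hv' : decide (t false u < t false (e true (r false (t false u)))) = false := by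
          simpa using hv
        have k1 := ((k u rfl).1 hv').2 (b u) (tb u) h5 (Or.inr hbu)
        have k2 := ((k (b u) (tb u)).1 hv').2 u rfl hur (Or.inl h1)
        omega
    rcases z2.ci false u trivial (b u) trivial heq with h | h
    · exact h2 h
    · exact h2 (h.trans h1)
  refine good_of_cert D z2 ?_ ?_ ?_
  · intro u h1 h2 a ha ⟨h3, h4⟩
    obtain ⟨k1, k2, -⟩ := z5 false a u ha h3 h4
    exact (k1 u k2).1 h1
  · intro u h1 h2 a ha ⟨h3, h4⟩
    obtain ⟨k1, k2, -⟩ := z5 true a (b u) ha h3 h4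
    exact (k1 _ k2).2 (hbent u h1 h2).1
  · intro u h1 h2
    have hnc : ¬ Cyc e d t false u := fun h => (h u rfl).1 h1
    have hur := huniq u h1 h2
    have hne : Z false u ≠ Z false (b u) := by
      intro heq
      rcases z2.ci false u trivial (b u) trivial heq with h | h
      · exact h2 h
      · exact h2 (h.trans h1)
    have hout : t false (e true (b u)) ≠ t false u := by
      intro h
      exact D.hout (b u) (hbent u h1 h2).1 ((L.orb false _ _).1 ((tb u).trans h.symm))
    have k := z4 false u hnc u rfl
    simp only [hur] at k
    by_cases hv : t false u < t false (e true (b u))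
    · left
      have k1 := (k.2 (by simpa using hv)).1
      have k2 := z3 false (b u) (e true (b u)) (by rw [tb]; exact_mod_cast hv)
      omega
    · right
      have k1 := (k.1 (by simpa using hv)).1
      have k2 := z3 false (e true (b u)) (b u) (by rw [tb]; exact_mod_cast (by omega))
      omega

/-- cutting out a vertex -/
def cut {V : Type*} (r : V) (f : V → V) (a : V) : V :=
  if a = r then r else if f a = r then a else f a

theorem cut_r {V : Type*} (r : V) (f : V → V) : cut r f r = r := by simp [cut]

theorem cut_of {V : Type*} {r : V} {f : V → V} {a : V} (h1 : a ≠ r) (h2 : f a ≠ r) :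
    cut r f a = f a := by simp [cut, h1, h2]

theorem cut_to {V : Type*} {r : V} {f : V → V} {a : V} (h2 : f a = r) :
    cut r f a = a := by
  unfold cut; split_ifs with h
  · exact h.symm
  · rfl

theorem cut_ne {V : Type*} {r : V} {f : V → V} {a : V} (h1 : a ≠ r) : cut r f a ≠ r := by
  unfold cut; rw [if_neg h1]; split_ifs with h
  · exact h1
  · exact h

theorem cut_inv {V : Type*} {r : V} {f : V → V} (hf : Function.Involutive f) :
    Function.Involutive (cut r f) := by
  intro a
  by_cases h1 : a = r
  · rw [h1, cut_r, cut_r]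
  · by_cases h2 : f a = r
    · rw [cut_to h2, cut_to h2]
    · rw [cut_of h1 h2, cut_of h2 (by rw [hf a]; exact h1), hf a]

theorem cut_fix {V : Type*} {r : V} {f : V → V} {a : V} (hf : ∀ a, f a ≠ a) (h1 : a ≠ r)
    (h : cut r f a = a) : f a = r := by
  by_contra h2
  rw [cut_of h1 h2] at h
  exact hf a h

theorem cut_orb_r {V : Type*} {r : V} {f g : V → V} {b : V} (h : Orb (cut r f) (cut r g) r b) :
    b = r := by
  refine h {r} rfl ?_
  rintro x rfl
  exact ⟨cut_r _ _, cut_r _ _⟩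

theorem cut_orb_ne {V : Type*} {r : V} {f g : V → V} {a b : V} (ha : a ≠ r)
    (h : Orb (cut r f) (cut r g) a b) : b ≠ r :=
  h {x | x ≠ r} ha (fun _ hx => ⟨cut_ne hx, cut_ne hx⟩)

theorem cut_orb_le {V : Type*} {r : V} {f g : V → V} {a b : V} (ha : a ≠ r)
    (h : Orb (cut r f) (cut r g) a b) : Orb f g a b := by
  refine (h {x | x ≠ r ∧ Orb f g a x} ⟨ha, Orb.rfl' a⟩ ?_).2
  rintro x ⟨h1, h2⟩
  constructor
  · refine ⟨cut_ne h1, ?_⟩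
    by_cases h3 : f x = r
    · rw [cut_to h3]; exact h2
    · rw [cut_of h1 h3]; exact h2.trans' (Orb.f_right x)
  · refine ⟨cut_ne h1, ?_⟩
    by_cases h3 : g x = r
    · rw [cut_to h3]; exact h2
    · rw [cut_of h1 h3]; exact h2.trans' (Orb.g_right x)

theorem cut_orb_z {V : Type*} [Finite V] {r : V} {f g : V → V} (hf : Function.Involutive f)
    (hg : Function.Involutive g) (ff : ∀ a, f a ≠ a) (gg : ∀ a, g a ≠ a) {a : V} (ha : a ≠ r)
    (h : Orb f g r a) : Orb (cut r f) (cut r g) (g r) a := by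
  obtain ⟨S, idx, i1, i2, i3, -, -, -, -, i8⟩ :=
    exists_seq (cut r f) (cut r g) (cut_inv hf) (cut_inv hg) (g r) (Or.inl (cut_to (hg r)))
  have hS : ∀ x ∈ S, x ≠ r := fun x hx => cut_orb_ne (gg r) (i3 x hx)
  obtain ⟨x, hx, h1⟩ := i8 (cut_to (hg r))
  have hx1 : f r ∈ S := by
    rcases h1 with h1 | ⟨h1, h2⟩
    · rw [← cut_fix ff (hS x hx) h1, hf x]; exact hx
    · exact absurd (by rw [← cut_fix gg (hS x hx) h1, hg x]) h2
  have := h (S ∪ {r}) (Or.inr rfl) ?_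
  · rcases this with h2 | h2
    · exact i3 a h2
    · exact absurd h2 ha
  · rintro y (hy | hy)
    · constructor
      · by_cases h3 : f y = r
        · exact Or.inr h3
        · rw [← cut_of (hS y hy) h3]; exact Or.inl (i2 y hy).1
      · by_cases h3 : g y = r
        · exact Or.inr h3
        · rw [← cut_of (hS y hy) h3]; exact Or.inl (i2 y hy).2
    · rw [hy]; exact ⟨Or.inl hx1, Or.inl i1⟩

theorem cut_orb {V : Type*} [Finite V] {r : V} {f g : V → V} (hf : Function.Involutive f)
    (hg : Function.Involutive g) (ff : ∀ a, f a ≠ a) (gg : ∀ a, g a ≠ a) {a b : V} (ha : a ≠ r)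
    (hb : b ≠ r) : Orb (cut r f) (cut r g) a b ↔ Orb f g a b := by
  refine ⟨cut_orb_le ha, fun h => ?_⟩
  by_cases hra : Orb f g r a
  · exact ((cut_orb_z hf hg ff gg ha hra).symm' (cut_inv hf) (cut_inv hg)).trans'
      (cut_orb_z hf hg ff gg hb (hra.trans' h))
  · intro T hT hc
    refine (h {x | x ∈ T ∧ Orb f g a x} ⟨hT, Orb.rfl' a⟩ ?_).1
    rintro x ⟨h1, h2⟩
    have hne : ∀ y, Orb f g a y → y ≠ r := by
      rintro y hy rfl
      exact hra (hy.symm' hf hg)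
    have k1 := h2.trans' (Orb.f_right (f := f) (g := g) x)
    have k2 := h2.trans' (Orb.g_right (f := f) (g := g) x)
    refine ⟨⟨?_, k1⟩, ⟨?_, k2⟩⟩
    · rw [← cut_of (hne x h2) (hne _ k1)]; exact (hc x h1).1
    · rw [← cut_of (hne x h2) (hne _ k2)]; exact (hc x h1).2

/-- all degree three, no bends -/
structure Dat0 {V : Type*} (e : Bool → V → V) (d : V → V) : Prop where
  he : ∀ s, Function.Involutive (e s)
  hd : Function.Involutive d
  fe : ∀ s a, e s a ≠ a
  fd : ∀ a, d a ≠ a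
  ne1 : ∀ a, e false a ≠ e true a
  ne2 : ∀ s a, d a ≠ e s a

theorem Dat0.swap {V : Type*} {e : Bool → V → V} {d : V → V} (D : Dat0 e d) :
    Dat0 (fun s => e (!s)) d :=
  ⟨fun _ => D.he _, D.hd, fun _ => D.fe _, D.fd, fun a => (D.ne1 a).symm, fun _ => D.ne2 _⟩

theorem SG.swap {V : Type*} {e : Bool → V → V} {d : V → V} {A : Set V} {p : V → Pt}
    (H : SG (SE (fun s => e (!s)) d A) A p) : SG (SE e d A) A p := by
  have : SE (fun s => e (!s)) d A = SE e d A := by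
    funext a b
    apply propext
    unfold SE
    have : (∃ s, b = e (!s) a) ↔ ∃ s, b = e s a :=
      ⟨fun ⟨s, h⟩ => ⟨!s, h⟩, fun ⟨s, h⟩ => ⟨!s, by rw [Bool.not_not]; exact h⟩⟩
    rw [this]
  rwa [this] at H

/-- order isomorphism invariance of certificates -/
theorem Cert.congr {V : Type*} {e : Bool → V → V} {d : V → V} {A : Set V} {Z Z' : Bool → V → ℤ}
    (C : Cert e d A Z) (hA : ∀ a ∈ A, d a ∈ A ∧ ∀ s, e s a ∈ A)
    (h : ∀ s, ∀ a ∈ A, ∀ b ∈ A, Z' s a < Z' s b ↔ Z s a < Z s b) : Cert e d A Z' := by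
  have hle : ∀ s, ∀ a ∈ A, ∀ b ∈ A, Z' s a ≤ Z' s b ↔ Z s a ≤ Z s b := by
    intro s a ha b hb
    rw [← not_lt, ← not_lt, h s b hb a ha]
  have heq : ∀ s, ∀ a ∈ A, ∀ b ∈ A, Z' s a = Z' s b ↔ Z s a = Z s b := by
    intro s a ha b hb
    rw [le_antisymm_iff, le_antisymm_iff, hle s a ha b hb, hle s b hb a ha]
  have hsep : ∀ a ∈ A, ∀ b ∈ A, ∀ c ∈ A, ∀ f ∈ A, SepZ Z a b c f → SepZ Z' a b c f := by
    rintro a ha b hb c hc f hf ⟨s, H⟩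
    refine ⟨s, ?_⟩
    rw [hle s a ha c hc, hle s a ha f hf, hle s b hb c hc, hle s b hb f hf,
      hle s c hc a ha, hle s f hf a ha, hle s c hc b hb, hle s f hf b hb]
    exact H
  exact ⟨fun s a ha => (heq s _ ((hA a ha).2 s) a ha).2 (C.ce s a ha),
    fun s a ha c hc hh => C.ci s a ha c hc ((heq s a ha c hc).1 hh),
    fun s a ha hda hh => C.dn s a ha hda ((heq s a ha _ (hA a ha).1).1 hh),
    fun s a ha w hw hda => hsep _ ha _ (hA a ha).1 _ hw _ ((hA w hw).2 s) (C.de s a ha w hw hda),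
    fun a ha w hw hda h1 h2 => hsep _ ha _ (hA a ha).1 _ hw _ (hA w hw).1
      (C.dd a ha w hw hda h1 h2)⟩

theorem Cert.mono {V : Type*} {e : Bool → V → V} {d : V → V} {A B : Set V} {Z : Bool → V → ℤ}
    (C : Cert e d B Z) (h : A ⊆ B) : Cert e d A Z :=
  ⟨fun s a ha => C.ce s a (h ha), fun s a ha c hc => C.ci s a (h ha) c (h hc),
    fun s a ha => C.dn s a (h ha), fun s a ha w hw => C.de s a (h ha) w (h hw),
    fun a ha w hw => C.dd a (h ha) w (h hw)⟩

/-- edge from `r` to `n` is fine with respect to the rest -/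
structure REdge {V : Type*} (R : V → V → Prop) (p : V → Pt) (r n : V) : Prop where
  off : ∀ w, w ≠ r → w ≠ n → p w ∉ segment ℝ (p r) (p n)
  cr : ∀ a b, R a b → a ≠ r → b ≠ r → Cr p (p r, p n) (p a, p b) r n a b

theorem REdge.hull {V : Type*} {R : V → V → Prop} {p : V → Pt} {r n : V} (ℓ : Pt →ₗ[ℝ] ℝ)
    (h1 : ℓ (p n) = ℓ (p r)) (h2 : ∀ w, w ≠ r → w ≠ n → ℓ (p r) < ℓ (p w))
    (hR : ∀ a, ¬ R a a) : REdge R p r n := by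
  have hc : ∀ x ∈ segment ℝ (p r) (p n), ℓ x = ℓ (p r) := fun x hx =>
    le_antisymm (seg_ge hx le_rfl h1.le) (seg_le hx le_rfl h1.ge)
  have hle : ∀ w, w ≠ r → ℓ (p r) ≤ ℓ (p w) := by
    intro w hw
    by_cases h : w = n
    · rw [h, h1]
    · exact (h2 w hw h).le
  refine ⟨fun w hw hn hx => (h2 w hw hn).ne' (hc _ hx), ?_⟩
  intro a b hab ha hb x hx hx'
  have hx1 := hc x hx
  left
  by_cases han : a = n
  · have hbn : b ≠ n := by rintro rfl; exact hR _ (han ▸ hab)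
    refine ⟨n, Or.inr rfl, Or.inl han.symm, ?_⟩
    rw [← han]
    refine seg_end hx' ?_ (by rw [hx1, han, h1])
    dsimp only
    rw [han, h1]; exact (h2 b hb hbn).ne
  · by_cases hbn : b = n
    · refine ⟨n, Or.inr rfl, Or.inr hbn.symm, ?_⟩
      rw [← hbn]
      refine seg_end (seg_symm hx') ?_ (by rw [hx1, hbn, h1])
      dsimp only
      rw [hbn, h1]; exact (h2 a ha han).ne
    · exfalso
      have := seg_le hx' (m := min (ℓ (p a)) (ℓ (p b))) (min_le_left _ _) (min_le_right _ _)
      rw [hx1] at this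
      have h3 := h2 a ha han
      have h4 := h2 b hb hbn
      exact absurd this (not_le.2 (lt_min h3 h4))

theorem REdge.graze {V : Type*} {R : V → V → Prop} {p : V → Pt} {r z : V} (hzr : z ≠ r)
    (H : SG R {x | x ≠ r} p) (ℓ : Pt →ₗ[ℝ] ℝ) (h1 : ℓ (p r) < ℓ (p z))
    (h2 : ∀ w, w ≠ r → ℓ (p z) ≤ ℓ (p w)) : REdge R p r z := by
  have hc : ∀ x ∈ segment ℝ (p r) (p z), ℓ (p z) ≤ ℓ x → x = p z := by
    intro x hx h
    refine seg_end (seg_symm hx) h1.ne' (le_antisymm (seg_ge hx h1.le le_rfl) h)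
  refine ⟨fun w hw hn hx => hn (H.inj w hw z hzr (hc _ hx (h2 w hw))), ?_⟩
  intro a b hab ha hb x hx hx'
  have hx1 := hc x hx (seg_le hx' (h2 a ha) (h2 b hb))
  left
  refine ⟨z, Or.inr rfl, ?_, hx1⟩
  by_contra hne
  push Not at hne
  refine H.off a b hab z hzr hne.1 hne.2 ?_
  rw [← hx1]; exact hx'

theorem SG.extend {V : Type*} {e : Bool → V → V} {d : V → V} {r : V} {p : V → Pt}
    (D : Dat0 e d)
    (H : SG (SE (fun s => cut r (e s)) (cut r d) {x | x ≠ r}) {x | x ≠ r} p)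
    (ℓ : Pt →ₗ[ℝ] ℝ) (hℓ : ∀ w, w ≠ r → ℓ (p r) < ℓ (p w))
    (hE : ∀ n, SE e d Set.univ r n →
      REdge (SE (fun s => cut r (e s)) (cut r d) {x | x ≠ r}) p r n)
    (hrr : ∀ n n', SE e d Set.univ r n → SE e d Set.univ r n' → n ≠ n' →
      ∀ x, x ∈ segment ℝ (p r) (p n) → x ∈ segment ℝ (p r) (p n') → x = p r) :
    SG (SE e d Set.univ) Set.univ p := by
  have hsub : ∀ a b, SE e d Set.univ a b → a ≠ r → b ≠ r →
      SE (fun s => cut r (e s)) (cut r d) {x | x ≠ r} a b := by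
    rintro a b ⟨-, h1, h2⟩ ha hb
    refine ⟨ha, h1, ?_⟩
    rcases h2 with ⟨s, h2⟩ | h2
    · left; exact ⟨s, by dsimp only; rw [cut_of ha (h2 ▸ hb)]; exact h2⟩
    · right; rw [cut_of ha (h2 ▸ hb)]; exact h2
  have hsym : ∀ a b, SE e d Set.univ a b → SE e d Set.univ b a := by
    rintro a b ⟨-, h1, h2⟩
    refine ⟨trivial, h1.symm, ?_⟩
    rcases h2 with ⟨s, h2⟩ | h2
    · left; exact ⟨s, by rw [h2, D.he]⟩
    · right; rw [h2, D.hd]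
  have offr : ∀ a b, a ≠ r → b ≠ r → p r ∉ segment ℝ (p a) (p b) := by
    intro a b ha hb hx
    have := seg_le hx (m := min (ℓ (p a)) (ℓ (p b))) (min_le_left _ _) (min_le_right _ _)
    exact absurd this (not_le.2 (lt_min (hℓ a ha) (hℓ b hb)))
  have hcr0 : ∀ n a b, SE e d Set.univ r n → SE e d Set.univ a b → s(r, n) ≠ s(a, b) →
      Cr p (p r, p n) (p a, p b) r n a b := by
    intro n a b hn hab hne
    by_cases ha : a = r
    · subst ha
      intro x h1 h2
      exact Or.inl ⟨a, Or.inl rfl, Or.inl rfl,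
        hrr n b hn hab (fun h => hne (by rw [h])) x h1 h2⟩
    · by_cases hb : b = r
      · subst hb
        intro x h1 h2
        exact Or.inl ⟨b, Or.inl rfl, Or.inr rfl,
          hrr n a hn (hsym _ _ hab) (fun h => hne (by rw [h, Sym2.eq_swap])) x h1 (seg_symm h2)⟩
      · exact (hE n hn).cr a b (hsub a b hab ha hb) ha hb
  refine ⟨?_, ?_, ?_⟩
  · intro a _ b _ h
    by_cases ha : a = r <;> by_cases hb : b = r
    · rw [ha, hb]
    · exact absurd (by rw [← h, ha]) (hℓ b hb).ne
    · exact absurd (by rw [h, hb]) (hℓ a ha).ne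
    · exact H.inj a ha b hb h
  · intro a b hab w _ hwa hwb
    by_cases ha : a = r
    · subst ha; exact (hE b hab).off w hwa hwb
    · by_cases hb : b = r
      · subst hb
        rw [segment_symm]; exact (hE a (hsym _ _ hab)).off w hwb hwa
      · by_cases hw : w = r
        · rw [hw]; exact offr a b ha hb
        · exact H.off a b (hsub a b hab ha hb) w hw hwa hwb
  · intro a b a' b' hab hab' hne
    by_cases ha : a = r
    · subst ha; exact hcr0 b a' b' hab hab' hne
    · by_cases hb : b = r
      · subst hb
        exact (hcr0 a a' b' (hsym _ _ hab) hab' (by rwa [Sym2.eq_swap])).rev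
      · by_cases ha' : a' = r
        · subst ha'; exact (hcr0 b' a b hab' hab hne.symm).symm
        · by_cases hb' : b' = r
          · subst hb'
            exact (hcr0 a' a b (hsym _ _ hab') hab (by rw [Sym2.eq_swap]; exact hne.symm)).rev.symm
          · exact H.cr a b a' b' (hsub _ _ hab ha hb) (hsub _ _ hab' ha' hb') hne

theorem cut_cert {V : Type*} [Fintype V] {e : Bool → V → V} {d : V → V} (D : Dat0 e d) (r : V)
    (t : Bool → V → ℕ) (orb : ∀ s a b, t s a = t s b ↔ Orb (e s) d a b)
    (ρ : Bool → ℕ → ℤ) (hρ0 : ∀ s a, 0 ≤ ρ s (t s a))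
    (hρ : ∀ s a b, ρ s (t s a) = ρ s (t s b) → t s a = t s b) (md : Bool → ℕ → Bool)
    (rv : Bool → Bool)
    (hex : ∀ s a, t s a ≠ t s r → ∃ u, t s u = t s a ∧ t (!s) u < t s u ∧
      ((md s (t s u) = true ∧
        ∀ w, t s w = t s u → t (!s) w = t (!s) u ∨ ρ (!s) (t (!s) u) < ρ (!s) (t (!s) w)) ∨
       (md s (t s u) = false ∧
        ∀ w, t s w = t s u → t (!s) w = t (!s) u ∨ ρ (!s) (t (!s) w) < ρ (!s) (t (!s) u)))) :
    ∃ Z : Bool → V → ℤ, (∀ s a, 0 ≤ Z s a ∧ Z s a < Fintype.card V) ∧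
      Cert (fun s => cut r (e s)) (cut r d) {x | x ≠ r} Z ∧
      (∀ s a b, a ≠ r → b ≠ r → ρ s (t s a) < ρ s (t s b) → Z s a < Z s b) ∧
      (∀ s w, w ≠ r → t s w = t s r →
        (rv s = false → Z s (d r) ≤ Z s w ∧ Z s w ≤ Z s (e s r)) ∧
        (rv s = true → Z s w ≤ Z s (d r) ∧ Z s (e s r) ≤ Z s w)) ∧
      (∀ s a w, a ≠ r → d a ≠ r → w ≠ r → Z s a < Z s w → Z s w < Z s (d a) →
        t s a ≠ t s r ∧ t s w = t s a ∧
        (md s (t s a) = true → Z (!s) a ≤ Z (!s) w ∧ Z (!s) (d a) ≤ Z (!s) w) ∧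
        (md s (t s a) = false → Z (!s) w ≤ Z (!s) a ∧ Z (!s) w ≤ Z (!s) (d a))) := by
  have te : ∀ s a, t s (e s a) = t s a := fun s a => ((orb s _ _).2 (Orb.f_right a)).symm
  have td : ∀ s a, t s (d a) = t s a := fun s a => ((orb s _ _).2 (Orb.g_right a)).symm
  set e' : Bool → V → V := fun s => cut r (e s) with he'
  set d' : V → V := cut r d with hd'
  set t' : Bool → V → ℕ := fun s a => if a = r then 0 else t s a + 1 with ht'
  have tr : ∀ s, t' s r = 0 := fun s => by simp [ht']
  have tn : ∀ s a, a ≠ r → t' s a = t s a + 1 := fun s a h => by simp [ht', h]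
  have tz : ∀ s a, t' s a = 0 → a = r := by
    intro s a h
    by_contra hne
    rw [tn s a hne] at h; omega
  have tne : ∀ s a b, a ≠ r → t' s b = t' s a → b ≠ r ∧ t s b = t s a := by
    intro s a b ha h
    have hb : b ≠ r := by
      rintro rfl
      rw [tr, tn s a ha] at h; omega
    rw [tn s a ha, tn s b hb] at h
    exact ⟨hb, by omega⟩
  have hcyc : ∀ s a, a ≠ r → t s a ≠ t s r → Cyc e' d' t' s a := by
    intro s a ha hta w hw
    obtain ⟨hw1, hw2⟩ := tne s a w ha hw
    have k1 : e s w ≠ r := by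
      intro h; apply hta; rw [← hw2, ← te s w, h]
    have k2 : d w ≠ r := by
      intro h; apply hta; rw [← hw2, ← td s w, h]
    constructor
    · show cut r (e s) w ≠ w
      rw [cut_of hw1 k1]; exact D.fe s w
    · show cut r d w ≠ w
      rw [cut_of hw1 k2]; exact D.fd w
  have hdr : d r ≠ r := D.fd r
  have hnc : ∀ s a, t s a = t s r → ¬ Cyc e' d' t' s a := by
    intro s a hta hc
    by_cases ha : a = r
    · exact (hc r (by rw [ha])).2 (cut_r _ _)
    · exact (hc (d r) (by rw [tn s _ hdr, tn s a ha, td, hta])).2 (cut_to (D.hd r))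
  obtain ⟨Z, z1, z2, z3, z4, z5⟩ := cert_of_lab e' d' (fun s => cut_inv (D.he s)) (cut_inv D.hd) t'
    (by
      intro s a b
      by_cases ha : a = r
      · subst ha
        constructor
        · intro h
          rw [tr] at h
          rw [tz s b h.symm]; exact Orb.rfl' _
        · intro h
          rw [cut_orb_r h]
      · constructor
        · intro h
          obtain ⟨hb, hb'⟩ := tne s a b ha h.symm
          exact (cut_orb (D.he s) D.hd (D.fe s) D.fd ha hb).2 ((orb s a b).1 hb'.symm)
        · intro h
          have hb := cut_orb_ne ha h
          rw [tn s a ha, tn s b hb, (orb s a b).2 (cut_orb_le ha h)])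
    (fun s n => if n = 0 then -1 else ρ s (n - 1))
    (by
      intro s a b h
      by_cases ha : a = r <;> by_cases hb : b = r
      · rw [ha, hb]
      · rw [ha, tr, tn s b hb] at h
        simp only [if_true, Nat.add_sub_cancel] at h
        rw [if_neg (by omega)] at h
        have := hρ0 s b; omega
      · rw [hb, tr, tn s a ha] at h
        simp only [if_true, Nat.add_sub_cancel] at h
        rw [if_neg (by omega)] at h
        have := hρ0 s a; omega
      · rw [tn s a ha, tn s b hb] at h ⊢
        simp only [Nat.add_sub_cancel] at h
        rw [if_neg (by omega), if_neg (by omega)] at h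
        rw [hρ s a b h])
    (fun s n => md s (n - 1)) (fun s n => if n = 0 then r else d r) (fun s _ => rv s)
    (by
      intro s a h1 h2
      have ha : a ≠ r := by
        rintro rfl; exact h1 (cut_r _ _)
      have h3 : d a ≠ r := fun h => h1 (cut_to h)
      have h4 : cut r d a = d a := cut_of ha h3
      change cut r d a = cut r (e s) a at h2
      rw [h4] at h2
      by_cases h5 : e s a = r
      · rw [cut_to h5] at h2; exact D.fd a h2
      · rw [cut_of ha h5] at h2; exact D.ne2 s a h2)
    (by
      intro s a
      by_cases ha : a = r
      · right
        rw [ha, tr, if_pos rfl]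
        exact ⟨tr s, cut_r _ _⟩
      · by_cases hta : t s a = t s r
        · right
          rw [tn s a ha, if_neg (by omega), tn s _ hdr, td, hta]
          exact ⟨rfl, cut_to (D.hd r)⟩
        · exact Or.inl (hcyc s a ha hta))
    (by
      intro s a hc
      have hta : t s a ≠ t s r := fun h => hnc s a h hc
      have ha : a ≠ r := by rintro rfl; exact hta rfl
      obtain ⟨u, u1, u2, u3⟩ := hex s a hta
      have hu : u ≠ r := by rintro rfl; exact hta u1.symm
      refine ⟨u, by rw [tn s u hu, tn s a ha, u1], by rw [tn _ u hu, tn _ u hu]; omega, ?_⟩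
      have key : ∀ w, t' s w = t' s u → w ≠ r ∧ t s w = t s u := fun w hw => tne s u w hu hw
      rw [tn s u hu, Nat.add_sub_cancel]
      refine u3.imp (fun h => ⟨h.1, fun w hw => ?_⟩) (fun h => ⟨h.1, fun w hw => ?_⟩)
      · rw [← tn s u hu] at hw
        obtain ⟨w1, w2⟩ := key w hw
        rw [tn _ u hu, tn _ w w1, if_neg (by omega), if_neg (by omega), Nat.add_sub_cancel,
          Nat.add_sub_cancel]
        exact (h.2 w w2).imp (fun h => by rw [h]) id
      · rw [← tn s u hu] at hw
        obtain ⟨w1, w2⟩ := key w hw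
        rw [tn _ u hu, tn _ w w1, if_neg (by omega), if_neg (by omega), Nat.add_sub_cancel,
          Nat.add_sub_cancel]
        exact (h.2 w w2).imp (fun h => by rw [h]) id)
  refine ⟨Z, z1, z2.mono (Set.subset_univ _), ?_, ?_, ?_⟩
  · intro s a b ha hb h
    apply z3
    rw [tn s a ha, tn s b hb, if_neg (by omega), if_neg (by omega), Nat.add_sub_cancel,
      Nat.add_sub_cancel]
    exact h
  · intro s w hw htw
    have her : e s r ≠ r := D.fe s r
    have hk : t' s (e s r) = t' s w := by rw [tn s _ her, tn s w hw, te, htw]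
    have k := z4 s w (hnc s w htw) w rfl
    rw [tn s w hw, if_neg (by omega)] at k
    rw [← tn s w hw] at k
    have hx : e s r ≠ d r := (D.ne2 s r).symm
    have hx2 : e' s (e s r) = e s r := cut_to (D.he s r)
    exact ⟨fun h => ⟨(k.1 h).1, (k.1 h).2 _ hk hx (Or.inl hx2)⟩,
      fun h => ⟨(k.2 h).1, (k.2 h).2 _ hk hx (Or.inl hx2)⟩⟩
  · intro s a w ha hda hw h1 h2
    have hd1 : d' a = d a := cut_of ha hda
    have k := z5 s a w (by rw [hd1]; exact D.fd a) h1 (by rw [hd1]; exact h2)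
    obtain ⟨k1, k2, k3, k4⟩ := k
    rw [hd1, tn s a ha, Nat.add_sub_cancel] at k3 k4
    refine ⟨fun h => hnc s a h k1, (tne s a w ha k2).2, k3, k4⟩

theorem cut_closed {V : Type*} (e : Bool → V → V) (d : V → V) (r : V) :
    ∀ a ∈ {x | x ≠ r}, cut r d a ∈ {x | x ≠ r} ∧
      ∀ s, (fun s => cut r (e s)) s a ∈ {x | x ≠ r} :=
  fun _ ha => ⟨cut_ne ha, fun _ => cut_ne ha⟩

theorem cut_ne1 {V : Type*} {e : Bool → V → V} {d : V → V} (D : Dat0 e d) (r : V) :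
    ∀ a ∈ {x | x ≠ r}, (fun s => cut r (e s)) false a ≠ a →
      (fun s => cut r (e s)) false a ≠ (fun s => cut r (e s)) true a := by
  intro a ha h1 h2
  dsimp only at h1 h2
  have h3 : e false a ≠ r := fun h => h1 (cut_to h)
  rw [cut_of ha h3] at h1 h2
  by_cases h4 : e true a = r
  · rw [cut_to h4] at h2; exact h1 h2
  · rw [cut_of ha h4] at h2; exact D.ne1 a h2

theorem SE_irr {V : Type*} {e : Bool → V → V} {d : V → V} {A : Set V} (a : V) :
    ¬ SE e d A a a := fun h => h.2.1 rfl

theorem hull_rr {P Q R x : Pt} (ℓ : Pt →ₗ[ℝ] ℝ) (h1 : ℓ Q = ℓ P) (h2 : ℓ P ≠ ℓ R)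
    (hx : x ∈ segment ℝ P Q) (hx' : x ∈ segment ℝ P R) : x = P :=
  seg_end hx' h2 (le_antisymm (seg_ge hx le_rfl h1.le) (seg_le hx le_rfl h1.ge))

theorem case_E {V : Type*} [Fintype V] {e : Bool → V → V} {d : V → V} (D : Dat0 e d) (r : V)
    (hall : ∀ s a b, Orb (e s) d a b) :
    ∃ Z : Bool → V → ℤ, (∀ s a, -(4 * Fintype.card V : ℤ) ≤ Z s a ∧
      Z s a ≤ 4 * Fintype.card V) ∧ SG (SE e d Set.univ) Set.univ (pt Z) := by
  obtain ⟨Z, z1, z2, -, z4, -⟩ := cut_cert D r (fun s _ => if s then 1 else 0)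
    (fun s a b => ⟨fun _ => hall s a b, fun _ => rfl⟩) (fun _ n => (n : ℤ))
    (fun s a => Int.natCast_nonneg _) (fun s a b _ => rfl) (fun _ _ => true) (fun _ => false)
    (fun s a h => absurd rfl h)
  have zmin : ∀ s w, w ≠ r → Z s (d r) ≤ Z s w := fun s w hw => ((z4 s w hw rfl).1 rfl).1
  have zmax : ∀ s w, w ≠ r → w ≠ e s r → Z s w < Z s (e s r) := by
    intro s w hw hw'
    refine lt_of_le_of_ne ((z4 s w hw rfl).1 rfl).2 ?_
    intro h
    rcases z2.ci s (e s r) (D.fe s r) w hw h.symm with h | h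
    · exact hw' h
    · exact hw' (h.trans (cut_to (D.he s r)))
  have hn : (1 : ℤ) ≤ Fintype.card V := by
    have : 0 < Fintype.card V := Fintype.card_pos_iff.2 ⟨r⟩
    omega
  set n : ℤ := ((Fintype.card V : ℕ) : ℤ) with hndef
  set Z' : Bool → V → ℤ := fun s a => if a = r then -(n + 1) else if a = e s r then
    2 * Z (!s) (e s r) + (n + 1) else Z s a with hZ'
  have Zr : ∀ s, Z' s r = -(n + 1) := fun s => by simp [hZ']
  have Ze : ∀ s, Z' s (e s r) = 2 * Z (!s) (e s r) + (n + 1) := fun s => by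
    simp [hZ', D.fe]
  have Zo : ∀ s a, a ≠ r → a ≠ e s r → Z' s a = Z s a := fun s a h1 h2 => by
    simp [hZ', h1, h2]
  have hord : ∀ s, ∀ a ∈ {x | x ≠ r}, ∀ b ∈ {x | x ≠ r}, Z' s a < Z' s b ↔ Z s a < Z s b := by
    intro s a ha b hb
    by_cases h1 : a = e s r <;> by_cases h2 : b = e s r
    · rw [h1, h2]; simp
    · rw [h1, Ze, Zo s b hb h2]
      have := zmax s b hb h2
      have := z1 s b
      have := z1 (!s) (e s r)
      omega
    · rw [h2, Ze, Zo s a ha h1]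
      have := zmax s a ha h1
      have := z1 s a
      have := z1 (!s) (e s r)
      omega
    · rw [Zo s a ha h1, Zo s b hb h2]
  have C := z2.congr (cut_closed e d r) hord
  have S := C.sg (fun s => cut_inv (D.he s)) (cut_inv D.hd) (cut_ne1 D r) (cut_closed e d r)
  have hnn : ∀ s w, w ≠ r → 0 ≤ Z' s w := by
    intro s w hw
    by_cases h1 : w = e s r
    · rw [h1, Ze]; have := z1 (!s) (e s r); omega
    · rw [Zo s w hw h1]; exact (z1 s w).1
  let ℓ : Bool → Pt →ₗ[ℝ] ℝ := fun s => (2 : ℝ) • co (!s) - co s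
  have hℓ : ∀ s a, ℓ s (pt Z' a) = ((2 * Z' (!s) a - Z' s a : ℤ) : ℝ) := by
    intro s a
    simp [ℓ, co_pt]
  have esn : ∀ s, e s r ≠ e (!s) r := by
    intro s
    cases s
    · exact D.ne1 r
    · exact (D.ne1 r).symm
  have hl1 : ∀ s, ℓ s (pt Z' (e s r)) = ℓ s (pt Z' r) := by
    intro s
    rw [hℓ, hℓ, Zr, Zr, Ze, Zo (!s) (e s r) (D.fe s r) (esn s)]
    congr 1; ring
  have hl2 : ∀ s w, w ≠ r → w ≠ e s r → ℓ s (pt Z' r) < ℓ s (pt Z' w) := by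
    intro s w hw hw'
    rw [hℓ, hℓ, Zr, Zr]
    have h1 := hnn (!s) w hw
    have h2 := Zo s w hw hw'
    have h3 := z1 s w
    have : 2 * -(n + 1) - -(n + 1) < 2 * Z' (!s) w - Z' s w := by omega
    exact_mod_cast this
  have hdr : d r ≠ r := D.fd r
  have hnb : ∀ m, SE e d Set.univ r m → (∃ s, m = e s r) ∨ m = d r := fun m h => h.2.2
  refine ⟨Z', ?_, SG.extend D S (co true) ?_ ?_ ?_⟩
  · intro s a
    by_cases ha : a = r
    · rw [ha, Zr]; omega
    · by_cases h1 : a = e s r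
      · rw [h1, Ze]; have := z1 (!s) (e s r); omega
      · rw [Zo s a ha h1]; have := z1 s a; omega
  · intro w hw
    rw [co_pt, co_pt, Zr]
    have := hnn true w hw
    have : -(n + 1) < Z' true w := by omega
    exact_mod_cast this
  · intro m hm
    rcases hnb m hm with ⟨s, rfl⟩ | rfl
    · exact REdge.hull (ℓ s) (hl1 s) (hl2 s) SE_irr
    · refine REdge.graze hdr S (co true) ?_ ?_
      · rw [co_pt, co_pt, Zr]
        have := hnn true (d r) hdr
        have : -(n + 1) < Z' true (d r) := by omega
        exact_mod_cast this
      · intro w hw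
        rw [co_pt, co_pt]
        have h1 : ¬ Z' true w < Z' true (d r) := by
          rw [hord true w hw _ hdr]
          have := zmin true w hw
          omega
        exact_mod_cast (not_lt.1 h1)
  · intro m m' hm hm' hne x hx hx'
    rcases hnb m hm with ⟨s, rfl⟩ | rfl
    · exact hull_rr (ℓ s) (hl1 s) (hl2 s m' hm'.2.1.symm hne.symm).ne hx hx'
    · rcases hnb m' hm' with ⟨s, rfl⟩ | rfl
      · exact hull_rr (ℓ s) (hl1 s) (hl2 s _ hm.2.1.symm hne).ne hx' hx
      · exact absurd rfl hne

theorem case_BC {V : Type*} [Fintype V] {e : Bool → V → V} {d : V → V} (D : Dat0 e d) (q : V)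
    (t : Bool → V → ℕ) (L : Lab e d (e false q) t)
    (hW : t false (e true q) ≠ t false q)
    (hBC : t true q = t true (e false q) ∨ t false (e true q) < t true q) :
    ∃ Z : Bool → V → ℤ, (∀ s a, -(4 * Fintype.card V : ℤ) ≤ Z s a ∧
      Z s a ≤ 4 * Fintype.card V) ∧ SG (SE e d Set.univ) Set.univ (pt Z) := by
  have te : ∀ s a, t s (e s a) = t s a := fun s a => ((L.orb s _ _).2 (Orb.f_right a)).symm
  have td : ∀ s a, t s (d a) = t s a := fun s a => ((L.orb s _ _).2 (Orb.g_right a)).symm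
  set r := e false q with hr
  have hqr : e false r = q := D.he false q
  have q_ne : q ≠ r := fun h => D.fe false q h.symm
  set y := e true q with hy
  have tq0 : t false q = 0 := by rw [← L.t0, ← te false q]
  have ty0 : t false y ≠ 0 := by rw [← tq0]; exact hW
  have y_ne : y ≠ r := by
    intro h; apply ty0; rw [h]; exact L.t0
  have ty : t true y = t true q := te true q
  obtain ⟨B, hB⟩ : ∃ B : ℕ, ∀ a, t false a < B := by
    obtain ⟨B, hB⟩ := (Set.finite_range (t false)).bddAbove
    exact ⟨B + 1, fun a => Nat.lt_succ_of_le (hB ⟨a, rfl⟩)⟩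
  set ρ : Bool → ℕ → ℤ := fun s n => if s = false ∧ n = t false y then (B : ℤ) else n with hρ
  have ρt : ∀ n, ρ true n = n := fun n => by simp [hρ]
  have ρy : ρ false (t false y) = B := by simp [hρ]
  have ρf : ∀ n, n ≠ t false y → ρ false n = n := fun n h => by simp [hρ, h]
  set md : Bool → ℕ → Bool := fun s n => decide (s = false ∨ ¬ (n = t true q ∨
    ∃ u, t true u = n ∧ t false u = t false y ∧ ∀ w, t true w = n → t false y ≤ t false w))
    with hmd
  have mdq : md true (t true q) = false := by simp [hmd]
  obtain ⟨Z, z1, z2, z3, z4, z5⟩ := cut_cert D r t L.orb ρ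
    (by
      intro s a
      simp only [hρ]
      split_ifs <;> positivity)
    (by
      intro s a b h
      cases s
      · by_cases ha : t false a = t false y <;> by_cases hb : t false b = t false y
        · rw [ha, hb]
        · rw [ha, ρy, ρf _ hb] at h
          have := hB b; omega
        · rw [hb, ρy, ρf _ ha] at h
          have := hB a; omega
        · rw [ρf _ ha, ρf _ hb] at h
          exact_mod_cast h
      · rw [ρt, ρt] at h
        exact_mod_cast h)
    md id
    (by
      intro s a hta
      obtain ⟨u, u1, u2, u3⟩ := L.nb s a (by
        rintro ⟨rfl, h⟩
        exact hta h)
      cases s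
      · refine ⟨u, u1, u2, Or.inl ⟨by simp [hmd], ?_⟩⟩
        intro w hw
        rcases (u3 w hw).eq_or_lt with h | h
        · exact Or.inl h.symm
        · right
          show ρ true (t true u) < ρ true (t true w)
          rw [ρt, ρt]; exact_mod_cast h
      · have hmax : ∀ u, t false u = t false y → ∀ w, t true w = t true u →
            t false w = t false u ∨ ρ false (t false w) < ρ false (t false u) := by
          intro u hu w hw
          by_cases h : t false w = t false y
          · exact Or.inl (h.trans hu.symm)
          · right
            rw [hu, ρy, ρf _ h]
            exact_mod_cast hB w
        by_cases h1 : t true a = t true q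
        · have h2 : t false y < t true q := hBC.resolve_left (fun h => hta (h1.trans h))
          refine ⟨y, ty.trans h1.symm, by rw [ty]; exact h2, Or.inr ⟨by rw [ty]; exact mdq, ?_⟩⟩
          exact hmax y rfl
        · by_cases h2 : t false u = t false y
          · refine ⟨u, u1, u2, Or.inr ⟨?_, hmax u h2⟩⟩
            simp only [hmd, decide_eq_false_iff_not]
            rintro (h | h)
            · exact Bool.noConfusion h
            · exact h (Or.inr ⟨u, rfl, h2, fun w hw => h2 ▸ u3 w hw⟩)
          · refine ⟨u, u1, u2, Or.inl ⟨?_, ?_⟩⟩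
            · simp only [hmd, decide_eq_true_eq]
              right
              rintro (h | ⟨u', k1, k2, k3⟩)
              · exact h1 (u1.symm.trans h)
              · have a1 := k3 u rfl
                have a2 := u3 u' k1
                change t false u ≤ t false u' at a2
                omega
            · intro w hw
              show t false w = t false u ∨ ρ false (t false u) < ρ false (t false w)
              rcases (u3 w hw).eq_or_lt with h | h
              · exact Or.inl h.symm
              · right
                change t false u < t false w at h
                rw [ρf _ h2]
                by_cases h3 : t false w = t false y
                · rw [h3, ρy]; exact_mod_cast hB u
                · rw [ρf _ h3]; exact_mod_cast h)
  have hρq : ρ false (t false q) = 0 := by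
    rw [ρf _ (Ne.symm hW), tq0]; rfl
  have tr0 : t false r = 0 := L.t0
  set z := d r with hz
  have z_ne : z ≠ r := D.fd r
  set v := e true r with hv
  have v_ne : v ≠ r := D.fe true r
  -- X facts
  have xpos : ∀ w, t false w ≠ 0 → (0 : ℤ) < ρ false (t false w) := by
    intro w hw
    by_cases h : t false w = t false y
    · rw [h, ρy]; have := hB w; omega
    · rw [ρf _ h]; omega
  have zminX : ∀ w, w ≠ r → Z false z ≤ Z false w := by
    intro w hw
    by_cases h : t false w = t false r
    · exact ((z4 false w hw h).1 rfl).1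
    · refine (z3 false z w z_ne hw ?_).le
      rw [td, tr0, ← tq0, hρq]; exact xpos w (by rw [← tr0]; exact h)
  have qy : Z false q < Z false y := by
    refine z3 false q y q_ne y_ne ?_
    rw [hρq]; exact xpos y ty0
  -- Y facts
  have vminY : ∀ w, w ≠ r → w ≠ v → Z true v < Z true w := by
    intro w hw hw'
    by_cases h : t true w = t true r
    · refine lt_of_le_of_ne ((z4 true w hw h).2 rfl).2 ?_
      intro h
      rcases z2.ci true v v_ne w hw h with h | h
      · exact hw' h
      · exact hw' (h.trans (cut_to (D.he true r)))
    · refine z3 true v w v_ne hw ?_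
      rw [ρt, ρt, te]
      have := L.snd w
      have : t true r < t true w := by omega
      exact_mod_cast this
  have hn : (1 : ℤ) ≤ Fintype.card V := by
    have : 0 < Fintype.card V := Fintype.card_pos_iff.2 ⟨r⟩
    omega
  set n : ℤ := ((Fintype.card V : ℕ) : ℤ) with hndef
  have vq : q ≠ v := by
    intro h; exact D.ne1 r (hqr.trans h)
  have zq : Z true z ≠ Z true q := by
    intro h
    rcases z2.ci true q q_ne z z_ne h.symm with h | h
    · exact D.ne2 false r (h.trans hqr.symm)
    · change z = cut r (e true) q at h
      rw [cut_of q_ne y_ne] at h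
      apply ty0
      rw [← tr0, ← td false r, ← hz, h]
  set Z' : Bool → V → ℤ := fun s a =>
    match s with
    | false => if a = r then -(2 * n) else Z false a
    | true => if a = r then Z true q else if a = v then -(2 * n) + Z true q - Z false v
        else Z true a with hZ'
  have Xr : Z' false r = -(2 * n) := by simp [hZ']
  have Xo : ∀ a, a ≠ r → Z' false a = Z false a := fun a h => by simp [hZ', h]
  have Yr : Z' true r = Z true q := by simp [hZ']
  have Yv : Z' true v = -(2 * n) + Z true q - Z false v := by simp [hZ', v_ne]
  have Yo : ∀ a, a ≠ r → a ≠ v → Z' true a = Z true a := fun a h1 h2 => by simp [hZ', h1, h2]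
  have hord : ∀ s, ∀ a ∈ {x | x ≠ r}, ∀ b ∈ {x | x ≠ r}, Z' s a < Z' s b ↔ Z s a < Z s b := by
    intro s a ha b hb
    cases s
    · rw [Xo a ha, Xo b hb]
    · have k1 := z1 true q
      have k2 := z1 false v
      by_cases h1 : a = v <;> by_cases h2 : b = v
      · rw [h1, h2]; simp
      · rw [h1, Yv, Yo b hb h2]
        have := vminY b hb h2
        have := z1 true b
        omega
      · rw [h2, Yv, Yo a ha h1]
        have := vminY a ha h1
        have := z1 true a
        omega
      · rw [Yo a ha h1, Yo b hb h2]
  have C := z2.congr (cut_closed e d r) hord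
  have S := C.sg (fun s => cut_inv (D.he s)) (cut_inv D.hd) (cut_ne1 D r) (cut_closed e d r)
  let ℓ : Pt →ₗ[ℝ] ℝ := co false + co true
  have hℓ : ∀ a, ℓ (pt Z' a) = ((Z' false a + Z' true a : ℤ) : ℝ) := by
    intro a
    simp [ℓ, co_pt]
  have hl1 : ℓ (pt Z' v) = ℓ (pt Z' r) := by
    rw [hℓ, hℓ, Xr, Yr, Yv, Xo v v_ne]
    congr 1; ring
  have hl2 : ∀ w, w ≠ r → w ≠ v → ℓ (pt Z' r) < ℓ (pt Z' w) := by
    intro w hw hw'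
    rw [hℓ, hℓ, Xr, Yr, Xo w hw, Yo w hw hw']
    have h1 := z1 false w
    have h2 := z1 true w
    have h3 := z1 true q
    have : -(2 * n) + Z true q < Z false w + Z true w := by omega
    exact_mod_cast this
  have hXr : ∀ w, w ≠ r → Z' false r < Z' false w := by
    intro w hw
    rw [Xr, Xo w hw]; have := z1 false w; omega
  have Yq : Z' true q = Z' true r := by rw [Yr, Yo q q_ne vq]
  have Xqy : Z' false q < Z' false y := by rw [hord false q q_ne y y_ne]; exact qy
  have hnb : ∀ m, SE e d Set.univ r m → m = q ∨ m = v ∨ m = z := by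
    rintro m ⟨-, -, ⟨s, h⟩ | h⟩
    · cases s
      · exact Or.inl (h.trans hqr)
      · exact Or.inr (Or.inl h)
    · exact Or.inr (Or.inr h)
  -- points of the row edge
  have row : ∀ x ∈ segment ℝ (pt Z' r) (pt Z' q), co true x = Z' true q ∧ co false x ≤ Z' false q := by
    intro x hx
    refine ⟨seg_const hx (by rw [co_pt, Yq]) (co_pt _ _ _), ?_⟩
    exact seg_ge hx (by rw [co_pt]; exact_mod_cast (hXr q q_ne).le) (co_pt _ _ _).le
  have eqq : cut r (e true) q = y := cut_of q_ne y_ne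
  have rowv : ∀ w, w ≠ r → Z' true w = Z' true q → w = q ∨ w = y := by
    intro w hw h
    rcases C.ci true q q_ne w hw h.symm with h | h
    · exact Or.inl h
    · exact Or.inr (h.trans eqq)
  have ynot : ∀ x ∈ segment ℝ (pt Z' r) (pt Z' q), x ≠ pt Z' y := by
    rintro x hx rfl
    have := (row _ hx).2
    rw [co_pt] at this
    have : Z' false y ≤ Z' false q := by exact_mod_cast this
    omega
  have xq : ∀ x ∈ segment ℝ (pt Z' r) (pt Z' q), (Z' false q : ℝ) ≤ co false x → x = pt Z' q := by
    intro x hx h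
    obtain ⟨h1, h2⟩ := row x hx
    exact co_ext false (by rw [co_pt]; exact le_antisymm h2 h) (by
      rw [co_pt]; exact h1)
  refine ⟨Z', ?_, SG.extend D S (co false) ?_ ?_ ?_⟩
  · intro s a
    have k1 := z1 true q
    have k2 := z1 false v
    have k3 := z1 s a
    by_cases ha : a = r
    · cases s
      · rw [ha, Xr]; omega
      · rw [ha, Yr]; omega
    · cases s
      · rw [Xo a ha]; omega
      · by_cases h1 : a = v
        · rw [h1, Yv]; omega
        · rw [Yo a ha h1]; omega
  · intro w hw
    rw [co_pt, co_pt]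
    exact_mod_cast hXr w hw
  · intro m hm
    rcases hnb m hm with rfl | rfl | rfl
    · refine ⟨?_, ?_⟩
      · intro w hw hwq hx
        have h1 := (row _ hx).1
        rw [co_pt] at h1
        rcases rowv w hw (by exact_mod_cast h1) with h | h
        · exact hwq h
        · exact ynot _ hx (by rw [h])
      · rintro a b ⟨-, hab, hab'⟩ ha hb x hx hx'
        obtain ⟨x1, x2⟩ := row x hx
        rcases hab' with ⟨s, hs⟩ | hs
        · change b = cut r (e s) a at hs
          have hZab : Z' s b = Z' s a := by rw [hs]; exact C.ce s a ha
          cases s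
          · right
            have hqa : m ≠ a := by
              rintro rfl
              rw [cut_to rfl] at hs; exact hab hs.symm
            have hqb : m ≠ b := by
              rintro rfl
              have := (cut_inv (r := r) (D.he false)) a
              rw [← hs, cut_to rfl] at this
              exact hab this.symm
            exact ⟨ha.symm, hb.symm, hqa, hqb,
              orth_of true (by rw [co_pt, co_pt, Yq]) (by
                show co false _ = co false _
                rw [co_pt, co_pt, hZab])⟩
          · left
            have h1 : co true x = Z' true a :=
              seg_const hx' (co_pt _ _ _) (by rw [co_pt, hZab])
            have h2 : Z' true a = Z' true m := by
              rw [x1] at h1; exact_mod_cast h1.symm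
            have hge : ∀ c, c = m ∨ c = y → (Z' false m : ℝ) ≤ co false (pt Z' c) := by
              intro c hc
              rw [co_pt]
              rcases hc with h | h
              · rw [h]
              · rw [h]; exact_mod_cast Xqy.le
            have ra := rowv a ha h2
            have rb := rowv b hb (hZab.trans h2)
            have hxm : x = pt Z' m := xq x hx (seg_le hx' (hge a ra) (hge b rb))
            refine ⟨m, Or.inr rfl, ?_, hxm⟩
            rcases ra with h | h
            · exact Or.inl h.symm
            · rcases rb with h' | h'
              · exact Or.inr h'.symm
              · exact absurd (h.trans h'.symm) hab
        · have hda : d a ≠ r := fun h => hab (by rw [hs, cut_to h])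
          have hs' : b = d a := hs.trans (cut_of ha hda)
          have hdn : Z' true a ≠ Z' true b := by
            have := C.dn true a ha (by rw [← hs]; exact hab.symm)
            rwa [← hs] at this
          left
          refine ⟨m, Or.inr rfl, ?_⟩
          have hne : co true (pt Z' a) ≠ co true (pt Z' b) := by
            rw [co_pt, co_pt]; exact_mod_cast hdn
          by_cases h1 : Z' true a = Z' true m
          · have hxa : x = pt Z' a := seg_end hx' hne (by rw [x1, co_pt, h1])
            rcases rowv a ha h1 with h | h
            · exact ⟨Or.inl h.symm, by rw [hxa, h]⟩
            · exact absurd (by rw [hxa, h]) (ynot x hx)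
          · by_cases h2 : Z' true b = Z' true m
            · have hxb : x = pt Z' b := seg_end (seg_symm hx') hne.symm (by rw [x1, co_pt, h2])
              rcases rowv b hb h2 with h | h
              · exact ⟨Or.inr h.symm, by rw [hxb, h]⟩
              · exact absurd (by rw [hxb, h]) (ynot x hx)
            · exfalso
              -- strictly between
              have key : Z' false m ≤ Z' false a ∧ Z' false m ≤ Z' false b := by
                have hlo := seg_lo hx' (co_pt Z' true a) (co_pt Z' true b)
                rw [x1] at hlo
                have l1 : min (Z' true a) (Z' true b) ≤ Z' true m := by exact_mod_cast hlo.1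
                have l2 : Z' true m ≤ max (Z' true a) (Z' true b) := by exact_mod_cast hlo.2
                have hc : (Z' true a < Z' true m ∧ Z' true m < Z' true b) ∨
                    (Z' true b < Z' true m ∧ Z' true m < Z' true a) := by omega
                have fin : ∀ c, Z false m ≤ Z false c → c ≠ r → Z' false m ≤ Z' false c := by
                  intro c hc hcr
                  rw [Xo m q_ne, Xo c hcr]; exact hc
                rcases hc with ⟨c1, c2⟩ | ⟨c1, c2⟩
                · rw [hord true _ ha _ q_ne] at c1
                  rw [hord true _ q_ne _ hb, hs'] at c2
                  obtain ⟨-, g2, -, g4⟩ := z5 true a m ha hda q_ne c1 c2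
                  rw [← g2] at g4
                  have := g4 mdq
                  rw [← hs'] at this
                  exact ⟨fin a this.1 ha, fin b this.2 hb⟩
                · rw [hord true _ hb _ q_ne] at c1
                  have hdb : d b = a := by rw [hs', D.hd]
                  rw [hord true _ q_ne _ ha, ← hdb] at c2
                  obtain ⟨-, g2, -, g4⟩ := z5 true b m hb (by rw [hdb]; exact ha) q_ne c1 c2
                  rw [← g2] at g4
                  have := g4 mdq
                  rw [hdb] at this
                  exact ⟨fin a this.2 ha, fin b this.1 hb⟩
              have hxm : x = pt Z' m := xq x hx (seg_le hx'
                (by rw [co_pt]; exact_mod_cast key.1) (by rw [co_pt]; exact_mod_cast key.2))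
              refine S.off a b ⟨ha, hab, Or.inr hs⟩ m q_ne ?_ ?_ (hxm ▸ hx')
              · rintro rfl; exact h1 rfl
              · rintro rfl; exact h2 rfl
    · exact REdge.hull ℓ hl1 hl2 SE_irr
    · refine REdge.graze z_ne S (co false) ?_ ?_
      · rw [co_pt, co_pt]; exact_mod_cast hXr _ z_ne
      · intro w hw
        rw [co_pt, co_pt, Xo _ z_ne, Xo w hw]
        exact_mod_cast zminX w hw
  · have hrow : ∀ x, x ∈ segment ℝ (pt Z' r) (pt Z' q) → x ∈ segment ℝ (pt Z' r) (pt Z' z) →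
        x = pt Z' r := by
      intro x hx hx'
      refine hull_rr (co true) (by rw [co_pt, co_pt, Yq]) ?_ hx hx'
      rw [co_pt, co_pt, Yr]
      by_cases h : z = v
      · exact absurd h (D.ne2 true r)
      · rw [Yo z z_ne h]; exact_mod_cast zq.symm
    intro m m' hm hm' hne x hx hx'
    rcases hnb m hm with h | h | h
    · rcases hnb m' hm' with h' | h' | h'
      · exact absurd (h.trans h'.symm) hne
      · rw [h'] at hx'
        exact hull_rr ℓ hl1 (hl2 m hm.2.1.symm (h' ▸ hne)).ne hx' hx
      · rw [h] at hx; rw [h'] at hx'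
        exact hrow x hx hx'
    · rw [h] at hx
      exact hull_rr ℓ hl1 (hl2 m' hm'.2.1.symm (h ▸ hne.symm)).ne hx hx'
    · rcases hnb m' hm' with h' | h' | h'
      · rw [h] at hx; rw [h'] at hx'
        exact hrow x hx' hx
      · rw [h'] at hx'
        exact hull_rr ℓ hl1 (hl2 m hm.2.1.symm (h' ▸ hne)).ne hx' hx
      · exact absurd (h.trans h'.symm) hne

theorem case_C {V N : Type*} [Fintype V] [Finite N] {e : Bool → V → V} {d : V → V} (D : Dat0 e d)
    (hc : Conn e d)
    (G : SimpleGraph N) (c : Bool → V → N) (c1 : ∀ s a b, c s a = c s b ↔ Orb (e s) d a b)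
    (c2 : ∀ a b, c false a ≠ c true b) (g2 : ∀ s a, G.Adj (c s a) (c (!s) a))
    (c4 : ∀ s a x, G.Adj (c s a) x → ∃ u, c s u = c s a ∧ x = c (!s) u) (a0 : V)
    (hG : (G.induce {c true a0}ᶜ).Connected)
    (n1 : ∀ q, c false (e true q) ≠ c false q → c true (e false q) ≠ c true q)
    (n2 : ∀ q, c true (e false q) ≠ c true q → c false (e true q) ≠ c false q) :
    ∃ Z : Bool → V → ℤ, (∀ s a, -(4 * Fintype.card V : ℤ) ≤ Z s a ∧
      Z s a ≤ 4 * Fintype.card V) ∧ SG (SE e d Set.univ) Set.univ (pt Z) := by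
  have ce : ∀ s a, c s (e s a) = c s a := fun s a => ((c1 s _ _).2 (Orb.f_right a)).symm
  have cd : ∀ s a, c s (d a) = c s a := fun s a => ((c1 s _ _).2 (Orb.g_right a)).symm
  by_cases h : ∃ q, c true q = c true a0 ∧ c false (e true q) ≠ c false q
  · obtain ⟨q, h1, h2⟩ := h
    obtain ⟨τ, t1, t2, t3, t4, t5⟩ := tau2 G (c true a0) hG (c false (e false q))
      (c true (e false q)) (c2 _ _) (by rw [← h1]; exact n1 q h2) (g2 false _)
      ⟨_, g2 true a0⟩
    have L := lab_of_tau e d G c c1 c2 c4 (e false q) τ t1 t2 t3 t4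
    refine case_BC D q _ L (fun h => h2 (t1 h)) (Or.inr ?_)
    show τ (c false (e true q)) < τ (c true q)
    refine lt_of_le_of_ne (by rw [h1]; exact t5 _) ?_
    intro h
    exact c2 _ _ (t1 h)
  · push Not at h
    have hT1 := hc {x | c true x = c true a0} ⟨a0, rfl⟩ (by
      intro a ha
      have ha' : c true a = c true a0 := ha
      refine ⟨(cd true a).trans ha', ?_⟩
      intro s
      cases s
      · have : c true (e false a) = c true a := by
          by_contra hne
          exact n2 a hne (h a ha')
        exact this.trans ha'
      · exact (ce true a).trans ha')
    have hH : ∀ a, c true a = c true a0 := by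
      intro a
      have : a ∈ {x | c true x = c true a0} := by rw [hT1]; trivial
      exact this
    have hT2 := hc {x | c false x = c false a0} ⟨a0, rfl⟩ (by
      intro a ha
      have ha' : c false a = c false a0 := ha
      refine ⟨(cd false a).trans ha', ?_⟩
      intro s
      cases s
      · exact (ce false a).trans ha'
      · exact (h a (hH a)).trans ha')
    have hW : ∀ a, c false a = c false a0 := by
      intro a
      have : a ∈ {x | c false x = c false a0} := by rw [hT2]; trivial
      exact this
    refine case_E D a0 ?_
    intro s a b
    rw [← c1]
    cases s
    · rw [hW a, hW b]
    · rw [hH a, hH b]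

theorem Conn.swap {V : Type*} {e : Bool → V → V} {d : V → V} (h : Conn e d) :
    Conn (fun s => e (!s)) d := by
  intro T hT hc
  refine h T hT (fun a ha => ⟨(hc a ha).1, fun s => ?_⟩)
  have := (hc a ha).2 (!s)
  simpa using this

/-- condition B implies the result -/
theorem case_B {V : Type*} [Fintype V] {e : Bool → V → V} {d : V → V} (D : Dat0 e d)
    (hc : Conn e d) (q : V) (h1 : ¬ Orb (e false) d (e true q) q)
    (h2 : Orb (e true) d (e false q) q) :
    ∃ Z : Bool → V → ℤ, (∀ s a, -(4 * Fintype.card V : ℤ) ≤ Z s a ∧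
      Z s a ≤ 4 * Fintype.card V) ∧ SG (SE e d Set.univ) Set.univ (pt Z) := by
  obtain ⟨t, L⟩ := exists_lab e d D.he D.hd hc (e false q)
  exact case_BC D q t L (fun h => h1 ((L.orb _ _ _).1 h)) (Or.inl ((L.orb _ _ _).2 h2).symm)

theorem case_two {V : Type*} [Fintype V] {e : Bool → V → V} {d : V → V} (D : Dat0 e d)
    (hc : Conn e d) (r0 : V) :
    ∃ Z : Bool → V → ℤ, (∀ s a, -(4 * Fintype.card V : ℤ) ≤ Z s a ∧
      Z s a ≤ 4 * Fintype.card V) ∧ SG (SE e d Set.univ) Set.univ (pt Z) := by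
  by_cases hB : ∃ q, ¬ Orb (e false) d (e true q) q ∧ Orb (e true) d (e false q) q
  · obtain ⟨q, h1, h2⟩ := hB
    exact case_B D hc q h1 h2
  by_cases hB' : ∃ q, ¬ Orb (e true) d (e false q) q ∧ Orb (e false) d (e true q) q
  · obtain ⟨q, h1, h2⟩ := hB'
    obtain ⟨Z, z1, z2⟩ := case_B D.swap hc.swap q h1 h2
    exact ⟨Z, z1, z2.swap⟩
  push Not at hB hB'
  obtain ⟨N, hN, G, c, g1, c1, c2, c3, g2, c4⟩ := exists_nodes e d D.he D.hd hc r0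
  have hnt : Nontrivial N := ⟨c false r0, c true r0, c2 _ _⟩
  obtain ⟨x0, hx0⟩ := g1.exists_connected_induce_compl_singleton_of_finite_nontrivial
  obtain ⟨s, a0, rfl⟩ := c3 x0
  have n1 : ∀ q, c false (e true q) ≠ c false q → c true (e false q) ≠ c true q := by
    intro q h1 h2
    exact hB q (fun h => h1 ((c1 _ _ _).2 h)) ((c1 _ _ _).1 h2)
  have n2 : ∀ q, c true (e false q) ≠ c true q → c false (e true q) ≠ c false q := by
    intro q h1 h2
    exact hB' q (fun h => h1 ((c1 _ _ _).2 h)) ((c1 _ _ _).1 h2)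
  cases s
  · obtain ⟨Z, z1, z2⟩ := case_C D.swap hc.swap G (fun s => c (!s)) (fun s => c1 (!s))
      (fun a b h => c2 b a h.symm) (fun s => g2 (!s)) (fun s => c4 (!s)) a0 hx0 n2 n1
    exact ⟨Z, z1, z2.swap⟩
  · exact case_C D hc G c c1 c2 g2 c4 a0 hx0 n1 n2

/-- connected case -/
theorem conn_case {V : Type*} [Fintype V] {e : Bool → V → V} {d b : V → V} (D : Dat e d b)
    (hc : Conn e d) (r0 : V) :
    ∃ Z : Bool → V → ℤ, (∀ s a, -(4 * Fintype.card V : ℤ) ≤ Z s a ∧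
      Z s a ≤ 4 * Fintype.card V) ∧ Good e d b (pt Z) := by
  have hn : (1 : ℤ) ≤ Fintype.card V := by
    have : 0 < Fintype.card V := Fintype.card_pos_iff.2 ⟨r0⟩
    omega
  by_cases hb : ∃ a, b a ≠ a
  · obtain ⟨Z, z1, z2⟩ := case_one D hc hb
    exact ⟨Z, fun s a => by have := z1 s a; omega, z2⟩
  · push Not at hb
    have hbid : b = id := funext hb
    have D0 : Dat0 e d := by
      refine ⟨D.he, D.hd, ?_, fun a => (D.deg a (hb a)).2, D.ne1, fun s a =>
        D.ne2 a (D.deg a (hb a)).2 s⟩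
      intro s a
      cases s
      · exact (D.deg a (hb a)).1
      · exact D.hfix a
    obtain ⟨Z, z1, z2⟩ := case_two D0 hc r0
    exact ⟨Z, z1, hbid ▸ z2.good⟩

/-- restriction to a fibre -/
def resF {V : Type*} {ix : V → ℕ} (f : V → V) (hf : ∀ a, ix (f a) = ix a) (i : ℕ)
    (x : {x : V // ix x = i}) : {x : V // ix x = i} := ⟨f x.1, (hf x.1).trans x.2⟩

theorem exists_ix {V : Type*} [Finite V] {e : Bool → V → V} {d : V → V}
    (he : ∀ s, Function.Involutive (e s)) (hd : Function.Involutive d) :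
    ∃ ix : V → ℕ, (∀ a, ix (d a) = ix a) ∧ (∀ s a, ix (e s a) = ix a) ∧
      ∀ T : Set V, (∀ a ∈ T, d a ∈ T ∧ ∀ s, e s a ∈ T) → ∀ a b, ix a = ix b → a ∈ T → b ∈ T := by
  let R : V → V → Prop := fun a b =>
    ∀ T : Set V, (∀ a ∈ T, d a ∈ T ∧ ∀ s, e s a ∈ T) → a ∈ T → b ∈ T
  have Rd : ∀ a, R a (d a) := fun a T hT ha => (hT a ha).1
  have Re : ∀ s a, R a (e s a) := fun s a T hT ha => (hT a ha).2 s
  have Rs : ∀ a b, R a b → R b a := by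
    intro a b h T hT hb
    by_contra ha
    refine h Tᶜ ?_ ha hb
    intro x hx
    refine ⟨fun h' => hx ?_, fun s h' => hx ?_⟩
    · have := (hT _ h').1; rwa [hd x] at this
    · have := (hT _ h').2 s; rwa [he s x] at this
  let S : Setoid V := ⟨R, fun a T _ ha => ha, fun h => Rs _ _ h,
    fun h h' T hT ha => h' T hT (h T hT ha)⟩
  obtain ⟨M, ⟨f⟩⟩ := Finite.exists_equiv_fin (Quotient S)
  have key : ∀ a b, R a b → (f (Quotient.mk S a) : ℕ) = f (Quotient.mk S b) := by
    intro a b h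
    have : Quotient.mk S a = Quotient.mk S b := Quotient.sound h
    rw [this]
  refine ⟨fun a => (f (Quotient.mk S a) : ℕ), fun a => (key _ _ (Rd a)).symm,
    fun s a => (key _ _ (Re s a)).symm, ?_⟩
  intro T hT a b h ha
  have h1 := f.injective (Fin.ext h)
  have h2 : R a b := Quotient.exact h1
  exact h2 T hT ha

theorem res_orb_le {V : Type*} {ix : V → ℕ} {f g : V → V} {hf : ∀ a, ix (f a) = ix a}
    {hg : ∀ a, ix (g a) = ix a} {i : ℕ} {a b : {x : V // ix x = i}}
    (h : Orb (resF f hf i) (resF g hg i) a b) : Orb f g a.1 b.1 :=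
  fun T ha hT => h {x | x.1 ∈ T} ha (fun x hx => hT x.1 hx)

theorem res_orb_ge {V : Type*} {ix : V → ℕ} {f g : V → V} {hf : ∀ a, ix (f a) = ix a}
    {hg : ∀ a, ix (g a) = ix a} {i : ℕ} {a b : {x : V // ix x = i}}
    (h : Orb f g a.1 b.1) : Orb (resF f hf i) (resF g hg i) a b := by
  intro T ha hT
  have := h {x | ∃ hx : ix x = i, (⟨x, hx⟩ : {x : V // ix x = i}) ∈ T} ⟨a.2, ha⟩ (by
    rintro x ⟨hx, hx'⟩
    exact ⟨⟨(hf x).trans hx, (hT _ hx').1⟩, ⟨(hg x).trans hx, (hT _ hx').2⟩⟩)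
  exact this.2

theorem seg_shift {P Q v x : Pt} (h : x ∈ segment ℝ (P + v) (Q + v)) :
    x - v ∈ segment ℝ P Q := by
  have := (mem_segment_translate ℝ v (x := x - v) (b := P) (c := Q)).1
  apply this
  rw [add_sub_cancel, add_comm v P, add_comm v Q]
  exact h

theorem all_case {V : Type*} [Fintype V] {e : Bool → V → V} {d b : V → V} (D : Dat e d b) :
    ∃ Z : Bool → V → ℤ, (∀ s a, 0 ≤ Z s a ∧ Z s a ≤ 10 * Fintype.card V) ∧
      Good e d b (pt Z) := by
  obtain ⟨ix, id', ie, iT⟩ := exists_ix D.he D.hd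
  have ib : ∀ a, ix (b a) = ix a := fun a =>
    D.brel a {x | ix x = ix a} rfl (fun x hx => ⟨(ie false x).trans hx, (id' x).trans hx⟩)
  let F : ℕ → Type _ := fun i => {x : V // ix x = i}
  have hi : ∀ i, ∃ Z : Bool → F i → ℤ, (∀ s a, -(4 * Fintype.card (F i) : ℤ) ≤ Z s a ∧
      Z s a ≤ 4 * Fintype.card (F i)) ∧
      Good (fun s => resF (e s) (ie s) i) (resF d id' i) (resF b ib i) (pt Z) := by
    intro i
    by_cases hne : Nonempty (F i)
    · obtain ⟨r0⟩ := hne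
      refine conn_case ?_ ?_ r0
      · have inj : ∀ {x y : F i}, x.1 = y.1 → x = y := fun h => Subtype.ext h
        have vl : ∀ {x y : F i}, x = y → x.1 = y.1 := fun h => congrArg Subtype.val h
        exact
        { he := fun s x => inj (D.he s x.1)
          hd := fun x => inj (D.hd x.1)
          hb := fun x => inj (D.hb x.1)
          hfix := fun x h => D.hfix x.1 (vl h)
          ne1 := fun x h => D.ne1 x.1 (vl h)
          ne2 := fun x h s h' => D.ne2 x.1 (fun k => h (inj k)) s (vl h')
          ne3 := fun x h => ⟨fun h' => (D.ne3 x.1 (fun k => h (inj k))).1 (vl h'),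
            fun s h' => (D.ne3 x.1 (fun k => h (inj k))).2 s (vl h')⟩
          deg := fun x h => ⟨fun h' => (D.deg x.1 (vl h)).1 (vl h'),
            fun h' => (D.deg x.1 (vl h)).2 (vl h')⟩
          bent := fun x h => (D.bent x.1 (fun k => h (inj k))).imp
            (fun k => ⟨inj k.1, fun h' => k.2.1 (vl h'), inj k.2.2.1, fun h' => k.2.2.2 (vl h')⟩)
            (fun k => ⟨inj k.1, fun h' => k.2.1 (vl h'), inj k.2.2.1, fun h' => k.2.2.2 (vl h')⟩)
          hout := fun x h h' => D.hout x.1 (vl h) (res_orb_le h')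
          brel := fun x => res_orb_ge (D.brel x.1) }
      · rintro T ⟨x0, hx0⟩ hT
        ext y
        refine ⟨fun _ => trivial, fun _ => ?_⟩
        have := iT {x | ∃ hx : ix x = i, (⟨x, hx⟩ : F i) ∈ T} (by
          rintro x ⟨hx, hx'⟩
          exact ⟨⟨(id' x).trans hx, (hT _ hx').1⟩, fun s => ⟨(ie s x).trans hx, (hT _ hx').2 s⟩⟩)
          x0.1 y.1 (x0.2.trans y.2.symm) ⟨x0.2, hx0⟩
        exact this.2
    · refine ⟨fun _ _ => 0, fun s a => absurd ⟨a⟩ hne, ?_⟩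
      exact ⟨fun a => absurd ⟨a⟩ hne, fun a => absurd ⟨a⟩ hne, fun a => absurd ⟨a⟩ hne⟩
  choose Zi hZb hZg using hi
  let cnt : ℕ → ℕ := fun i => (Finset.univ.filter (fun x => ix x < i)).card
  have hsz : ∀ i, Fintype.card (F i) = (Finset.univ.filter (fun x => ix x = i)).card :=
    fun i => Fintype.card_subtype _
  have hcnt : ∀ i j, i < j → cnt i + Fintype.card (F i) ≤ cnt j := by
    intro i j hij
    rw [hsz, ← Finset.card_union_of_disjoint]
    · apply Finset.card_le_card
      intro x hx
      simp only [Finset.mem_union, Finset.mem_filter, Finset.mem_univ, true_and] at hx ⊢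
      omega
    · rw [Finset.disjoint_filter]
      intro x _ h; omega
  have hcnt' : ∀ i, cnt i + Fintype.card (F i) ≤ Fintype.card V := by
    intro i
    rw [hsz, ← Finset.card_union_of_disjoint]
    · exact Finset.card_le_univ _
    · rw [Finset.disjoint_filter]
      intro x _ h; omega
  let O : ℕ → ℤ := fun i => 10 * cnt i + 4 * Fintype.card (F i)
  let Z : Bool → V → ℤ := fun s a => Zi (ix a) s ⟨a, rfl⟩ + O (ix a)
  have hZ : ∀ i s a (h : ix a = i), Z s a = Zi i s ⟨a, h⟩ + O i := by
    rintro i s a rfl; rfl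
  have hbox : ∀ s a, (10 * cnt (ix a) : ℤ) ≤ Z s a ∧
      Z s a ≤ 10 * cnt (ix a) + 8 * Fintype.card (F (ix a)) := by
    intro s a
    have h1 := hZb (ix a) s ⟨a, rfl⟩
    have h2 := hZ (ix a) s a rfl
    have h3 : O (ix a) = 10 * cnt (ix a) + 4 * Fintype.card (F (ix a)) := rfl
    omega
  let v : ℕ → Pt := fun i => ((O i : ℝ), (O i : ℝ))
  have hpt : ∀ i a (h : ix a = i), pt Z a = pt (Zi i) ⟨a, h⟩ + v i := by
    intro i a h
    refine Prod.ext ?_ ?_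
    · show ((Z false a : ℤ) : ℝ) = (Zi i false ⟨a, h⟩ : ℝ) + (O i : ℝ)
      rw [hZ i false a h]; push_cast; rfl
    · show ((Z true a : ℤ) : ℝ) = (Zi i true ⟨a, h⟩ : ℝ) + (O i : ℝ)
      rw [hZ i true a h]; push_cast; rfl
  have hoth : ∀ i a (h : ix a = i) k, ((oth (fun s => resF (e s) (ie s) i) (resF d id' i)
      (resF b ib i) (⟨a, h⟩ : F i) k : F i) : V) = oth e d b a k := by
    intro i a h k
    cases k <;> rfl
  have hact : ∀ i a (h : ix a = i) k, act e d b a k → act (fun s => resF (e s) (ie s) i)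
      (resF d id' i) (resF b ib i) (⟨a, h⟩ : F i) k := by
    intro i a h k hk
    cases k with
    | st s => exact fun h' => hk (congrArg Subtype.val h')
    | dd => exact fun h' => hk (congrArg Subtype.val h')
    | b1 => exact ⟨Subtype.ext hk.1, fun h' => hk.2 (congrArg Subtype.val h')⟩
    | b2 => exact ⟨Subtype.ext hk.1, fun h' => hk.2 (congrArg Subtype.val h')⟩
  have hsg : ∀ i a (h : ix a = i) k, sg e d b (pt Z) a k =
      ((sg (fun s => resF (e s) (ie s) i) (resF d id' i) (resF b ib i) (pt (Zi i))
        (⟨a, h⟩ : F i) k).1 + v i,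
       (sg (fun s => resF (e s) (ie s) i) (resF d id' i) (resF b ib i) (pt (Zi i))
        (⟨a, h⟩ : F i) k).2 + v i) := by
    intro i a h k
    have hb1 := hpt i a h
    have hb2 := hpt i (b a) ((ib a).trans h)
    have hbp : bendPt b (pt Z) a = bendPt (resF b ib i) (pt (Zi i)) (⟨a, h⟩ : F i) + v i := by
      unfold bendPt
      rw [hb1, hb2]; rfl
    cases k with
    | st s => exact Prod.ext hb1 (hpt i (e s a) ((ie s a).trans h))
    | dd => exact Prod.ext hb1 (hpt i (d a) ((id' a).trans h))
    | b1 => exact Prod.ext hb1 hbp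
    | b2 => exact Prod.ext hbp hb2
  -- boxes of segments
  have hsbox : ∀ a k x, x ∈ segment ℝ (sg e d b (pt Z) a k).1 (sg e d b (pt Z) a k).2 →
      ((10 * cnt (ix a) : ℤ) : ℝ) ≤ co false x ∧
      co false x ≤ ((10 * cnt (ix a) + 8 * Fintype.card (F (ix a)) : ℤ) : ℝ) := by
    intro a k x hx
    have hc : ∀ c, ix c = ix a → ((10 * cnt (ix a) : ℤ) : ℝ) ≤ co false (pt Z c) ∧
        co false (pt Z c) ≤ ((10 * cnt (ix a) + 8 * Fintype.card (F (ix a)) : ℤ) : ℝ) := by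
      intro c hc
      rw [co_pt]
      have := hbox false c
      rw [hc] at this
      exact ⟨by exact_mod_cast this.1, by exact_mod_cast this.2⟩
    have hp : co false (bendPt b (pt Z) a) = co false (pt Z a) := rfl
    have key : ∀ P Q, x ∈ segment ℝ P Q →
        (((10 * cnt (ix a) : ℤ) : ℝ) ≤ co false P ∧
          co false P ≤ ((10 * cnt (ix a) + 8 * Fintype.card (F (ix a)) : ℤ) : ℝ)) →
        (((10 * cnt (ix a) : ℤ) : ℝ) ≤ co false Q ∧
          co false Q ≤ ((10 * cnt (ix a) + 8 * Fintype.card (F (ix a)) : ℤ) : ℝ)) →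
        (((10 * cnt (ix a) : ℤ) : ℝ) ≤ co false x ∧
          co false x ≤ ((10 * cnt (ix a) + 8 * Fintype.card (F (ix a)) : ℤ) : ℝ)) :=
      fun P Q hx h1 h2 => ⟨seg_le hx h1.1 h2.1, seg_ge hx h1.2 h2.2⟩
    have hbb := hc a rfl
    rw [← hp] at hbb
    cases k with
    | st s => exact key _ _ hx (hc a rfl) (hc _ (ie s a))
    | dd => exact key _ _ hx (hc a rfl) (hc _ (id' a))
    | b1 => exact key _ _ hx (hc a rfl) hbb
    | b2 => exact key _ _ hx hbb (hc _ (ib a))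
  have hdis : ∀ a c (x : ℝ), ((10 * cnt (ix a) : ℤ) : ℝ) ≤ x →
      x ≤ ((10 * cnt (ix a) + 8 * Fintype.card (F (ix a)) : ℤ) : ℝ) →
      ((10 * cnt (ix c) : ℤ) : ℝ) ≤ x →
      x ≤ ((10 * cnt (ix c) + 8 * Fintype.card (F (ix c)) : ℤ) : ℝ) → ix a = ix c := by
    have pos : ∀ a, 1 ≤ Fintype.card (F (ix a)) :=
      fun a => Fintype.card_pos_iff.2 ⟨(⟨a, rfl⟩ : F (ix a))⟩
    intro a c x h1 h2 h3 h4
    have k1 : (10 * cnt (ix a) : ℤ) ≤ 10 * cnt (ix c) + 8 * Fintype.card (F (ix c)) := by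
      exact_mod_cast h1.trans h4
    have k2 : (10 * cnt (ix c) : ℤ) ≤ 10 * cnt (ix a) + 8 * Fintype.card (F (ix a)) := by
      exact_mod_cast h3.trans h2
    have p1 := pos a
    have p2 := pos c
    rcases lt_trichotomy (ix a) (ix c) with h | h | h
    · have := hcnt _ _ h; omega
    · exact h
    · have := hcnt _ _ h; omega
  have hptbox : ∀ w, ((10 * cnt (ix w) : ℤ) : ℝ) ≤ co false (pt Z w) ∧
      co false (pt Z w) ≤ ((10 * cnt (ix w) + 8 * Fintype.card (F (ix w)) : ℤ) : ℝ) := by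
    intro w
    rw [co_pt]
    have := hbox false w
    exact ⟨by exact_mod_cast this.1, by exact_mod_cast this.2⟩
  refine ⟨Z, ?_, ?_, ?_, ?_⟩
  · intro s a
    have h1 := hbox s a
    have h2 := hcnt' (ix a)
    omega
  · intro a c h
    have hix : ix a = ix c := by
      have h1 := hptbox a
      have h2 := hptbox c
      rw [← h] at h2
      exact hdis a c _ h1.1 h1.2 h2.1 h2.2
    rw [hpt (ix c) a hix, hpt (ix c) c rfl] at h
    exact congrArg Subtype.val ((hZg (ix c)).inj _ _ (add_right_cancel h))
  · intro a k hk w hw hw' hx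
    have hix : ix w = ix a := by
      have h1 := hptbox w
      have h2 := hsbox a k _ hx
      exact hdis w a _ h1.1 h1.2 h2.1 h2.2
    rw [hsg (ix a) a rfl k, hpt (ix a) w hix] at hx
    have hx' := seg_shift hx
    rw [add_sub_cancel_right] at hx'
    refine (hZg (ix a)).off ⟨a, rfl⟩ k (hact _ a rfl k hk) ⟨w, hix⟩ ?_ ?_ hx'
    · intro h; exact hw (congrArg Subtype.val h)
    · intro h; exact hw' ((congrArg Subtype.val h).trans (hoth _ a rfl k))
  · intro a k a' k' hk hk' hne x hx hx'
    have hix : ix a' = ix a := by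
      have h1 := hsbox a' k' _ hx'
      have h2 := hsbox a k _ hx
      exact hdis a' a _ h1.1 h1.2 h2.1 h2.2
    have e1 := hsg (ix a) a rfl k
    have e2 := hsg (ix a) a' hix k'
    rw [e1] at hx
    rw [e2] at hx'
    have y1 := seg_shift hx
    have y2 := seg_shift hx'
    rcases (hZg (ix a)).cr ⟨a, rfl⟩ k ⟨a', hix⟩ k' (hact _ a rfl k hk) (hact _ a' hix k' hk') (by
      intro h
      apply hne
      have := congrArg (Sym2.map Subtype.val) h
      rw [Sym2.map_mk, Sym2.map_mk] at this
      simpa only [hoth] using this) _ y1 y2 with ⟨w, h1, h2, h3⟩ | ⟨h1, h2, h3, h4, h5⟩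
    · left
      refine ⟨w.1, ?_, ?_, ?_⟩
      · rcases h1 with h | h
        · exact Or.inl (congrArg Subtype.val h)
        · exact Or.inr ((congrArg Subtype.val h).trans (hoth _ a rfl k))
      · rcases h2 with h | h
        · exact Or.inl (congrArg Subtype.val h)
        · exact Or.inr ((congrArg Subtype.val h).trans (hoth _ a' hix k'))
      · rw [hpt (ix a) w.1 w.2, ← h3]; simp
    · right
      refine ⟨fun h => h1 (Subtype.ext h), fun h => h2 (Subtype.ext (h.trans (hoth _ a' hix k').symm)),
        fun h => h3 (Subtype.ext ((hoth _ a rfl k).trans h)),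
        fun h => h4 (Subtype.ext ((hoth _ a rfl k).trans (h.trans (hoth _ a' hix k').symm))), ?_⟩
      rw [e1, e2]
      unfold SegOrth at h5 ⊢
      simp only [Prod.fst_add, Prod.snd_add, add_sub_add_right_eq_sub]
      exact h5

/-- cyclic parametrisation of a 2-regular graph -/
structure Param {V : Type*} (H : SimpleGraph V) (r : H.ConnectedComponent → V)
    (M I : V → ℕ) (T : V → ℕ → V) : Prop where
  m3 : ∀ a, 3 ≤ M a
  mc : ∀ a, M a = (H.connectedComponentMk a).supp.ncard
  ilt : ∀ a, I a < M a
  ti : ∀ a, T a (I a) = a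
  it : ∀ a i, i < M a → I (T a i) = i
  tc : ∀ a i, H.connectedComponentMk (T a i) = H.connectedComponentMk a
  cc : ∀ a c, H.connectedComponentMk a = H.connectedComponentMk c → T a = T c ∧ M a = M c
  t0 : ∀ a, T a 0 = r (H.connectedComponentMk a)
  tm : ∀ a, T a (M a) = T a 0
  adj : ∀ a i, i < M a → H.Adj (T a i) (T a (i + 1))

theorem param_exists {V : Type*} [Fintype V] (H : SimpleGraph V)
    (h2 : ∀ a, (H.neighborSet a).ncard = 2)
    (r : H.ConnectedComponent → V) (hr : ∀ C, r C ∈ C.supp) :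
    ∃ M I T, Param H r M I T := by
  have hcyc : H.IsCycles := fun a _ => h2 a
  have hex : ∀ C : H.ConnectedComponent, ∃ p : H.Walk (r C) (r C),
      p.IsCycle ∧ p.toSubgraph.verts = C.supp := by
    intro C
    refine hcyc.exists_cycle_toSubgraph_verts_eq_connectedComponentSupp (hr C) ?_
    exact Set.nonempty_of_ncard_ne_zero (by rw [h2]; norm_num)
  choose p hp hv using hex
  have hm3 : ∀ C, 3 ≤ (p C).length := fun C => (hp C).three_le_length
  have hmem : ∀ C i, (p C).getVert i ∈ C.supp := by
    intro C i
    rw [← hv C, SimpleGraph.Walk.mem_verts_toSubgraph]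
    exact (p C).getVert_mem_support i
  have hsurj : ∀ C, ∀ a ∈ C.supp, ∃ i, i < (p C).length ∧ (p C).getVert i = a := by
    intro C a ha
    rw [← hv C, SimpleGraph.Walk.mem_verts_toSubgraph,
      SimpleGraph.Walk.mem_support_iff_exists_getVert] at ha
    obtain ⟨n, h1, h3⟩ := ha
    rcases h3.lt_or_eq with h | h
    · exact ⟨n, h, h1⟩
    · refine ⟨0, by have := hm3 C; omega, ?_⟩
      rw [h, SimpleGraph.Walk.getVert_length] at h1
      rw [SimpleGraph.Walk.getVert_zero, h1]
  have hinj : ∀ C i j, i < (p C).length → j < (p C).length →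
      (p C).getVert i = (p C).getVert j → i = j := by
    intro C i j hi hj h
    exact (hp C).getVert_injOn' (by simp only [Set.mem_ofPred_eq]; omega)
      (by simp only [Set.mem_ofPred_eq]; omega) h
  have hcard : ∀ C, (p C).length = C.supp.ncard := by
    intro C
    have : C.supp = (p C).getVert '' (Set.Iio (p C).length) := by
      ext a
      constructor
      · intro ha
        obtain ⟨i, h1, h3⟩ := hsurj C a ha
        exact ⟨i, h1, h3⟩
      · rintro ⟨i, _, rfl⟩
        exact hmem C i
    have hio : Set.InjOn (p C).getVert (Set.Iio (p C).length) :=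
      fun i hi j hj h => hinj C i j hi hj h
    rw [this, hio.ncard_image]
    rw [Set.ncard_eq_toFinset_card']
    simp
  have hI : ∀ a, ∃ i, i < (p (H.connectedComponentMk a)).length ∧
      (p (H.connectedComponentMk a)).getVert i = a := fun a => hsurj _ a rfl
  choose I hI1 hI2 using hI
  have htc : ∀ a i, H.connectedComponentMk ((p (H.connectedComponentMk a)).getVert i) =
      H.connectedComponentMk a := fun a i => hmem _ i
  refine ⟨fun a => (p (H.connectedComponentMk a)).length, I,
    fun a => (p (H.connectedComponentMk a)).getVert, ?_⟩
  constructor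
  · exact fun a => hm3 _
  · exact fun a => hcard _
  · exact hI1
  · exact hI2
  · intro a i hi
    have h1 := hI1 ((p (H.connectedComponentMk a)).getVert i)
    have h3 := hI2 ((p (H.connectedComponentMk a)).getVert i)
    rw [htc] at h1 h3
    exact hinj _ _ _ h1 hi h3
  · exact htc
  · intro a c h
    have : ∀ C C' : H.ConnectedComponent, C = C' →
        (p C).getVert = (p C').getVert ∧ (p C).length = (p C').length := by
      rintro C _ rfl
      exact ⟨rfl, rfl⟩
    exact this _ _ h
  · intro a
    exact SimpleGraph.Walk.getVert_zero _
  · intro a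
    simp only [SimpleGraph.Walk.getVert_length, SimpleGraph.Walk.getVert_zero]
  · intro a i hi
    exact (p (H.connectedComponentMk a)).adj_getVert_succ hi

/-- index maps -/
def fv (m i : ℕ) : ℕ := if i % 2 = 0 then (if i + 1 < m then i + 1 else i) else i - 1

/-- index maps -/
def fd (m i : ℕ) : ℕ :=
  if i % 2 = 1 then (if i + 1 < m then i + 1 else 0)
  else if i = 0 then (if m % 2 = 0 then m - 1 else 0) else i - 1

/-- index maps -/
def fb (m i : ℕ) : ℕ :=
  if m % 2 = 1 then (if i = 0 then m - 1 else if i = m - 1 then 0 else i) else i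

theorem fix_of_even {V : Type*} [Fintype V] (h : V → V) (hi : Function.Involutive h)
    (hf : ∀ a, h a ≠ a) (S : Set V) (hS : Odd S.ncard) : ∃ a ∈ S, h a ∉ S := by
  by_contra hc
  push Not at hc
  have h0 : ∑ x ∈ S.toFinset, (1 : ZMod 2) = 0 :=
    Finset.sum_involution (fun a _ => h a) (fun a _ => by decide) (fun a _ _ => hf a)
      (fun a ha => by rw [Set.mem_toFinset] at ha ⊢; exact hc a ha) (fun a _ => hi a)
  rw [Finset.sum_const, nsmul_eq_mul, mul_one, ZMod.natCast_eq_zero_iff] at h0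
  rw [Set.ncard_eq_toFinset_card'] at hS
  exact (Nat.not_even_iff_odd.mpr hS) (even_iff_two_dvd.mpr h0)

theorem two_deg {V : Type*} {G : SimpleGraph V} {F : Set (Sym2 V)} (hF : Is2Factor G F) (a : V) :
    ((SimpleGraph.fromEdgeSet F).neighborSet a).ncard = 2 := by
  rw [← hF.2 a]
  have hinj : Set.InjOn (fun c => s(a, c)) ((SimpleGraph.fromEdgeSet F).neighborSet a) := by
    intro c _ c' _ h
    exact Sym2.congr_right.mp h
  rw [← hinj.ncard_image]
  congr 1
  ext x
  constructor
  · rintro ⟨c, hc, rfl⟩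
    rw [SimpleGraph.mem_neighborSet, SimpleGraph.fromEdgeSet_adj] at hc
    exact ⟨hc.1, Sym2.mem_mk_left _ _⟩
  · rintro ⟨h1, h2⟩
    obtain ⟨c, rfl⟩ := h2
    refine ⟨c, ?_, rfl⟩
    rw [SimpleGraph.mem_neighborSet, SimpleGraph.fromEdgeSet_adj]
    exact ⟨h1, (hF.1 h1 : G.Adj a c).ne⟩

theorem third {V : Type*} [Fintype V] {G H : SimpleGraph V} (hle : ∀ a c, H.Adj a c → G.Adj a c)
    (h3 : ∀ a, vdeg G a = 3) (h2 : ∀ a, (H.neighborSet a).ncard = 2) :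
    ∃ h : V → V, Function.Involutive h ∧ (∀ a, h a ≠ a) ∧ (∀ a, ¬ H.Adj a (h a)) ∧
      ∀ a c, G.Adj a c ↔ H.Adj a c ∨ c = h a := by
  have hex : ∀ a, ∃ c, G.neighborSet a \ H.neighborSet a = {c} := by
    intro a
    have hs : H.neighborSet a ⊆ G.neighborSet a := fun c hc => hle a c hc
    rw [← Set.ncard_eq_one, Set.ncard_sdiff hs, h2]
    have := h3 a
    unfold vdeg at this
    rw [this]
  choose h hh using hex
  have hm : ∀ a c, (G.Adj a c ∧ ¬ H.Adj a c) ↔ c = h a := by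
    intro a c
    have := Set.ext_iff.mp (hh a) c
    simpa using this
  refine ⟨h, ?_, ?_, ?_, ?_⟩
  · intro a
    have := (hm a (h a)).mpr rfl
    exact ((hm (h a) a).mp ⟨this.1.symm, fun h => this.2 h.symm⟩).symm
  · intro a
    exact ((hm a (h a)).mpr rfl).1.ne'
  · intro a
    exact ((hm a (h a)).mpr rfl).2
  · intro a c
    rw [← hm]
    constructor
    · intro hg
      by_cases hc : H.Adj a c
      · exact Or.inl hc
      · exact Or.inr ⟨hg, hc⟩
    · rintro (h | h)
      · exact hle a c h
      · exact h.1

theorem fd_cases {m i : ℕ} (h : i < m) :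
    (i % 2 = 1 ∧ i + 1 < m ∧ fd m i = i + 1) ∨ (i % 2 = 1 ∧ i + 1 = m ∧ fd m i = 0) ∨
      (i = 0 ∧ m % 2 = 0 ∧ fd m i = m - 1) ∨ (i = 0 ∧ m % 2 = 1 ∧ fd m i = 0) ∨
      (i % 2 = 0 ∧ 0 < i ∧ fd m i = i - 1) := by
  unfold fd
  split_ifs <;> omega

theorem fv_cases {m i : ℕ} (h : i < m) :
    (i % 2 = 1 ∧ fv m i = i - 1) ∨ (i % 2 = 0 ∧ i + 1 < m ∧ fv m i = i + 1) ∨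
      (i % 2 = 0 ∧ i + 1 = m ∧ fv m i = i) := by
  unfold fv
  split_ifs <;> omega

theorem fb_cases {m i : ℕ} (h : i < m) :
    (m % 2 = 0 ∧ fb m i = i) ∨ (m % 2 = 1 ∧ i = 0 ∧ fb m i = m - 1) ∨
      (m % 2 = 1 ∧ i = m - 1 ∧ fb m i = 0) ∨
      (m % 2 = 1 ∧ 0 < i ∧ i < m - 1 ∧ fb m i = i) := by
  unfold fb
  split_ifs <;> omega

theorem fd_lt {m i : ℕ} (h : i < m) : fd m i < m := by
  rcases fd_cases h with h1 | h1 | h1 | h1 | h1 <;> omega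

theorem fd_inv {m i : ℕ} (h : i < m) : fd m (fd m i) = i := by
  have h1 := fd_cases h
  have h2 := fd_cases (fd_lt h)
  omega

set_option maxHeartbeats 2000000 in
theorem dat_exists {V : Type*} [Fintype V] (G : SimpleGraph V) (h3 : ∀ v, vdeg G v = 3)
    (F : Set (Sym2 V)) (hF : Is2Factor G F) :
    ∃ (e : Bool → V → V) (d b : V → V), Dat e d b ∧
      (∀ a c, G.Adj a c ↔ c ≠ a ∧ (c = e true a ∨ c = e false a ∨ c = d a ∨ c = b a)) ∧
      (∀ a a', e false a = a → b a ≠ a → e false a' = a' → b a' ≠ a' →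
        (SimpleGraph.fromEdgeSet F).connectedComponentMk a =
          (SimpleGraph.fromEdgeSet F).connectedComponentMk a' → a = a') ∧
      (∀ a, b a ≠ a → Odd ((SimpleGraph.fromEdgeSet F).connectedComponentMk a).supp.ncard) := by
  have h2 := two_deg hF
  have hle : ∀ a c, (SimpleGraph.fromEdgeSet F).Adj a c → G.Adj a c := by
    intro a c h
    rw [SimpleGraph.fromEdgeSet_adj] at h
    exact hF.1 h.1
  generalize SimpleGraph.fromEdgeSet F = H at h2 hle
  obtain ⟨h, hi, hf, hn, hG⟩ := third hle h3 h2
  have hr : ∀ C : H.ConnectedComponent, ∃ a ∈ C.supp, Odd C.supp.ncard → h a ∉ C.supp := by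
    intro C
    by_cases hC : Odd C.supp.ncard
    · obtain ⟨a, h1, h4⟩ := fix_of_even h hi hf C.supp hC
      exact ⟨a, h1, fun _ => h4⟩
    · obtain ⟨a, ha⟩ := C.nonempty_supp
      exact ⟨a, ha, fun h => absurd h hC⟩
  choose r hr1 hr2 using hr
  obtain ⟨M, I, T, P⟩ := param_exists H h2 r hr1
  -- basic calculus
  have m3 := P.m3
  have ilt := P.ilt
  have hT : ∀ a i, T (T a i) = T a ∧ M (T a i) = M a := fun a i => P.cc _ _ (P.tc a i)
  have tinj : ∀ a i j, i < M a → j < M a → (T a i = T a j ↔ i = j) := by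
    intro a i j h1 h4
    constructor
    · intro h
      rw [← P.it a i h1, ← P.it a j h4, h]
    · rintro rfl; rfl
  have tself : ∀ a i, i < M a → (T a i = a ↔ i = I a) := by
    intro a i h1
    rw [← tinj a i (I a) h1 (ilt a), P.ti]
  have lv : ∀ m i, i < m → fv m i < m := by intro m i h; unfold fv; split_ifs <;> omega
  have ld : ∀ m i, i < m → fd m i < m := by intro m i h; unfold fd; split_ifs <;> omega
  have lb : ∀ m i, i < m → fb m i < m := by intro m i h; unfold fb; split_ifs <;> omega
  have inv : ∀ f : ℕ → ℕ → ℕ, (∀ m i, i < m → f m i < m) → (∀ m i, i < m → f m (f m i) = i) →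
      Function.Involutive (fun a => T a (f (M a) (I a))) := by
    intro f hf1 hf2 a
    have h1 := hf1 _ _ (ilt a)
    simp only
    rw [(hT a _).1, (hT a _).2, P.it a _ h1, hf2 _ _ (ilt a), P.ti]
  have iv : ∀ m i, i < m → fv m (fv m i) = i := by
    intro m i h; unfold fv; split_ifs <;> omega
  have idd : ∀ m i, i < m → fd m (fd m i) = i := by
    intro m i h; exact fd_inv h
  have ib : ∀ m i, i < m → fb m (fb m i) = i := by
    intro m i h; unfold fb; split_ifs <;> omega
  -- adjacency
  have hsucc : ∀ a, H.Adj a (T a (if I a + 1 < M a then I a + 1 else 0)) := by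
    intro a
    have h1 := P.adj a (I a) (ilt a)
    rw [P.ti] at h1
    split_ifs with hlt
    · exact h1
    · have : I a + 1 = M a := by have := ilt a; omega
      rwa [this, P.tm] at h1
  have hpred : ∀ a, H.Adj a (T a (if I a = 0 then M a - 1 else I a - 1)) := by
    intro a
    apply SimpleGraph.Adj.symm
    split_ifs with h0
    · have h1 := P.adj a (M a - 1) (by have := m3 a; omega)
      have : M a - 1 + 1 = M a := by have := m3 a; omega
      rw [this, P.tm, ← h0, P.ti] at h1
      exact h1
    · have h1 := P.adj a (I a - 1) (by have := ilt a; omega)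
      have : I a - 1 + 1 = I a := by omega
      rw [this, P.ti] at h1
      exact h1
  have hHadj : ∀ a c, H.Adj a c ↔ c = T a (if I a + 1 < M a then I a + 1 else 0) ∨
      c = T a (if I a = 0 then M a - 1 else I a - 1) := by
    intro a c
    have hne : T a (if I a + 1 < M a then I a + 1 else 0) ≠
        T a (if I a = 0 then M a - 1 else I a - 1) := by
      have := m3 a
      have := ilt a
      rw [Ne, tinj] <;> split_ifs <;> omega
    have hsub : ({T a (if I a + 1 < M a then I a + 1 else 0),
        T a (if I a = 0 then M a - 1 else I a - 1)} : Set V) ⊆ H.neighborSet a := by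
      rintro x (rfl | rfl)
      · exact hsucc a
      · exact hpred a
    have heq := Set.eq_of_subset_of_ncard_le hsub (by rw [h2, Set.ncard_pair hne])
    rw [← SimpleGraph.mem_neighborSet, ← heq]
    simp
  have hHv : ∀ a c, (c = T a (fv (M a) (I a)) ∨ c = T a (fd (M a) (I a)) ∨
      c = T a (fb (M a) (I a))) → c = a ∨ H.Adj a c := by
    intro a c hc
    rw [hHadj]
    have e1 := m3 a
    have e2 := ilt a
    have : ∃ i, i < M a ∧ c = T a i ∧ (i = I a ∨
      i = (if I a + 1 < M a then I a + 1 else 0) ∨ i = (if I a = 0 then M a - 1 else I a - 1)) := by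
      rcases hc with h | h | h
      · refine ⟨_, lv _ _ e2, h, ?_⟩
        unfold fv; split_ifs <;> omega
      · refine ⟨_, ld _ _ e2, h, ?_⟩
        unfold fd; split_ifs <;> omega
      · refine ⟨_, lb _ _ e2, h, ?_⟩
        unfold fb; split_ifs <;> omega
    obtain ⟨i, h1, rfl, h4 | h4 | h4⟩ := this
    · left; rw [h4, P.ti]
    · right; left; rw [h4]
    · right; right; rw [h4]
  have hH' : ∀ a c, H.Adj a c → c = T a (fv (M a) (I a)) ∨ c = T a (fd (M a) (I a)) ∨
      c = T a (fb (M a) (I a)) := by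
    intro a c hc
    rw [hHadj] at hc
    have e1 := m3 a
    have e2 := ilt a
    have : ∃ i, c = T a i ∧ (i = fv (M a) (I a) ∨ i = fd (M a) (I a) ∨ i = fb (M a) (I a)) := by
      rcases hc with h | h
      · refine ⟨_, h, ?_⟩
        have c1 := fv_cases e2
        have c2 := fd_cases e2
        have c3 := fb_cases e2
        split_ifs <;> omega
      · refine ⟨_, h, ?_⟩
        have c1 := fv_cases e2
        have c2 := fd_cases e2
        have c3 := fb_cases e2
        split_ifs <;> omega
    obtain ⟨i, rfl, h4 | h4 | h4⟩ := this
    · left; rw [h4]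
    · right; left; rw [h4]
    · right; right; rw [h4]
  have cHv : ∀ a i, i < M a → T a i ≠ h a ∨ ¬ (T a i = a ∨ H.Adj a (T a i)) := by
    intro a i _
    by_cases hc : T a i = h a
    · right
      rw [hc]
      push Not
      exact ⟨hf a, hn a⟩
    · exact Or.inl hc
  have hOdd : ∀ a, T a (fb (M a) (I a)) ≠ a → M a % 2 = 1 ∧ (I a = 0 ∨ I a = M a - 1) := by
    intro a ha
    rw [Ne, tself a _ (lb _ _ (ilt a))] at ha
    unfold fb at ha
    split_ifs at ha <;> omega
  have Oe : ∀ a i, i < M a →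
      Orb (fun a => T a (fv (M a) (I a))) (fun a => T a (fd (M a) (I a))) (T a 0) (T a i) := by
    intro a i
    induction i with
    | zero => intro _; exact Orb.rfl' _
    | succ i ih =>
      intro hlt
      refine (ih (by omega)).trans' ?_
      have e1 := P.it a i (by omega)
      have e2 := hT a i
      by_cases hp : i % 2 = 0
      · have := Orb.f_right (f := fun a => T a (fv (M a) (I a)))
          (g := fun a => T a (fd (M a) (I a))) (T a i)
        simp only [e1, e2] at this
        have e3 : fv (M a) i = i + 1 := by unfold fv; split_ifs; rfl
        rwa [e3] at this
      · have := Orb.g_right (f := fun a => T a (fv (M a) (I a)))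
          (g := fun a => T a (fd (M a) (I a))) (T a i)
        simp only [e1, e2] at this
        have e3 : fd (M a) i = i + 1 := by unfold fd; split_ifs <;> omega
        rwa [e3] at this
  refine ⟨fun s => if s then h else fun a => T a (fv (M a) (I a)),
    fun a => T a (fd (M a) (I a)), fun a => T a (fb (M a) (I a)), ?_, ?_, ?_, ?_⟩
  · constructor
    · intro s
      cases s
      · exact inv fv lv iv
      · exact hi
    · exact inv fd ld idd
    · exact inv fb lb ib
    · exact hf
    · intro a
      simp only [if_true, Bool.false_eq_true, if_false]
      intro hc
      rcases hHv a _ (Or.inl hc.symm) with h1 | h1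
      · exact hf a h1
      · exact hn a h1
    · intro a ha s
      cases s
      · simp only [Bool.false_eq_true, if_false] at ha ⊢
        have e1 := m3 a
        have e2 := ilt a
        rw [Ne, tself a _ (ld _ _ e2)] at ha
        rw [Ne, tinj a _ _ (ld _ _ e2) (lv _ _ e2)]
        have c1 := fv_cases e2
        have c2 := fd_cases e2
        have c3 := fb_cases e2
        omega
      · simp only [if_true]
        intro hc
        rcases hHv a _ (Or.inr (Or.inl hc.symm)) with h1 | h1
        · exact hf a h1
        · exact hn a h1
    · intro a ha
      have e1 := m3 a
      have e2 := ilt a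
      have ha' := ha
      rw [Ne, tself a _ (lb _ _ e2)] at ha
      constructor
      · rw [Ne, tinj a _ _ (lb _ _ e2) (ld _ _ e2)]
        have c1 := fv_cases e2
        have c2 := fd_cases e2
        have c3 := fb_cases e2
        omega
      · intro s
        cases s
        · simp only [Bool.false_eq_true, if_false]
          rw [Ne, tinj a _ _ (lb _ _ e2) (lv _ _ e2)]
          have c1 := fv_cases e2
          have c2 := fd_cases e2
          have c3 := fb_cases e2
          omega
        · simp only [if_true]
          intro hc
          rcases hHv a _ (Or.inr (Or.inr hc.symm)) with h1 | h1
          · exact hf a h1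
          · exact hn a h1
    · intro a ha
      simp only [Bool.false_eq_true, if_false] at ha ⊢
      have e1 := m3 a
      have e2 := ilt a
      rw [tself a _ (lb _ _ e2)] at ha
      rw [Ne, tself a _ (lv _ _ e2), Ne, tself a _ (ld _ _ e2)]
      have c1 := fv_cases e2
      have c2 := fd_cases e2
      have c3 := fb_cases e2
      omega
    · intro a ha
      simp only [Bool.false_eq_true, if_false] at ha ⊢
      have e1 := m3 a
      have e2 := ilt a
      have e4 := lb _ _ e2
      rw [Ne, tself a _ e4] at ha
      rw [(hT a _).1, (hT a _).2, P.it a _ e4]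
      simp only [ne_eq]
      rw [tself a _ (lv _ _ e2), tself a _ (ld _ _ e2), tinj a _ _ (lv _ _ e4) e4,
        tinj a _ _ (ld _ _ e4) e4]
      have := hOdd a (by rw [Ne, tself a _ e4]; exact ha)
      rcases this with ⟨h1, h4 | h4⟩
      · right
        have e5 : fb (M a) (I a) = M a - 1 := by unfold fb; split_ifs; rfl
        rw [e5, h4]
        have c1 := fd_cases (m := M a) (i := 0) (by omega)
        have c2 := fd_cases (m := M a) (i := M a - 1) (by omega)
        have c3 := fv_cases (m := M a) (i := 0) (by omega)
        have c4 := fv_cases (m := M a) (i := M a - 1) (by omega)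
        omega
      · left
        have e5 : fb (M a) (I a) = 0 := by unfold fb; split_ifs <;> omega
        rw [e5, h4]
        have c1 := fd_cases (m := M a) (i := 0) (by omega)
        have c2 := fd_cases (m := M a) (i := M a - 1) (by omega)
        have c3 := fv_cases (m := M a) (i := 0) (by omega)
        have c4 := fv_cases (m := M a) (i := M a - 1) (by omega)
        omega
    · intro a ha hO
      simp only [if_true, Bool.false_eq_true, if_false] at ha hO
      have e1 := m3 a
      have e2 := ilt a
      rw [tself a _ (ld _ _ e2)] at ha
      have : M a % 2 = 1 ∧ I a = 0 := by
        unfold fd at ha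
        split_ifs at ha <;> omega
      have hra : a = r (H.connectedComponentMk a) := by
        rw [← P.t0, ← this.2, P.ti]
      have hcl := hO (H.connectedComponentMk a).supp rfl (by
        intro x hx
        exact ⟨(P.tc x _).trans hx, (P.tc x _).trans hx⟩)
      have hno := hr2 (H.connectedComponentMk a) (by
        rw [← P.mc, Nat.odd_iff]; exact this.1)
      rw [← hra] at hno
      exact hno hcl
    · intro a
      simp only [Bool.false_eq_true, if_false]
      have e2 := ilt a
      have := Oe a (I a) e2
      rw [P.ti] at this
      exact (this.symm' (inv fv lv iv) (inv fd ld idd)).trans' (Oe a _ (lb _ _ e2))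
  · intro a c
    simp only [if_true, Bool.false_eq_true, if_false]
    rw [hG]
    constructor
    · rintro (h1 | h1)
      · exact ⟨h1.ne', Or.inr (hH' a c h1)⟩
      · exact ⟨by rw [h1]; exact hf a, Or.inl h1⟩
    · rintro ⟨h0, h1 | h1⟩
      · exact Or.inr h1
      · rcases hHv a c h1 with h4 | h4
        · exact absurd h4 h0
        · exact Or.inl h4
  · intro a a' h1 h4 h5 h6 hc
    simp only [Bool.false_eq_true, if_false] at h1 h4 h5 h6
    obtain ⟨q1, q2⟩ := P.cc a a' hc
    have key : ∀ a, T a (fv (M a) (I a)) = a → T a (fb (M a) (I a)) ≠ a → I a = M a - 1 := by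
      intro a g1 g2
      have e1 := m3 a
      have e2 := ilt a
      have := hOdd a g2
      rw [tself a _ (lv _ _ e2)] at g1
      unfold fv at g1
      split_ifs at g1 <;> omega
    have k1 := key a h1 h4
    have k2 := key a' h5 h6
    rw [← P.ti a, ← P.ti a', k1, k2, q1, q2]
  · intro a ha
    rw [← P.mc, Nat.odd_iff]
    exact (hOdd a ha).1

theorem orth_subsingleton {a b c d : Pt} (h : SegOrth a b c d) :
    (segment ℝ a b ∩ segment ℝ c d).Subsingleton := by
  rintro x ⟨hx1, hx2⟩ y ⟨hy1, hy2⟩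
  rw [segment_eq_image] at hx1 hx2 hy1 hy2
  obtain ⟨s, _, rfl⟩ := hx1
  obtain ⟨t, _, rfl⟩ := hy1
  obtain ⟨s', _, h1⟩ := hx2
  obtain ⟨t', _, h2⟩ := hy2
  rw [Prod.ext_iff] at h1 h2
  simp only [Prod.fst_add, Prod.snd_add, Prod.smul_fst, Prod.smul_snd, smul_eq_mul] at h1 h2
  unfold SegOrth at h
  have e1 : (t - s) * (b.1 - a.1) = (t' - s') * (d.1 - c.1) := by linarith [h1.1, h2.1]
  have e2 : (t - s) * (b.2 - a.2) = (t' - s') * (d.2 - c.2) := by linarith [h1.2, h2.2]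
  have e3 : ((t - s) * (b.1 - a.1)) ^ 2 + ((t - s) * (b.2 - a.2)) ^ 2 = 0 := by
    calc _ = ((t - s) * (b.1 - a.1)) * ((t' - s') * (d.1 - c.1)) +
        ((t - s) * (b.2 - a.2)) * ((t' - s') * (d.2 - c.2)) := by rw [← e1, ← e2]; ring
      _ = (t - s) * (t' - s') *
        ((b.1 - a.1) * (d.1 - c.1) + (b.2 - a.2) * (d.2 - c.2)) := by ring
      _ = 0 := by rw [h, mul_zero]
  have f1 : (t - s) * (b.1 - a.1) = 0 := by nlinarith [sq_nonneg ((t - s) * (b.1 - a.1)), sq_nonneg ((t - s) * (b.2 - a.2))]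
  have f2 : (t - s) * (b.2 - a.2) = 0 := by nlinarith [sq_nonneg ((t - s) * (b.1 - a.1)), sq_nonneg ((t - s) * (b.2 - a.2))]
  refine Prod.ext ?_ ?_
  · simp only [Prod.fst_add, Prod.smul_fst, smul_eq_mul]
    linarith
  · simp only [Prod.snd_add, Prod.smul_snd, smul_eq_mul]
    linarith

/-- bent edge -/
def BentE {V : Type*} (e : Bool → V → V) (b : V → V) (x : Sym2 V) (a : V) : Prop :=
  e false a = a ∧ b a ≠ a ∧ x = s(a, b a)

/-- the polylines -/
def plys {V : Type*} (e : Bool → V → V) (b : V → V) (p : V → Pt) (x : Sym2 V) : List Pt :=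
  if h : ∃ a, BentE e b x a then [p h.choose, bendPt b p h.choose, p (b h.choose)]
  else [p (Quot.out x).1, p (Quot.out x).2]

theorem plys_spec {V : Type*} (e : Bool → V → V) (b : V → V) (p : V → Pt) (x : Sym2 V) :
    (∃ a, BentE e b x a ∧ plys e b p x = [p a, bendPt b p a, p (b a)]) ∨
    ((¬ ∃ a, BentE e b x a) ∧ ∃ u w, x = s(u, w) ∧ plys e b p x = [p u, p w]) := by
  by_cases h : ∃ a, BentE e b x a
  · left
    exact ⟨h.choose, h.choose_spec, by unfold plys; rw [dif_pos h]⟩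
  · right
    exact ⟨h, (Quot.out x).1, (Quot.out x).2, (Quot.out_eq x).symm, by unfold plys; rw [dif_neg h]⟩

theorem seg_spec {V : Type*} {G : SimpleGraph V} {e : Bool → V → V} {d b : V → V} (D : Dat e d b)
    (hG : ∀ a c, G.Adj a c ↔ c ≠ a ∧ (c = e true a ∨ c = e false a ∨ c = d a ∨ c = b a))
    (p : V → Pt) (x : Sym2 V) (hx : x ∈ G.edgeSet) (S : Pt × Pt)
    (hS : S ∈ polySegs (plys e b p x)) :
    ∃ a k, act e d b a k ∧ x = s(a, oth e d b a k) ∧ S = sg e d b p a k := by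
  rcases plys_spec e b p x with ⟨a, ⟨h1, h2, h3⟩, h4⟩ | ⟨hno, u, w, rfl, h4⟩
  · rw [h4] at hS
    simp only [polySegs, List.tail_cons, List.zip_cons_cons, List.zip_nil_right, List.mem_cons,
      List.not_mem_nil, or_false] at hS
    rcases hS with rfl | rfl
    · exact ⟨a, Kd.b1, ⟨h1, h2⟩, h3, rfl⟩
    · exact ⟨a, Kd.b2, ⟨h1, h2⟩, h3, rfl⟩
  · rw [h4] at hS
    simp only [polySegs, List.tail_cons, List.zip_cons_cons, List.zip_nil_right, List.mem_cons,
      List.not_mem_nil, or_false] at hS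
    subst hS
    have hadj : G.Adj u w := hx
    rw [hG] at hadj
    obtain ⟨hne, rfl | rfl | rfl | rfl⟩ := hadj
    · exact ⟨u, Kd.st true, hne, rfl, rfl⟩
    · exact ⟨u, Kd.st false, hne, rfl, rfl⟩
    · exact ⟨u, Kd.dd, hne, rfl, rfl⟩
    · exfalso
      apply hno
      rcases D.bent u hne with h | h
      · exact ⟨u, h.1, hne, rfl⟩
      · exact ⟨b u, h.2.2.1, by rw [D.hb]; exact hne.symm, by rw [D.hb]; exact Sym2.eq_swap⟩

theorem mem_polySet {l : List Pt} {x : Pt} :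
    x ∈ polySet l ↔ ∃ S ∈ polySegs l, x ∈ segment ℝ S.1 S.2 := by
  unfold polySet
  simp only [Set.mem_iUnion, exists_prop]

theorem draw {V : Type*} [Fintype V] {G : SimpleGraph V} {e : Bool → V → V} {d b : V → V}
    (D : Dat e d b)
    (hG : ∀ a c, G.Adj a c ↔ c ≠ a ∧ (c = e true a ∨ c = e false a ∨ c = d a ∨ c = b a))
    {p : V → Pt} (Q : Good e d b p) : IsBendRACDrawing 1 G p (plys e b p) := by
  have hs := seg_spec D hG p
  have hcr : ∀ x ∈ G.edgeSet, ∀ x' ∈ G.edgeSet, x ≠ x' → ∀ S ∈ polySegs (plys e b p x),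
      ∀ S' ∈ polySegs (plys e b p x'), ∀ z ∈ segment ℝ S.1 S.2, z ∈ segment ℝ S'.1 S'.2 →
      (∃ w, w ∈ x ∧ w ∈ x' ∧ z = p w) ∨
        ((∀ w, w ∈ x → w ∉ x') ∧ SegOrth S.1 S.2 S'.1 S'.2) := by
    intro x hx x' hx' hne S hS S' hS' z hz hz'
    obtain ⟨a, k, h1, rfl, rfl⟩ := hs x hx S hS
    obtain ⟨a', k', h1', rfl, rfl⟩ := hs x' hx' S' hS'
    rcases Q.cr a k a' k' h1 h1' hne z hz hz' with ⟨w, h2, h3, h4⟩ | ⟨h2, h3, h4, h5, h6⟩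
    · left
      exact ⟨w, Sym2.mem_iff.mpr h2, Sym2.mem_iff.mpr h3, h4⟩
    · right
      refine ⟨?_, h6⟩
      intro w hw hw'
      rw [Sym2.mem_iff] at hw hw'
      rcases hw with rfl | rfl <;> rcases hw' with h | h <;> contradiction
  constructor
  · exact fun a c h => Q.inj a c h
  · intro x hx
    rcases plys_spec e b p x with ⟨a, ⟨h1, h2, h3⟩, h4⟩ | ⟨hno, u, w, h3, h4⟩
    · exact ⟨a, b a, h3, by rw [h4]; rfl, by rw [h4]; rfl⟩
    · exact ⟨u, w, h3, by rw [h4]; rfl, by rw [h4]; rfl⟩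
  · intro x hx
    rcases plys_spec e b p x with ⟨a, ⟨h1, h2, h3⟩, h4⟩ | ⟨hno, u, w, h3, h4⟩
    · rw [h4]; simp
    · rw [h4]; simp
  · intro x hx w hw hm
    rw [mem_polySet] at hm
    obtain ⟨S, hS, hm⟩ := hm
    obtain ⟨a, k, h1, rfl, rfl⟩ := hs x hx S hS
    rw [Sym2.mem_iff] at hw
    push Not at hw
    exact Q.off a k h1 w hw.1 hw.2 hm
  · rintro x hx x' hx' hne w hw hw' z ⟨hz, hz'⟩
    rw [mem_polySet] at hz hz'
    obtain ⟨S, hS, hz⟩ := hz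
    obtain ⟨S', hS', hz'⟩ := hz'
    rcases hcr x hx x' hx' hne S hS S' hS' z hz hz' with ⟨v, h1, h2, h3⟩ | ⟨h1, _⟩
    · rw [h3]
      by_cases hv : v = w
      · rw [hv]; rfl
      · exfalso
        apply hne
        rw [(Sym2.mem_and_mem_iff hv).mp ⟨h1, hw⟩, (Sym2.mem_and_mem_iff hv).mp ⟨h2, hw'⟩]
    · exact absurd hw' (h1 w hw)
  · intro x hx x' hx' hne
    have hsub : polySet (plys e b p x) ∩ polySet (plys e b p x') ⊆
        ⋃ S ∈ {S | S ∈ polySegs (plys e b p x)}, ⋃ S' ∈ {S | S ∈ polySegs (plys e b p x')},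
          (segment ℝ S.1 S.2 ∩ segment ℝ S'.1 S'.2) := by
      rintro z ⟨hz, hz'⟩
      rw [mem_polySet] at hz hz'
      obtain ⟨S, hS, hz⟩ := hz
      obtain ⟨S', hS', hz'⟩ := hz'
      exact Set.mem_biUnion hS (Set.mem_biUnion hS' ⟨hz, hz'⟩)
    refine Set.Finite.subset ?_ hsub
    refine Set.Finite.biUnion (List.finite_toSet _) ?_
    intro S hS
    refine Set.Finite.biUnion (List.finite_toSet _) ?_
    intro S' hS'
    by_cases ho : SegOrth S.1 S.2 S'.1 S'.2
    · exact (orth_subsingleton ho).finite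
    · refine (Set.finite_range p).subset ?_
      rintro z ⟨hz, hz'⟩
      rcases hcr x hx x' hx' hne S hS S' hS' z hz hz' with ⟨v, h1, h2, h3⟩ | ⟨_, h1⟩
      · exact ⟨v, h3.symm⟩
      · exact absurd h1 ho
  · intro x hx x' hx' hne S hS S' hS' z hz hz' hw
    rcases hcr x hx x' hx' hne S hS S' hS' z hz hz' with ⟨v, h1, h2, h3⟩ | ⟨_, h1⟩
    · exact absurd h3 (hw v h1 h2)
    · exact h1

/-- There is an absolute constant `c` such that every bridgeless
3-regular graph with oddness `k ≥ 2` on `n` vertices admits a 1-bend RAC drawing, on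
integer grid points inside a square of side `c * n` (i.e. of `O(n²)` area), in which at
most `k` edges are drawn with a bend; all remaining edges are single straight-line
segments (their polyline consists of exactly two points). -/
theorem stmt5 :
    ∃ c : ℝ, 0 < c ∧
      ∀ (V : Type) [Fintype V] (G : SimpleGraph V) (k : ℕ),
        2 ≤ k → (∀ v : V, vdeg G v = 3) → Bridgeless G → HasOddness G k →
        ∃ (p : V → Pt) (poly : Sym2 V → List Pt),
          IsBendRACDrawing 1 G p poly ∧
          {e ∈ G.edgeSet | (poly e).length ≠ 2}.ncard ≤ k ∧
          InGridSquare (c * (Fintype.card V : ℝ)) (drawingPoints G p poly) := by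
  refine ⟨10, by norm_num, ?_⟩
  intro V _ G k _ h3 _ hodd
  obtain ⟨⟨F, hF, hk⟩, _⟩ := hodd
  obtain ⟨e, d, b, D, hG, huniq, hbo⟩ := dat_exists G h3 F hF
  obtain ⟨Z, hZ, Q⟩ := all_case D
  refine ⟨pt Z, plys e b (pt Z), draw D hG Q, ?_, ?_⟩
  · rw [← hk]
    have hbent : ∀ x ∈ {e' ∈ G.edgeSet | (plys e b (pt Z) e').length ≠ 2},
        ∃ a, BentE e b x a := by
      rintro x ⟨_, hx⟩
      rcases plys_spec e b (pt Z) x with ⟨a, h1, _⟩ | ⟨_, u, w, _, h4⟩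
      · exact ⟨a, h1⟩
      · rw [h4] at hx
        exact absurd rfl hx
    have hfin : (oddComps F).Finite := Set.toFinite _
    refine Set.ncard_le_ncard_of_injOn
      (fun x => if h : ∃ a, BentE e b x a then
        (SimpleGraph.fromEdgeSet F).connectedComponentMk h.choose
        else (SimpleGraph.fromEdgeSet F).connectedComponentMk (Quot.out x).1) ?_ ?_ hfin
    · intro x hx
      have h := hbent x hx
      simp only [dif_pos h]
      exact hbo _ h.choose_spec.2.1
    · intro x hx x' hx' heq
      have h := hbent x hx
      have h' := hbent x' hx'
      simp only [dif_pos h, dif_pos h'] at heq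
      have g := h.choose_spec
      have g' := h'.choose_spec
      have := huniq _ _ g.1 g.2.1 g'.1 g'.2.1 heq
      rw [g.2.2, g'.2.2, this]
  · have key : ∀ q ∈ drawingPoints G (pt Z) (plys e b (pt Z)),
        ∃ a c, q = ((Z false a : ℝ), (Z true c : ℝ)) := by
      rintro q (⟨a, rfl⟩ | ⟨x, hx, hq⟩)
      · exact ⟨a, a, rfl⟩
      · rcases plys_spec e b (pt Z) x with ⟨a, h1, h4⟩ | ⟨_, u, w, _, h4⟩
        · rw [h4] at hq
          simp only [List.mem_cons, List.not_mem_nil, or_false] at hq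
          rcases hq with rfl | rfl | rfl
          · exact ⟨a, a, rfl⟩
          · exact ⟨a, b a, rfl⟩
          · exact ⟨b a, b a, rfl⟩
        · rw [h4] at hq
          simp only [List.mem_cons, List.not_mem_nil, or_false] at hq
          rcases hq with rfl | rfl
          · exact ⟨u, u, rfl⟩
          · exact ⟨w, w, rfl⟩
    have hb : ∀ s a, (0 : ℝ) ≤ (Z s a : ℝ) ∧ (Z s a : ℝ) ≤ 10 * (Fintype.card V : ℝ) := by
      intro s a
      exact ⟨by exact_mod_cast (hZ s a).1, by exact_mod_cast (hZ s a).2⟩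
    refine ⟨?_, 0, 0, ?_⟩
    · intro q hq
      obtain ⟨a, c, h⟩ := key q hq
      exact ⟨_, _, h⟩
    · intro q hq
      obtain ⟨a, c, rfl⟩ := key q hq
      simp only [zero_add]
      exact ⟨(hb _ _).1, (hb _ _).2, (hb _ _).1, (hb _ _).2⟩
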